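/- Tunneling Wronskian in the Klein paradox case (Section 5): Assume V satisfies assumption (A), m > 0, E is in region III, and m²c⁴ − (V(x)−E)² has exactly two real zeros t₁(E) < t₂(E), both simple. Then W(ω_out^+, ω_in^+) = −2, and there exists a classical analytic symbol φ of non-negative order such that W(ω_in^−, ω_in^+) = −2(1 + hφ(h))·exp{(1/h)(z(t₁(E),−∞) + z(t₂(E),+∞) + S(E))}, where S(E) = ∫_{t₁(E)}^{t₂(E)} √((m²c⁴ − (E−V(t))²)/c²) dt and z(t₁(E),−∞), z(t₂(E),+∞) are the purely imaginary phases z(x,±∞) = i∫_{±∞}^{x} (√(((E−V(t))² − m²c⁴)/c²) − √(((E−V^±)² − m²c⁴)/c²)) dt + i√(((E−V^±)² − m²c⁴)/c²)·x evaluated at x = t₁(E), t₂(E) respectively. -/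

import Mathlib

open Complex Filter Topology MeasureTheory Set

noncomputable section

/-- The sector `𝒮 = {x ∈ ℂ : |Im x| < ε|Re x| + η}`. -/
def Sector (ε η : ℝ) : Set ℂ := {x : ℂ | |x.im| < ε * |x.re| + η}

/-- Assumption (A): `V` is real on the real axis, analytic in a sector `𝒮`
around the real axis, and tends to constants `V^±` at `±∞` in `𝒮` at rate
`⟨x⟩^{-δ}`, `δ > 1`, with `V⁻ < V⁺`. -/
structure AssumptionA (V : ℂ → ℂ) (Vm Vp : ℝ) : Prop where
  lt : Vm < Vp
  real_on_real : ∀ x : ℝ, (V x).im = 0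
  sector : ∃ ε > (0 : ℝ), ∃ η > (0 : ℝ), ∃ δ > (1 : ℝ),
    AnalyticOnNhd ℂ V (Sector ε η) ∧
    (∃ C R : ℝ, ∀ x ∈ Sector ε η, R ≤ x.re →
      ‖V x - (Vp : ℂ)‖ ≤ C * (1 + ‖x‖ ^ 2) ^ (-(δ / 2))) ∧
    (∃ C R : ℝ, ∀ x ∈ Sector ε η, x.re ≤ -R →
      ‖V x - (Vm : ℂ)‖ ≤ C * (1 + ‖x‖ ^ 2) ^ (-(δ / 2)))

/-- `u = (u₁,u₂)` solves the one-dimensional Dirac equation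
`(-i h c σ₁ d/dx + m c² σ₃ + V(x) I₂) u = E u` on `ℝ`. -/
structure IsDiracSolution (hp m c : ℝ) (V : ℂ → ℂ) (E : ℝ) (u : ℝ → ℂ × ℂ) : Prop where
  diff1 : Differentiable ℝ fun x : ℝ => (u x).1
  diff2 : Differentiable ℝ fun x : ℝ => (u x).2
  eq1 : ∀ x : ℝ,
    -Complex.I * (hp : ℂ) * (c : ℂ) * deriv (fun y : ℝ => (u y).2) x
      + ((m : ℂ) * (c : ℂ) ^ 2 + V x) * (u x).1 = (E : ℂ) * (u x).1
  eq2 : ∀ x : ℝ,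
    -Complex.I * (hp : ℂ) * (c : ℂ) * deriv (fun y : ℝ => (u y).1) x
      + (-((m : ℂ) * (c : ℂ) ^ 2) + V x) * (u x).2 = (E : ℂ) * (u x).2

/-- `Φ(λ) = sgn(λ) √(λ² − m²c⁴)`. -/
def PhiF (m c lam : ℝ) : ℝ := Real.sign lam * Real.sqrt (lam ^ 2 - m ^ 2 * c ^ 4)

/-- `A(λ) = ((λ + mc²)/(λ − mc²))^{1/4}`. -/
def AmpF (m c lam : ℝ) : ℝ := ((lam + m * c ^ 2) / (lam - m * c ^ 2)) ^ ((1 : ℝ) / 4)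

/-- `u(x)` behaves exactly like `e^{θ x} v` along the filter `l`,
i.e. `u(x) e^{-θ x} → v`. -/
def JostAsymp (u : ℝ → ℂ × ℂ) (θ : ℂ) (v : ℂ × ℂ) (l : Filter ℝ) : Prop :=
  Tendsto (fun x : ℝ => (u x).1 * Complex.exp (-(θ * (x : ℂ)))) l (𝓝 v.1) ∧
  Tendsto (fun x : ℝ => (u x).2 * Complex.exp (-(θ * (x : ℂ)))) l (𝓝 v.2)

/-- `u` behaves exactly like `exp(s (i/(hc)) Φ(E−V₀) x) · (A(E−V₀), s' A(E−V₀)⁻¹)`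
along `l`.  The Jost solutions `ω_in^±` correspond to `s = s' = ∓1`, `l = at±∞`,
and `ω_out^±` to `s = s' = ±1`, `l = at±∞`. -/
def JostCond (hp m c E V0 s s' : ℝ) (l : Filter ℝ) (u : ℝ → ℂ × ℂ) : Prop :=
  JostAsymp u ((s : ℂ) * Complex.I / ((hp : ℂ) * (c : ℂ)) * ((PhiF m c (E - V0) : ℝ) : ℂ))
    (((AmpF m c (E - V0) : ℝ) : ℂ), (s' : ℂ) * (((AmpF m c (E - V0) : ℝ) : ℂ))⁻¹) l

/-- `B^± = ((mc² + E − V^±)/(mc² − E + V^±))^{1/4}`. -/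
def Bsym (m c E W : ℝ) : ℝ := ((m * c ^ 2 + E - W) / (m * c ^ 2 - E + W)) ^ ((1 : ℝ) / 4)

/-- The decaying Jost solution `ω_d^±` (for `s = ±1`, `l = at±∞`):
`ω_d^± ~ exp(∓ (1/(hc)) √(m²c⁴ − (V^± − E)²) x) (∓ i B^±, (B^±)⁻¹)`. -/
def DecayCond (hp m c E W s : ℝ) (l : Filter ℝ) (u : ℝ → ℂ × ℂ) : Prop :=
  JostAsymp u (-(s : ℂ) * ((Real.sqrt (m ^ 2 * c ^ 4 - (W - E) ^ 2) : ℝ) : ℂ) / ((hp : ℂ) * (c : ℂ)))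
    (-(s : ℂ) * Complex.I * ((Bsym m c E W : ℝ) : ℂ), (((Bsym m c E W : ℝ) : ℂ))⁻¹) l

/-- The defining relation `(ω_in^−, ω_in^+) = (ω_out^+, ω_out^−) · 𝕊` of the
scattering matrix. -/
def ScatRel (ωinm ωinp ωoutp ωoutm : ℝ → ℂ × ℂ) (S : Matrix (Fin 2) (Fin 2) ℂ) : Prop :=
  (∀ x : ℝ, ωinm x = S 0 0 • ωoutp x + S 1 0 • ωoutm x) ∧
  (∀ x : ℝ, ωinp x = S 0 1 • ωoutp x + S 1 1 • ωoutm x)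

/-- A classical analytic symbol (of non-negative order `mo`) in the semiclassical
parameter `h`: there are coefficients `a j` with `‖a j‖ ≤ C^{j+1} j^j` such that
`f(h) − ∑_{0 ≤ j ≤ h⁻¹/(e C₁)} a j h^{mo+j}` is `O(e^{-ρ/h})` for every `C₁ > C`. -/
def IsCAS (f : ℝ → ℂ) : Prop :=
  ∃ (mo : ℕ) (a : ℕ → ℂ) (C : ℝ), 0 < C ∧
    (∀ j : ℕ, ‖a j‖ ≤ C ^ (j + 1) * (j : ℝ) ^ j) ∧
    ∀ C₁ : ℝ, C < C₁ → ∃ ρ > (0 : ℝ), ∃ M : ℝ,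
      ∀ h : ℝ, 0 < h → h < 1 →
        ‖f h - ∑ j ∈ Finset.range (⌊1 / (h * Real.exp 1 * C₁)⌋₊ + 1), a j * (h : ℂ) ^ (mo + j)‖
          ≤ M * Real.exp (-ρ / h)

/-- `E^± = (−m²c⁴ + (V^± − E)²)/c²`. -/
def Esym (m c E W : ℝ) : ℝ := (-(m ^ 2 * c ^ 4) + (W - E) ^ 2) / c ^ 2

/-- `Q^±(t,E) = √((−m²c⁴ + (V(t) − E)²)/c²) − √(E^±)` (here `W = V^±`). -/
def Qsym (m c E W : ℝ) (V : ℂ → ℂ) (t : ℝ) : ℝ :=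
  Real.sqrt ((-(m ^ 2 * c ^ 4) + ((V t).re - E) ^ 2) / c ^ 2) - Real.sqrt (Esym m c E W)

/-- `Q₋^±(t,E) = √((m²c⁴ − (V(t) − E)²)/c²) − √(−E^±)` (here `W = V^±`). -/
def Qminus (m c E W : ℝ) (V : ℂ → ℂ) (t : ℝ) : ℝ :=
  Real.sqrt ((m ^ 2 * c ^ 4 - ((V t).re - E) ^ 2) / c ^ 2) - Real.sqrt (-(Esym m c E W))

/-- The classical action `S(E)` between the turning points. -/
def SAct (m c E : ℝ) (V : ℂ → ℂ) (t₁ t₂ : ℝ) : ℝ :=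
  ∫ t in t₁..t₂, Real.sqrt ((m ^ 2 * c ^ 4 - ((V t).re - E) ^ 2) / c ^ 2)

/-- The phase `T(E)`. -/
def TPhase (m c E Vm Vp : ℝ) (V : ℂ → ℂ) (t₁ t₂ : ℝ) : ℝ :=
  (∫ t in Set.Iic t₁, Qsym m c E Vm V t) - (∫ t in Set.Ici t₂, Qsym m c E Vp V t)
    + t₁ * Real.sqrt (Esym m c E Vm) + t₂ * Real.sqrt (Esym m c E Vp)

/-- The Wronskian of two vectors in `ℂ²`. -/
def Wron (u v : ℂ × ℂ) : ℂ := u.1 * v.2 - u.2 * v.1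

end

namespace KleinTunneling

/-- The open horizontal strip `a < Im x < b`. -/
def HStrip (a b : ℝ) : Set ℂ := {x : ℂ | a < x.im ∧ x.im < b}

lemma isOpen_HStrip (a b : ℝ) : IsOpen (HStrip a b) :=
  (isOpen_lt continuous_const Complex.continuous_im).inter
    (isOpen_lt Complex.continuous_im continuous_const)

lemma convex_HStrip (a b : ℝ) : Convex ℝ (HStrip a b) :=
  (convex_halfSpace_im_gt a).inter (convex_halfSpace_im_lt b)

lemma HStrip_mono {a b a' b' : ℝ} (ha : a' ≤ a) (hb : b ≤ b') : HStrip a b ⊆ HStrip a' b' :=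
  fun _ hx => ⟨ha.trans_lt hx.1, hx.2.trans_le hb⟩

/-- A positive integrable weight on the line, slowly varying at unit scale. -/
structure IsWeight (w : ℝ → ℝ) : Prop where
  pos : ∀ s, 0 < w s
  le_one : ∀ s, w s ≤ 1
  cont : Continuous w
  int : Integrable w
  tendsto_bot : Tendsto w atBot (𝓝 0)
  tendsto_top : Tendsto w atTop (𝓝 0)
  shift : ∃ K, 1 ≤ K ∧ ∀ s t, |t| ≤ 1 → w (s + t) ≤ K * w s

lemma im_mem_of_dist {x y : ℂ} {d : ℝ} (h : dist y x ≤ d) :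
    x.im - d ≤ y.im ∧ y.im ≤ x.im + d ∧ |y.re - x.re| ≤ d := by
  rw [Complex.dist_eq] at h
  have h1 := (Complex.abs_im_le_norm (y - x)).trans h
  have h2 := (Complex.abs_re_le_norm (y - x)).trans h
  rw [Complex.sub_im, abs_le] at h1
  rw [Complex.sub_re] at h2
  exact ⟨by linarith, by linarith, h2⟩

/-- Weighted Cauchy estimate on a strip. -/
lemma norm_deriv_le_weight {w : ℝ → ℝ} {f : ℂ → ℂ} {a b d F K : ℝ} (hd : 0 < d) (hd1 : d ≤ 1)
    (hF : 0 ≤ F) (hK : ∀ s t, |t| ≤ 1 → w (s + t) ≤ K * w s)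
    (hf : DifferentiableOn ℂ f (HStrip a b))
    (hb : ∀ x ∈ HStrip a b, ‖f x‖ ≤ F * w x.re) {x : ℂ} (hx : x ∈ HStrip (a + d) (b - d)) :
    ‖deriv f x‖ ≤ F * K / d * w x.re := by
  have hsub : Metric.closedBall x d ⊆ HStrip a b := fun y hy => by
    obtain ⟨h1, h2, -⟩ := im_mem_of_dist hy
    exact ⟨by linarith [hx.1], by linarith [hx.2]⟩
  have h := Complex.norm_deriv_le_of_forall_mem_sphere_norm_le (f := f) (C := F * (K * w x.re)) hd
    ((hf.mono hsub).diffContOnCl_ball subset_rfl) (fun z hz => ?_)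
  · calc _ ≤ _ := h
      _ = _ := by ring
  · have hz' := Metric.sphere_subset_closedBall hz
    refine (hb z (hsub hz')).trans (mul_le_mul_of_nonneg_left ?_ hF)
    have := hK x.re (z.re - x.re) ((im_mem_of_dist hz').2.2.trans hd1)
    simpa using this

/-- Primitive from `-∞` along horizontal lines. -/
noncomputable def prim (f : ℂ → ℂ) (x : ℂ) : ℂ := ∫ t in Iic (0 : ℝ), f (x + t)

lemma integrableOn_line {w : ℝ → ℝ} (hw : IsWeight w) {f : ℂ → ℂ} {a b F : ℝ}
    (hf : ContinuousOn f (HStrip a b))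
    (hb : ∀ x ∈ HStrip a b, ‖f x‖ ≤ F * w x.re) {x : ℂ} (hx : x ∈ HStrip a b) :
    Integrable (fun t : ℝ => f (x + t)) := by
  have hmem : ∀ t : ℝ, x + t ∈ HStrip a b := fun t => by simpa [HStrip] using hx
  refine ((hw.int.comp_add_left x.re).const_mul F).mono' ?_ (Eventually.of_forall fun t => ?_)
  · exact (hf.comp_continuous (by fun_prop) hmem).aestronglyMeasurable
  · simpa using hb _ (hmem t)

lemma norm_prim_le {w : ℝ → ℝ} (hw : IsWeight w) {f : ℂ → ℂ} {a b F : ℝ}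
    (hb : ∀ x ∈ HStrip a b, ‖f x‖ ≤ F * w x.re) {x : ℂ} (hx : x ∈ HStrip a b) :
    ‖prim f x‖ ≤ F * ∫ t in Iic x.re, w t := by
  have hmem : ∀ t : ℝ, x + t ∈ HStrip a b := fun t => by simpa [HStrip] using hx
  have : ∫ t in Iic x.re, w t = ∫ t in Iic (0 : ℝ), w (x.re + t) := by
    rw [← (measurePreserving_add_left volume x.re).setIntegral_preimage_emb
      (measurableEmbedding_addLeft _) w (Iic x.re)]
    simp [preimage_const_add_Iic]
  rw [this, ← integral_const_mul]
  refine norm_integral_le_of_norm_le ((hw.int.comp_add_left x.re).const_mul F).integrableOn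
    (Eventually.of_forall fun t => ?_)
  simpa using hb _ (hmem t)

lemma hasDerivAt_prim {w : ℝ → ℝ} (hw : IsWeight w) {f : ℂ → ℂ} {a b F : ℝ} (hF : 0 ≤ F)
    (hf : DifferentiableOn ℂ f (HStrip a b))
    (hb : ∀ x ∈ HStrip a b, ‖f x‖ ≤ F * w x.re) {x : ℂ} (hx : x ∈ HStrip a b) :
    HasDerivAt (prim f) (f x) x := by
  obtain ⟨K, hK1, hK⟩ := hw.shift
  obtain ⟨d, hd, hd1, hda, hdb⟩ : ∃ d > 0, d ≤ 1 ∧ a + d < x.im - d ∧ x.im + d < b - d := by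
    refine ⟨min 1 (min ((x.im - a) / 3) ((b - x.im) / 3)), ?_, min_le_left _ _, ?_, ?_⟩
    · have := hx.1; have := hx.2
      refine lt_min one_pos (lt_min ?_ ?_) <;> linarith
    · have := hx.1
      have := (min_le_right 1 (min ((x.im - a) / 3) ((b - x.im) / 3))).trans (min_le_left _ _)
      linarith
    · have := hx.2
      have := (min_le_right 1 (min ((x.im - a) / 3) ((b - x.im) / 3))).trans (min_le_right _ _)
      linarith
  have hball : ∀ y ∈ Metric.ball x d, ∀ t : ℝ, y + t ∈ HStrip (a + d) (b - d) := fun y hy t => by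
    obtain ⟨h1, h2, -⟩ := im_mem_of_dist (le_of_lt hy)
    exact ⟨by simp; linarith, by simp; linarith⟩
  have hsub : HStrip (a + d) (b - d) ⊆ HStrip a b := HStrip_mono (by linarith) (by linarith)
  have hdf : DifferentiableOn ℂ (deriv f) (HStrip a b) := hf.deriv (isOpen_HStrip a b)
  have hda : ∀ y ∈ HStrip a b, HasDerivAt f (deriv f y) y := fun y hy =>
    (hf.differentiableAt ((isOpen_HStrip a b).mem_nhds hy)).hasDerivAt
  have hwint := hw.int.comp_add_left x.re
  have key := hasDerivAt_integral_of_dominated_loc_of_deriv_le (μ := volume.restrict (Iic (0 : ℝ)))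
    (F := fun y (t : ℝ) => f (y + t)) (F' := fun y (t : ℝ) => deriv f (y + t)) (x₀ := x)
    (s := Metric.ball x d) (bound := fun t => F * K / d * K * w (x.re + t))
    (Metric.ball_mem_nhds x hd) ?_ ?_ ?_ ?_ ?_ ?_
  · have hlim : Tendsto (fun t : ℝ => f (x + t)) atBot (𝓝 0) := by
      have h0 : Tendsto (fun t : ℝ => F * w (x.re + t)) atBot (𝓝 0) := by
        simpa using (hw.tendsto_bot.comp (tendsto_atBot_add_const_left atBot x.re
          tendsto_id)).const_mul F
      refine squeeze_zero_norm (fun t => ?_) h0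
      simpa using hb (x + t) (hsub (hball x (Metric.mem_ball_self hd) t))
    have := integral_Iic_of_hasDerivAt_of_tendsto' (a := 0) (f := fun t : ℝ => f (x + t))
      (f' := fun t : ℝ => deriv f (x + t)) (m := 0) (fun t _ => ?_) key.1 hlim
    · have hkey := key.2
      rw [this] at hkey
      simp only [Complex.ofReal_zero, add_zero, sub_zero] at hkey
      exact hkey
    · have h1 := hda (x + t) (hsub (hball x (Metric.mem_ball_self hd) t))
      have h2 : HasDerivAt (fun t : ℝ => x + (t : ℂ)) 1 t := by
        simpa using (Complex.ofRealCLM.hasDerivAt (x := t)).const_add x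
      simpa [Function.comp_def] using h1.scomp t h2
  · filter_upwards [Metric.ball_mem_nhds x hd] with y hy
    exact (integrableOn_line hw hf.continuousOn hb
      (by simpa using hsub (hball y hy 0))).aestronglyMeasurable.restrict
  · exact (integrableOn_line hw hf.continuousOn hb hx).integrableOn
  · exact (hdf.continuousOn.comp_continuous (by fun_prop) (fun t =>
      hsub (hball x (Metric.mem_ball_self hd) t))).aestronglyMeasurable
  · refine Eventually.of_forall fun t y hy => ?_
    have h1 := norm_deriv_le_weight hd hd1 hF hK hf hb (hball y hy t)
    have h2 := hK (x.re + t) (y.re - x.re) ((im_mem_of_dist (le_of_lt hy)).2.2.trans hd1)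
    have h3 : (y + (t : ℂ)).re = x.re + t + (y.re - x.re) := by simp; ring
    rw [h3] at h1
    refine h1.trans ?_
    rw [mul_assoc]
    exact mul_le_mul_of_nonneg_left h2 (by positivity)
  · exact (hwint.const_mul _).integrableOn
  · refine Eventually.of_forall fun t y hy => ?_
    exact (hda (y + t) (hsub (hball y hy t))).comp_add_const y t

lemma tendsto_integral_Iic_atBot {w : ℝ → ℝ} (hw : IsWeight w) :
    Tendsto (fun s => ∫ t in Iic s, w t) atBot (𝓝 0) := by
  have h := hw.int.integrableOn (s := Iic 0)
  have h1 := intervalIntegral_tendsto_integral_Iic (f := w) 0 h tendsto_id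
  have h2 : (fun s => ∫ t in Iic s, w t) =
      fun s => (∫ t in Iic (0:ℝ), w t) - ∫ t in s..0, w t := by
    funext s
    have := intervalIntegral.integral_Iic_sub_Iic (f := w) (μ := volume) (a := s) (b := 0)
      hw.int.integrableOn hw.int.integrableOn
    linarith
  rw [h2]
  simpa using h1.const_sub (∫ t in Iic (0:ℝ), w t)

lemma hasDerivAt_integral_Iic {w : ℝ → ℝ} (hw : IsWeight w) (s : ℝ) :
    HasDerivAt (fun s => ∫ t in Iic s, w t) (w s) s := by
  have h2 : (fun s => ∫ t in Iic s, w t) =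
      fun s => (∫ t in Iic (0:ℝ), w t) + ∫ t in (0:ℝ)..s, w t := by
    funext s
    have := intervalIntegral.integral_Iic_sub_Iic (f := w) (μ := volume) (a := 0) (b := s)
      hw.int.integrableOn hw.int.integrableOn
    linarith
  rw [h2]
  exact (intervalIntegral.integral_hasDerivAt_right (hw.cont.intervalIntegrable _ _)
    hw.cont.stronglyMeasurable.stronglyMeasurableAtFilter hw.cont.continuousAt).const_add _

lemma integral_Iic_nonneg {w : ℝ → ℝ} (hw : IsWeight w) (s : ℝ) : 0 ≤ ∫ t in Iic s, w t :=
  setIntegral_nonneg measurableSet_Iic fun t _ => (hw.pos t).le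

lemma integral_Iic_le {w : ℝ → ℝ} (hw : IsWeight w) (s : ℝ) :
    ∫ t in Iic s, w t ≤ ∫ t, w t :=
  setIntegral_le_integral hw.int (Eventually.of_forall fun t => (hw.pos t).le)

/-- Energy estimate for the transport system from `-∞`. -/
lemma energy_estimate {w : ℝ → ℝ} (hw : IsWeight w) {Γ ρ : ℝ} (hΓ : 0 ≤ Γ)
    {u v α β R : ℝ → ℂ}
    (hu : ∀ s, HasDerivAt u (-(α s * v s)) s)
    (hv : ∀ s, HasDerivAt v (-(β s * v s + α s * u s) + R s) s)
    (hα : ∀ s, ‖α s‖ ≤ Γ * w s) (hβ : ∀ s, 0 ≤ (β s).re) (hR : ∀ s, ‖R s‖ ≤ ρ * w s)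
    (hu0 : Tendsto u atBot (𝓝 0)) (hv0 : Tendsto v atBot (𝓝 0)) (s : ℝ) :
    ‖u s‖ ^ 2 + ‖v s‖ ^ 2 ≤ Real.exp ((2 * Γ + 1) * ∫ t, w t) * (ρ ^ 2 * ∫ t, w t) := by
  set Ω : ℝ → ℝ := fun s => ∫ t in Iic s, w t with hΩ
  set k := 2 * Γ + 1 with hk
  set n : ℝ → ℝ := fun s => ‖u s‖ ^ 2 + ‖v s‖ ^ 2 with hn
  have hn' : ∀ s, ∃ n', HasDerivAt n n' s ∧ n' ≤ k * w s * n s + ρ ^ 2 * w s := by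
    intro s
    refine ⟨_, (hu s).norm_sq.add (hv s).norm_sq, ?_⟩
    have e1 : (inner ℝ (u s) (-(α s * v s)) : ℝ) ≤ Γ * w s * (‖u s‖ * ‖v s‖) := by
      refine (real_inner_le_norm _ _).trans ?_
      rw [norm_neg, norm_mul]
      have := mul_le_mul_of_nonneg_right (hα s) (by positivity : 0 ≤ ‖u s‖ * ‖v s‖)
      linarith
    have e2 : (inner ℝ (v s) (-(β s * v s + α s * u s) + R s) : ℝ) ≤
        Γ * w s * (‖u s‖ * ‖v s‖) + ‖v s‖ * (ρ * w s) := by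
      have h1 : (inner ℝ (v s) (-(β s * v s + α s * u s) + R s) : ℝ) =
          -(inner ℝ (v s) (β s * v s)) + inner ℝ (v s) (-(α s * u s)) + inner ℝ (v s) (R s) := by
        rw [← inner_neg_right, ← inner_add_right, ← inner_add_right]; congr 1; ring
      have h2 : (0 : ℝ) ≤ inner ℝ (v s) (β s * v s) := by
        have : (inner ℝ (v s) (β s * v s) : ℝ) = (β s).re * ‖v s‖ ^ 2 := by
          rw [Complex.inner, ← Complex.normSq_eq_norm_sq, Complex.normSq_apply]
          simp; ring
        rw [this]; exact mul_nonneg (hβ s) (by positivity)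
      have h3 : (inner ℝ (v s) (-(α s * u s)) : ℝ) ≤ Γ * w s * (‖u s‖ * ‖v s‖) := by
        refine (real_inner_le_norm _ _).trans ?_
        rw [norm_neg, norm_mul]
        have := mul_le_mul_of_nonneg_right (hα s) (by positivity : 0 ≤ ‖u s‖ * ‖v s‖)
        linarith
      have h4 : (inner ℝ (v s) (R s) : ℝ) ≤ ‖v s‖ * (ρ * w s) :=
        (real_inner_le_norm _ _).trans (mul_le_mul_of_nonneg_left (hR s) (norm_nonneg _))
      linarith
    have hp := (hw.pos s).le
    have e3 : 0 ≤ Γ * w s * (‖u s‖ - ‖v s‖) ^ 2 := by positivity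
    have e4 : 0 ≤ w s * (‖v s‖ - ρ) ^ 2 := by positivity
    have e5 : 0 ≤ w s * ‖u s‖ ^ 2 := by positivity
    simp only [hn, hk]
    nlinarith
  have hmono : Antitone fun s => n s * Real.exp (-(k * Ω s)) - ρ ^ 2 * Ω s := by
    have hd : ∀ s, ∃ d', HasDerivAt (fun s => n s * Real.exp (-(k * Ω s)) - ρ ^ 2 * Ω s) d' s
        ∧ d' ≤ 0 := by
      intro s
      obtain ⟨n', h1, h2⟩ := hn' s
      have hΩs := hasDerivAt_integral_Iic hw s
      refine ⟨_, (h1.mul ((hΩs.const_mul k).neg.exp)).sub (hΩs.const_mul (ρ ^ 2)), ?_⟩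
      have hp := (hw.pos s).le
      have hk0 : 0 ≤ k := by positivity
      have hexp : Real.exp (-(k * Ω s)) ≤ 1 := by
        rw [Real.exp_le_one_iff]
        have := mul_nonneg hk0 (integral_Iic_nonneg hw s)
        simp only [hΩ]; linarith
      have he0 := (Real.exp_pos (-(k * Ω s))).le
      have q1 := mul_le_mul_of_nonneg_right h2 he0
      have q2 := mul_le_mul_of_nonneg_left hexp (by positivity : 0 ≤ ρ ^ 2 * w s)
      simp only [Pi.neg_apply]
      nlinarith
    refine antitone_of_deriv_nonpos (fun s => ?_) (fun s => ?_)
    · obtain ⟨d', h, -⟩ := hd s; exact h.differentiableAt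
    · obtain ⟨d', h, h'⟩ := hd s; rw [h.deriv]; exact h'
  have hlim : Tendsto (fun s => n s * Real.exp (-(k * Ω s)) - ρ ^ 2 * Ω s) atBot (𝓝 0) := by
    have hΩ0 := tendsto_integral_Iic_atBot hw
    have h1 : Tendsto n atBot (𝓝 0) := by
      simpa using (hu0.norm.pow 2).add (hv0.norm.pow 2)
    have h2 := (Real.continuous_exp.tendsto _).comp ((hΩ0.const_mul k).neg)
    simpa using (h1.mul h2).sub (hΩ0.const_mul (ρ ^ 2))
  have h0 := hmono.ge_of_tendsto hlim s
  have hk0 : 0 ≤ k := by positivity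
  have hI := integral_Iic_le hw s
  have hI0 := integral_Iic_nonneg hw s
  have h1 : n s * Real.exp (-(k * Ω s)) ≤ ρ ^ 2 * ∫ t, w t := by
    have := mul_le_mul_of_nonneg_left hI (sq_nonneg ρ)
    simp only [hΩ] at h0 ⊢; linarith
  have h2 : n s ≤ Real.exp (k * Ω s) * (ρ ^ 2 * ∫ t, w t) := by
    have := mul_le_mul_of_nonneg_left h1 (Real.exp_pos (k * Ω s)).le
    rwa [mul_left_comm, ← Real.exp_add, add_neg_cancel, Real.exp_zero, mul_one] at this
  have h3 : Real.exp (k * Ω s) ≤ Real.exp (k * ∫ t, w t) :=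
    Real.exp_le_exp.2 (mul_le_mul_of_nonneg_left hI hk0)
  have h4 : 0 ≤ ρ ^ 2 * ∫ t, w t := mul_nonneg (sq_nonneg _) (hI0.trans hI)
  exact h2.trans (mul_le_mul_of_nonneg_right h3 h4)

/-- Formal solution `(∑ eⱼ hʲ, ∑ oⱼ hʲ)` of the transport system. -/
noncomputable def tCoeff (g κ : ℂ → ℂ) : ℕ → (ℂ → ℂ) × (ℂ → ℂ)
  | 0 => (fun _ => 1, fun _ => 0)
  | j + 1 =>
    (fun x => -prim (fun y => g y *
        (-(g y * (tCoeff g κ j).1 y + deriv (tCoeff g κ j).2 y) / (2 * κ y))) x,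
      fun y => -(g y * (tCoeff g κ j).1 y + deriv (tCoeff g κ j).2 y) / (2 * κ y))

/-- Data for the transport system on the strip `y₀ - r < Im x < y₁ + r`. -/
structure TransData (w : ℝ → ℝ) (g κ : ℂ → ℂ) (y₀ y₁ r G K₀ : ℝ) : Prop where
  weight : IsWeight w
  r_pos : 0 < r
  r_le : r ≤ 1
  G_nonneg : 0 ≤ G
  K₀_nonneg : 0 ≤ K₀
  diff_g : DifferentiableOn ℂ g (HStrip (y₀ - r) (y₁ + r))
  diff_κ : DifferentiableOn ℂ κ (HStrip (y₀ - r) (y₁ + r))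
  κ_ne : ∀ x ∈ HStrip (y₀ - r) (y₁ + r), κ x ≠ 0
  bound_g : ∀ x ∈ HStrip (y₀ - r) (y₁ + r), ‖g x‖ ≤ G * w x.re
  bound_κ_inv : ∀ x ∈ HStrip (y₀ - r) (y₁ + r), ‖(κ x)⁻¹‖ ≤ K₀

lemma exists_mem_smaller_strip {y₀ y₁ r : ℝ} (hr : 0 < r) {x : ℂ}
    (hx : x ∈ HStrip (y₀ - r) (y₁ + r)) :
    ∃ t, 0 ≤ t ∧ t < r ∧ x ∈ HStrip (y₀ - t) (y₁ + t) := by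
  obtain ⟨h1, h2⟩ := hx
  obtain ⟨t, ht1, ht2⟩ := exists_between
    (show max 0 (max (y₀ - x.im) (x.im - y₁)) < r from
      max_lt hr (max_lt (by linarith) (by linarith)))
  have h3 := (le_max_left _ _).trans_lt ht1
  have h4 := (le_max_right _ _).trans_lt ht1
  have h5 := (le_max_left _ _).trans_lt h4
  have h6 := (le_max_right _ _).trans_lt h4
  exact ⟨t, h3.le, ht2, by linarith, by linarith⟩

namespace TransData

variable {w : ℝ → ℝ} {g κ : ℂ → ℂ} {y₀ y₁ r G K₀ : ℝ}

/-- The Gevrey bounds on the coefficients. -/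
lemma coeff_bound (h : TransData w g κ y₀ y₁ r G K₀) :
    ∃ B D : ℝ, 1 ≤ B ∧ 1 ≤ D ∧ ∀ j : ℕ,
      DifferentiableOn ℂ (tCoeff g κ j).1 (HStrip (y₀ - r) (y₁ + r)) ∧
      DifferentiableOn ℂ (tCoeff g κ j).2 (HStrip (y₀ - r) (y₁ + r)) ∧
      ∀ t, 0 ≤ t → t < r → ∀ x ∈ HStrip (y₀ - t) (y₁ + t),
        ‖(tCoeff g κ j).1 x‖ ≤ D * (B * j / (r - t)) ^ j ∧
        ‖(tCoeff g κ j).2 x‖ ≤ (B * j / (r - t)) ^ j * w x.re := by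
  have hw := h.weight
  have hG := h.G_nonneg
  have hK₀ := h.K₀_nonneg
  obtain ⟨K, hK1, hK⟩ := hw.shift
  set I := ∫ t, w t with hI
  have hI0 : 0 ≤ I := (integral_Iic_nonneg hw 0).trans (integral_Iic_le hw 0)
  set D := 1 + G * I with hD
  have hD1 : 1 ≤ D := by have := mul_nonneg hG hI0; linarith
  set B := 1 + K₀ * (G * D + 2 * K) with hB
  have hB1 : 1 ≤ B := by
    have : 0 ≤ K₀ * (G * D + 2 * K) := by positivity
    linarith
  refine ⟨B, D, hB1, hD1, fun j => ?_⟩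
  induction j with
  | zero =>
    refine ⟨differentiableOn_const _, differentiableOn_const _, fun t _ _ x _ => ⟨?_, ?_⟩⟩
    · simpa [tCoeff] using hD1
    · simpa [tCoeff] using (hw.pos _).le
  | succ j ih =>
    obtain ⟨hde, hdo, hbd⟩ := ih
    have hopen := isOpen_HStrip (y₀ - r) (y₁ + r)
    have hdo' : DifferentiableOn ℂ (tCoeff g κ (j + 1)).2 (HStrip (y₀ - r) (y₁ + r)) := by
      simp only [tCoeff]
      exact (((h.diff_g.mul hde).add (hdo.deriv hopen)).neg).div (h.diff_κ.const_mul 2)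
        fun x hx => mul_ne_zero two_ne_zero (h.κ_ne x hx)
    have hbo : ∀ t, 0 ≤ t → t < r → ∀ x ∈ HStrip (y₀ - t) (y₁ + t),
        ‖(tCoeff g κ (j + 1)).2 x‖ ≤ (B * (j + 1 : ℕ) / (r - t)) ^ (j + 1) * w x.re := by
      intro t ht htr x hx
      set τ := r - t with hτ
      have hτ0 : 0 < τ := by linarith
      have hτ1 : τ ≤ 1 := by have := h.r_le; linarith
      set d := τ / (j + 2) with hd
      have hj2 : (0 : ℝ) < j + 2 := by positivity
      have hd0 : 0 < d := by positivity
      have hdτ : d < τ := by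
        rw [hd, div_lt_iff₀ hj2]; nlinarith [(Nat.cast_nonneg j : (0:ℝ) ≤ j)]
      have hxr : x ∈ HStrip (y₀ - r) (y₁ + r) := HStrip_mono (by linarith) (by linarith) hx
      have hx' : x ∈ HStrip (y₀ - (t + d) + d) (y₁ + (t + d) - d) := by
        convert hx using 2 <;> ring
      set X := (B * (j + 1 : ℕ) / τ) with hX
      have hX0 : 0 ≤ X := by positivity
      have hBX : B ≤ X := by
        rw [hX, le_div_iff₀ hτ0]; push_cast
        nlinarith [(Nat.cast_nonneg j : (0:ℝ) ≤ j)]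
      have hM1 : (B * j / (r - (t + d))) ^ j ≤ X ^ j := by
        refine pow_le_pow_left₀ (div_nonneg (by positivity) (by linarith)) ?_ _
        have h1 : r - (t + d) = τ * (j + 1) / (j + 2) := by
          rw [hd]; field_simp; linarith
        rw [h1, hX, div_div_eq_mul_div, div_le_div_iff₀ (by positivity) hτ0]
        push_cast
        nlinarith [mul_pos hτ0 (by linarith : 0 < B)]
      have hM2 : (B * j / τ) ^ j ≤ X ^ j := by
        refine pow_le_pow_left₀ (by positivity) ?_ _
        rw [hX]; gcongr; linarith
      have hder := norm_deriv_le_weight (w := w) (F := X ^ j) hd0 (by linarith) (by positivity) hK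
        (hdo.mono (HStrip_mono (by linarith) (by linarith)))
        (fun y hy => ((hbd (t + d) (by linarith) (by linarith) y hy).2).trans
          (mul_le_mul_of_nonneg_right hM1 (hw.pos _).le)) hx'
      have hder2 : ‖deriv (tCoeff g κ j).2 x‖ ≤ 2 * K * (X ^ (j + 1) / B) * w x.re := by
        refine hder.trans (mul_le_mul_of_nonneg_right ?_ (hw.pos _).le)
        have h1 : X ^ j * K / d = K * X ^ j * ((j + 2) / τ) := by rw [hd]; field_simp
        have h2 : (j + 2 : ℝ) / τ ≤ 2 * (X / B) := by
          rw [hX]; push_cast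
          rw [div_le_iff₀ hτ0]; field_simp; linarith [(Nat.cast_nonneg j : (0:ℝ) ≤ j)]
        rw [h1, pow_succ]
        calc _ ≤ K * X ^ j * (2 * (X / B)) := by gcongr
          _ = _ := by ring
      have hge : ‖g x * (tCoeff g κ j).1 x‖ ≤ G * D * (X ^ (j + 1) / B) * w x.re := by
        rw [norm_mul]
        have h1 := h.bound_g x hxr
        have h2 := ((hbd t ht htr x hx).1).trans
          (mul_le_mul_of_nonneg_left hM2 (by linarith))
        have h3 : X ^ j ≤ X ^ (j + 1) / B := by
          rw [le_div_iff₀ (by linarith), pow_succ]; gcongr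
        have hp := (hw.pos x.re).le
        calc _ ≤ G * w x.re * (D * X ^ j) := by gcongr
          _ ≤ G * w x.re * (D * (X ^ (j + 1) / B)) := by gcongr
          _ = _ := by ring
      have hp := (hw.pos x.re).le
      have hY : 0 ≤ X ^ (j + 1) / B := by positivity
      simp only [tCoeff]
      rw [div_eq_mul_inv, norm_mul, norm_neg, mul_inv, norm_mul]
      have hinv := h.bound_κ_inv x hxr
      have h2 : ‖(2 : ℂ)⁻¹‖ ≤ 1 := by norm_num
      calc _ ≤ (G * D * (X ^ (j + 1) / B) * w x.re + 2 * K * (X ^ (j + 1) / B) * w x.re)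
            * (1 * K₀) := by
            gcongr
            exact (norm_add_le _ _).trans (add_le_add hge hder2)
        _ = (K₀ * (G * D + 2 * K)) * (X ^ (j + 1) / B) * w x.re := by ring
        _ ≤ B * (X ^ (j + 1) / B) * w x.re := by gcongr; linarith
        _ = _ := by field_simp
    have hgo : ∀ t, 0 ≤ t → t < r → ∀ x ∈ HStrip (y₀ - t) (y₁ + t),
        ‖g x * (tCoeff g κ (j + 1)).2 x‖ ≤ G * (B * (j + 1 : ℕ) / (r - t)) ^ (j + 1) * w x.re := by
      intro t ht htr x hx
      have hxr : x ∈ HStrip (y₀ - r) (y₁ + r) := HStrip_mono (by linarith) (by linarith) hx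
      have h1 := hbo t ht htr x hx
      have h2 := h.bound_g x hxr
      have hp := (hw.pos x.re).le
      have h3 : ‖g x‖ ≤ G := h2.trans (mul_le_of_le_one_right hG (hw.le_one _))
      rw [norm_mul]
      calc _ ≤ G * ((B * (j + 1 : ℕ) / (r - t)) ^ (j + 1) * w x.re) := by gcongr
        _ = _ := by ring
    refine ⟨?_, hdo', fun t ht htr x hx => ⟨?_, hbo t ht htr x hx⟩⟩
    · intro x hx
      obtain ⟨t, ht0, htr, hxt⟩ := exists_mem_smaller_strip h.r_pos hx
      have hsub : HStrip (y₀ - t) (y₁ + t) ⊆ HStrip (y₀ - r) (y₁ + r) :=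
        HStrip_mono (by linarith) (by linarith)
      have hτ : 0 < r - t := by linarith
      have := hasDerivAt_prim hw (by positivity) ((h.diff_g.mul hdo').mono hsub)
        (hgo t ht0 htr) hxt
      exact this.neg.differentiableAt.differentiableWithinAt
    · have hτ : 0 < r - t := by linarith
      have h1 := norm_prim_le hw (hgo t ht htr) hx
      have h2 := integral_Iic_le hw x.re
      have : ‖(tCoeff g κ (j + 1)).1 x‖ = ‖prim (fun y => g y * (tCoeff g κ (j + 1)).2 y) x‖ := by
        simp only [tCoeff, norm_neg]
      rw [this]
      refine h1.trans ?_
      calc _ ≤ G * (B * (j + 1 : ℕ) / (r - t)) ^ (j + 1) * I := by gcongr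
        _ = G * I * (B * (j + 1 : ℕ) / (r - t)) ^ (j + 1) := by ring
        _ ≤ _ := by gcongr; linarith

end TransData

/-- A path in the strip, parametrized by the real part, along which the phase is monotone. -/
structure TransPath (κ : ℂ → ℂ) (y₀ y₁ : ℝ) (γ γ' : ℝ → ℂ) : Prop where
  deriv : ∀ s, HasDerivAt γ (γ' s) s
  cont : Continuous γ'
  norm_le : ∀ s, ‖γ' s‖ ≤ 2
  re_eq : ∀ s, (γ s).re = s
  mem : ∀ s, γ s ∈ HStrip y₀ y₁
  mono : ∀ s, 0 ≤ (κ (γ s) * γ' s).re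

namespace TransData

variable {w : ℝ → ℝ} {g κ : ℂ → ℂ} {y₀ y₁ r G K₀ : ℝ}

lemma hasDerivAt_coeff_succ (h : TransData w g κ y₀ y₁ r G K₀) (j : ℕ) {x : ℂ}
    (hx : x ∈ HStrip (y₀ - r) (y₁ + r)) :
    HasDerivAt (tCoeff g κ (j + 1)).1 (-(g x * (tCoeff g κ (j + 1)).2 x)) x := by
  obtain ⟨B, D, hB, hD, hb⟩ := h.coeff_bound
  obtain ⟨-, hdo, hbo⟩ := hb (j + 1)
  obtain ⟨t, ht0, htr, hxt⟩ := exists_mem_smaller_strip h.r_pos hx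
  have hτ : 0 < r - t := by linarith
  have hsub : HStrip (y₀ - t) (y₁ + t) ⊆ HStrip (y₀ - r) (y₁ + r) :=
    HStrip_mono (by linarith) (by linarith)
  have hG := h.G_nonneg
  exact (hasDerivAt_prim h.weight (F := G * (B * (j + 1 : ℕ) / (r - t)) ^ (j + 1))
    (by positivity) ((h.diff_g.mul hdo).mono hsub) (fun y hy => by
      have h3 : ‖g y‖ ≤ G :=
        (h.bound_g y (hsub hy)).trans (mul_le_of_le_one_right hG (h.weight.le_one _))
      rw [Pi.mul_apply, norm_mul, mul_assoc]
      exact mul_le_mul h3 ((hbo t ht0 htr y hy).2) (norm_nonneg _) hG) hxt).neg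

lemma hasDerivAt_coeff (h : TransData w g κ y₀ y₁ r G K₀) (j : ℕ) {x : ℂ}
    (hx : x ∈ HStrip (y₀ - r) (y₁ + r)) :
    HasDerivAt (tCoeff g κ j).1 (-(g x * (tCoeff g κ j).2 x)) x := by
  cases j with
  | zero => simpa [tCoeff] using hasDerivAt_const x (1 : ℂ)
  | succ j => exact h.hasDerivAt_coeff_succ j hx

lemma hasDerivAt_coeff_snd (h : TransData w g κ y₀ y₁ r G K₀) (j : ℕ) {x : ℂ}
    (hx : x ∈ HStrip (y₀ - r) (y₁ + r)) :
    HasDerivAt (tCoeff g κ j).2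
      (-(2 * κ x * (tCoeff g κ (j + 1)).2 x + g x * (tCoeff g κ j).1 x)) x := by
  obtain ⟨B, D, hB, hD, hb⟩ := h.coeff_bound
  have h1 := (((hb j).2.1).differentiableAt ((isOpen_HStrip _ _).mem_nhds hx)).hasDerivAt
  refine h1.congr_deriv ?_
  have := h.κ_ne x hx
  simp only [tCoeff]
  field_simp
  ring

/-- Gevrey expansion of the transmission coefficient of the transport system. -/
theorem exists_expansion (h : TransData w g κ y₀ y₁ r G K₀) {γ γ' : ℝ → ℂ}
    (hγ : TransPath κ y₀ y₁ γ γ') {K' : ℝ} (hK' : ∀ x ∈ HStrip y₀ y₁, ‖κ x‖ ≤ K') :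
    ∃ (a : ℕ → ℂ) (B D : ℝ), 0 < B ∧ 0 < D ∧ a 0 = 1 ∧
      (∀ j : ℕ, ‖a j‖ ≤ D * (B * j) ^ j) ∧
      ∀ hb : ℝ, 0 < hb → ∀ (we wo : ℝ → ℂ) (l : ℂ),
        (∀ s, HasDerivAt we (-(γ' s * g (γ s) * wo s)) s) →
        (∀ s, HasDerivAt wo (-(γ' s * (2 * κ (γ s) / hb * wo s + g (γ s) * we s))) s) →
        Tendsto we atBot (𝓝 1) → Tendsto wo atBot (𝓝 0) → Tendsto we atTop (𝓝 l) →
        ∀ N : ℕ, ‖l - ∑ j ∈ Finset.range (N + 1), a j * (hb : ℂ) ^ j‖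
          ≤ D * hb ^ N * (B * (N + 1 : ℕ)) ^ (N + 1) := by
  obtain ⟨B, D, hB, hD, hb⟩ := h.coeff_bound
  have hw := h.weight
  have hr := h.r_pos
  have hG := h.G_nonneg
  set I := ∫ t, w t with hI
  have hI0 : 0 ≤ I := (integral_Iic_nonneg hw 0).trans (integral_Iic_le hw 0)
  have hmem0 : ∀ s, γ s ∈ HStrip (y₀ - 0) (y₁ + 0) := fun s => by simpa using hγ.mem s
  have hmem : ∀ s, γ s ∈ HStrip (y₀ - r) (y₁ + r) := fun s =>
    HStrip_mono (by linarith) (by linarith) (hγ.mem s)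
  have hK'0 : 0 ≤ K' := (norm_nonneg _).trans (hK' _ (hγ.mem 0))
  have hbe : ∀ j s, ‖(tCoeff g κ j).1 (γ s)‖ ≤ D * (B / r * j) ^ j := fun j s => by
    have := ((hb j).2.2 0 le_rfl hr _ (hmem0 s)).1
    rwa [sub_zero, mul_div_right_comm] at this
  have hbo : ∀ j s, ‖(tCoeff g κ j).2 (γ s)‖ ≤ (B / r * j) ^ j * w s := fun j s => by
    have := ((hb j).2.2 0 le_rfl hr _ (hmem0 s)).2
    rwa [sub_zero, mul_div_right_comm, hγ.re_eq] at this
  have hder : ∀ j s, HasDerivAt (fun s => (tCoeff g κ j).1 (γ s))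
      (-(γ' s * g (γ s) * (tCoeff g κ j).2 (γ s))) s := fun j s => by
    have := (h.hasDerivAt_coeff j (hmem s)).scomp s (hγ.deriv s)
    simp only [Function.comp_def, smul_eq_mul] at this
    exact this.congr_deriv (by ring)
  have hders : ∀ j s, HasDerivAt (fun s => (tCoeff g κ j).2 (γ s))
      (-(γ' s * (2 * κ (γ s) * (tCoeff g κ (j + 1)).2 (γ s)
        + g (γ s) * (tCoeff g κ j).1 (γ s)))) s := fun j s => by
    have := (h.hasDerivAt_coeff_snd j (hmem s)).scomp s (hγ.deriv s)
    simp only [Function.comp_def, smul_eq_mul] at this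
    exact this.congr_deriv (by ring)
  have hγc : Continuous γ := continuous_iff_continuousAt.2 fun s => (hγ.deriv s).continuousAt
  have hgb : ∀ s, ‖γ' s * g (γ s)‖ ≤ 2 * G * w s := fun s => by
    rw [norm_mul]
    have h1 := h.bound_g _ (hmem s)
    rw [hγ.re_eq] at h1
    calc _ ≤ 2 * (G * w s) := mul_le_mul (hγ.norm_le s) h1 (norm_nonneg _) (by norm_num)
      _ = _ := by ring
  have hintegr : ∀ j, Integrable fun s => -(γ' s * g (γ s) * (tCoeff g κ j).2 (γ s)) := fun j => by
    refine (hw.int.const_mul (2 * G * (B / r * j) ^ j)).mono' ?_ (Eventually.of_forall fun s => ?_)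
    · exact (((hγ.cont.mul (h.diff_g.continuousOn.comp_continuous hγc hmem)).mul
        ((hb j).2.1.continuousOn.comp_continuous hγc hmem)).neg).aestronglyMeasurable
    · rw [norm_neg, norm_mul]
      have h2 := hbo j s
      have h3 : ‖γ' s * g (γ s)‖ ≤ 2 * G :=
        (hgb s).trans (mul_le_of_le_one_right (by positivity) (hw.le_one _))
      calc _ ≤ 2 * G * ((B / r * j) ^ j * w s) :=
            mul_le_mul h3 h2 (norm_nonneg _) (by positivity)
        _ = _ := by ring
  have hlimt : ∀ j, ∃ a, Tendsto (fun s => (tCoeff g κ j).1 (γ s)) atTop (𝓝 a) := fun j =>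
    ⟨_, tendsto_limUnder_of_hasDerivAt_of_integrableOn_Ioi (a := 0)
      (fun s _ => hder j s) (hintegr j).integrableOn⟩
  choose a ha using hlimt
  have hlimb : ∀ j, Tendsto (fun s => (tCoeff g κ (j + 1)).1 (γ s)) atBot (𝓝 0) := fun j => by
    have h0 : Tendsto (fun s => G * (B / r * (j + 1 : ℕ)) ^ (j + 1) * ∫ t in Iic s, w t)
        atBot (𝓝 0) := by simpa using (tendsto_integral_Iic_atBot hw).const_mul _
    refine squeeze_zero_norm (fun s => ?_) h0
    have h1 := norm_prim_le hw (f := fun y => g y * (tCoeff g κ (j + 1)).2 y)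
      (a := y₀ - 0) (b := y₁ + 0) (F := G * (B / r * (j + 1 : ℕ)) ^ (j + 1)) (fun y hy => by
      have h3 : ‖g y‖ ≤ G := (h.bound_g y (HStrip_mono (by linarith) (by linarith) hy)).trans
        (mul_le_of_le_one_right hG (hw.le_one _))
      have h4 := ((hb (j + 1)).2.2 0 le_rfl hr _ hy).2
      rw [sub_zero, mul_div_right_comm] at h4
      rw [norm_mul, mul_assoc]
      exact mul_le_mul h3 h4 (norm_nonneg _) hG) (hmem0 s)
    rw [hγ.re_eq] at h1
    simpa [tCoeff] using h1
  have hlimo : ∀ j, Tendsto (fun s => (tCoeff g κ j).2 (γ s)) atBot (𝓝 0) := fun j =>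
    squeeze_zero_norm (hbo j) (by simpa using hw.tendsto_bot.const_mul _)
  set L := Real.exp ((2 * (2 * G) + 1) * I) * I with hL
  have hL0 : 0 ≤ L := by positivity
  have hBr : 0 < B / r := by positivity
  refine ⟨a, B / r, D + 4 * K' * Real.sqrt L, hBr, by positivity, ?_, ?_, ?_⟩
  · refine tendsto_nhds_unique (ha 0) ?_
    simp only [tCoeff]
    exact tendsto_const_nhds
  · intro j
    have h1 := le_of_tendsto (ha j).norm (Eventually.of_forall (hbe j))
    refine h1.trans (mul_le_mul_of_nonneg_right ?_ (by positivity))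
    have : 0 ≤ 4 * K' * Real.sqrt L := by positivity
    linarith
  intro η hη we wo l hwe hwo hwe0 hwo0 hl N
  have hηc : (η : ℂ) ≠ 0 := by exact_mod_cast hη.ne'
  set eN : ℝ → ℂ := fun s => ∑ j ∈ Finset.range (N + 1), (tCoeff g κ j).1 (γ s) * (η : ℂ) ^ j
  set oN : ℝ → ℂ := fun s => ∑ j ∈ Finset.range (N + 1), (tCoeff g κ j).2 (γ s) * (η : ℂ) ^ j
    with hoN
  have heN : ∀ s, HasDerivAt eN (-(γ' s * g (γ s) * oN s)) s := fun s => by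
    have := HasDerivAt.fun_sum (u := Finset.range (N + 1)) fun j _ =>
      (hder j s).mul_const ((η : ℂ) ^ j)
    refine this.congr_deriv ?_
    rw [hoN, Finset.mul_sum, ← Finset.sum_neg_distrib]
    exact Finset.sum_congr rfl fun j _ => by ring
  have hoN' : ∀ s, HasDerivAt oN (-(γ' s * (2 * κ (γ s) / η * oN s + g (γ s) * eN s))
      - γ' s * (2 * κ (γ s)) * (tCoeff g κ (N + 1)).2 (γ s) * (η : ℂ) ^ N) s := fun s => by
    have := HasDerivAt.fun_sum (u := Finset.range (N + 1)) fun j _ =>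
      (hders j s).mul_const ((η : ℂ) ^ j)
    refine this.congr_deriv ?_
    have e1 : oN s + (tCoeff g κ (N + 1)).2 (γ s) * (η : ℂ) ^ (N + 1) =
        ∑ j ∈ Finset.range (N + 1), (tCoeff g κ (j + 1)).2 (γ s) * (η : ℂ) ^ (j + 1) := by
      have h1 := Finset.sum_range_succ (fun j => (tCoeff g κ j).2 (γ s) * (η : ℂ) ^ j) (N + 1)
      have h2 := Finset.sum_range_succ' (fun j => (tCoeff g κ j).2 (γ s) * (η : ℂ) ^ j) (N + 1)
      rw [h1] at h2
      simpa [tCoeff, hoN] using h2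
    have e2 : oN s = (∑ j ∈ Finset.range (N + 1), (tCoeff g κ (j + 1)).2 (γ s) * (η : ℂ) ^ j) * η
        - (tCoeff g κ (N + 1)).2 (γ s) * (η : ℂ) ^ (N + 1) := by
      rw [eq_sub_iff_add_eq, e1, Finset.sum_mul]
      exact Finset.sum_congr rfl fun j _ => by ring
    have e3 : ∑ j ∈ Finset.range (N + 1),
        -(γ' s * (2 * κ (γ s) * (tCoeff g κ (j + 1)).2 (γ s) + g (γ s) * (tCoeff g κ j).1 (γ s)))
          * (η : ℂ) ^ j = -(γ' s * (2 * κ (γ s) *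
          (∑ j ∈ Finset.range (N + 1), (tCoeff g κ (j + 1)).2 (γ s) * (η : ℂ) ^ j)
            + g (γ s) * eN s)) := by
      simp only [eN, Finset.mul_sum, ← Finset.sum_add_distrib, ← Finset.sum_neg_distrib]
      exact Finset.sum_congr rfl fun j _ => by ring
    rw [e3, e2]
    field_simp
    ring
  set ρ := 4 * K' * η ^ N * (B / r * (N + 1 : ℕ)) ^ (N + 1) with hρ
  have hρ0 : 0 ≤ ρ := by positivity
  have key := energy_estimate hw (Γ := 2 * G) (ρ := ρ) (by positivity)
    (u := fun s => we s - eN s) (v := fun s => wo s - oN s) (α := fun s => γ' s * g (γ s))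
    (β := fun s => γ' s * (2 * κ (γ s) / η))
    (R := fun s => γ' s * (2 * κ (γ s)) * (tCoeff g κ (N + 1)).2 (γ s) * (η : ℂ) ^ N)
    (fun s => ((hwe s).sub (heN s)).congr_deriv (by ring))
    (fun s => ((hwo s).sub (hoN' s)).congr_deriv (by ring)) hgb
    (fun s => by
      have h1 : γ' s * (2 * κ (γ s) / η) = ((2 / η : ℝ) : ℂ) * (κ (γ s) * γ' s) := by
        push_cast; ring
      rw [h1, Complex.re_ofReal_mul]
      exact mul_nonneg (by positivity) (hγ.mono s))
    (fun s => by
      simp only [norm_mul, norm_pow, Complex.norm_real, Real.norm_eq_abs, abs_of_pos hη,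
        Complex.norm_ofNat]
      have h1 := hbo (N + 1) s
      have h2 := hK' _ (hγ.mem s)
      have h3 := hγ.norm_le s
      have hp := (hw.pos s).le
      calc _ ≤ 2 * (2 * K') * ((B / r * (N + 1 : ℕ)) ^ (N + 1) * w s) * η ^ N := by gcongr
        _ = _ := by rw [hρ]; ring)
    (by
      have : Tendsto eN atBot (𝓝 1) := by
        have h1 : ∀ s, eN s = (∑ j ∈ Finset.range N,
            (tCoeff g κ (j + 1)).1 (γ s) * (η : ℂ) ^ (j + 1)) + 1 := fun s => by
          simp only [eN]; rw [Finset.sum_range_succ']; simp [tCoeff]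
        simp only [funext h1]
        simpa using (tendsto_finsetSum (Finset.range N) fun j _ =>
          (hlimb j).mul_const ((η : ℂ) ^ (j + 1))).add_const 1
      simpa using hwe0.sub this)
    (by
      have : Tendsto oN atBot (𝓝 0) := by
        simpa using tendsto_finsetSum (Finset.range (N + 1)) fun j _ =>
          (hlimo j).mul_const ((η : ℂ) ^ j)
      simpa using hwo0.sub this)
  have hlim : Tendsto (fun s => we s - eN s) atTop
      (𝓝 (l - ∑ j ∈ Finset.range (N + 1), a j * (η : ℂ) ^ j)) :=
    hl.sub (tendsto_finsetSum _ fun j _ => (ha j).mul_const _)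
  have h1 := le_of_tendsto (hlim.norm.pow 2) (Eventually.of_forall fun s =>
    (le_add_of_nonneg_right (sq_nonneg ‖wo s - oN s‖)).trans (key s))
  have h2 : ‖l - ∑ j ∈ Finset.range (N + 1), a j * (η : ℂ) ^ j‖ ≤ ρ * Real.sqrt L := by
    refine (pow_le_pow_iff_left₀ (norm_nonneg _) (by positivity) two_ne_zero).1 ?_
    rw [mul_pow, Real.sq_sqrt hL0]
    calc _ ≤ _ := h1
      _ = _ := by rw [hL]; ring
  refine h2.trans ?_
  have h3 : 0 ≤ D * η ^ N * (B / r * (N + 1 : ℕ)) ^ (N + 1) := by positivity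
  rw [hρ]
  nlinarith

end TransData

lemma succ_pow_succ_le (j : ℕ) : ((j + 1 : ℕ) : ℝ) ^ (j + 1) ≤ 4 ^ j * (j : ℝ) ^ j := by
  rcases Nat.eq_zero_or_pos j with rfl | hj
  · simp
  have h1 : ((j + 1 : ℕ) : ℝ) ≤ 2 ^ j := by
    exact_mod_cast Nat.succ_le_of_lt (Nat.lt_two_pow_self (n := j))
  have h2 : ((j + 1 : ℕ) : ℝ) ≤ 2 * j := by
    have : (1 : ℝ) ≤ j := by exact_mod_cast hj
    push_cast; linarith
  calc ((j + 1 : ℕ) : ℝ) ^ (j + 1) = ((j + 1 : ℕ) : ℝ) ^ j * ((j + 1 : ℕ) : ℝ) := pow_succ _ _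
    _ ≤ (2 * j) ^ j * 2 ^ j := by gcongr
    _ = 4 ^ j * (j : ℝ) ^ j := by
      rw [show (4 : ℝ) = 2 * 2 by norm_num, mul_pow, mul_pow]; ring

/-- A Gevrey expansion with factorial remainders yields a classical analytic symbol. -/
theorem isCAS_of_expansion {l : ℝ → ℂ} {a : ℕ → ℂ} {B D : ℝ} (hB : 0 < B) (hD : 0 < D)
    (ha0 : a 0 = 1) (ha : ∀ j : ℕ, ‖a j‖ ≤ D * (B * j) ^ j)
    (hl : ∀ h : ℝ, 0 < h → ∀ N : ℕ, ‖l h - ∑ j ∈ Finset.range (N + 1), a j * (h : ℂ) ^ j‖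
      ≤ D * h ^ N * (B * (N + 1 : ℕ)) ^ (N + 1)) :
    IsCAS fun h => (l h - 1) / h := by
  refine ⟨0, fun j => a (j + 1), D * B + 4 * B, by positivity, fun j => ?_, fun C₁ hC₁ => ?_⟩
  · have h1 := succ_pow_succ_le j
    calc _ ≤ _ := ha (j + 1)
      _ = D * B * B ^ j * ((j + 1 : ℕ) : ℝ) ^ (j + 1) := by rw [mul_pow]; ring
      _ ≤ D * B * B ^ j * (4 ^ j * (j : ℝ) ^ j) := by gcongr
      _ = D * B * (4 * B) ^ j * (j : ℝ) ^ j := by rw [mul_pow]; ring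
      _ ≤ (D * B + 4 * B) * (D * B + 4 * B) ^ j * (j : ℝ) ^ j := by
        have : 0 < D * B := by positivity
        gcongr <;> linarith
      _ = _ := by ring
  have hC₁0 : 0 < C₁ := lt_trans (by positivity) hC₁
  have hBC : 4 * B ≤ C₁ := by have : 0 < D * B := by positivity
                              linarith
  have he := Real.exp_pos 1
  refine ⟨1 / (2 * Real.exp 1 * C₁), by positivity, 8 * D * B ^ 2 * Real.exp (1 / 2),
    fun h h0 _ => ?_⟩
  set X := 1 / (h * Real.exp 1 * C₁) with hX
  set n := ⌊X⌋₊ with hn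
  have hX0 : 0 ≤ X := by positivity
  have hnX : (n : ℝ) ≤ X := Nat.floor_le hX0
  have hXn : X < n + 1 := Nat.lt_floor_add_one X
  have hhc : (h : ℂ) ≠ 0 := by exact_mod_cast h0.ne'
  have e1 : (l h - 1) / h - ∑ j ∈ Finset.range (n + 1), a (j + 1) * (h : ℂ) ^ (0 + j) =
      (l h - ∑ j ∈ Finset.range (n + 1 + 1), a j * (h : ℂ) ^ j) / h := by
    rw [Finset.sum_range_succ' _ (n + 1), ha0, eq_div_iff hhc, sub_mul, div_mul_cancel₀ _ hhc,
      Finset.sum_mul]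
    have : ∀ j, a (j + 1) * (h : ℂ) ^ (0 + j) * h = a (j + 1) * (h : ℂ) ^ (j + 1) := fun j => by
      rw [zero_add]; ring
    simp only [this]; ring
  rw [e1, norm_div, Complex.norm_real, Real.norm_of_nonneg h0.le]
  have h1 := hl h h0 (n + 1)
  have h2 : (h * B * (n + 2)) ^ n ≤ Real.exp (-n) := by
    rcases Nat.eq_zero_or_pos n with h3 | h3
    · simp [h3]
    · have h4 : (1 : ℝ) ≤ n := by exact_mod_cast h3
      have h5 : h * Real.exp 1 * C₁ * n ≤ 1 := by
        rw [hX, le_div_iff₀ (by positivity)] at hnX; linarith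
      have h6 : h * B * (n + 2) ≤ Real.exp (-1) := by
        rw [Real.exp_neg, ← one_div, le_div_iff₀ he]
        have h7 : h * B * (n + 2) * Real.exp 1 ≤ h * B * (4 * n) * Real.exp 1 := by
          gcongr; linarith
        have h8 : h * (4 * B) * n * Real.exp 1 ≤ h * C₁ * n * Real.exp 1 := by gcongr
        nlinarith
      calc _ ≤ Real.exp (-1) ^ n := pow_le_pow_left₀ (by positivity) h6 n
        _ = _ := by rw [← Real.exp_nat_mul]; ring_nf
  have h3 : ((n : ℝ) + 2) ^ 2 ≤ 8 * Real.exp (n / 2) := by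
    have := Real.quadratic_le_exp_of_nonneg (x := (n : ℝ) / 2) (by positivity)
    nlinarith
  have h4 : Real.exp (-n) * Real.exp (n / 2) ≤
      Real.exp (1 / 2) * Real.exp (-(1 / (2 * Real.exp 1 * C₁)) / h) := by
    rw [← Real.exp_add, ← Real.exp_add, Real.exp_le_exp]
    have : -(1 / (2 * Real.exp 1 * C₁)) / h = -X / 2 := by rw [hX]; field_simp
    rw [this]; linarith
  rw [div_le_iff₀ h0]
  calc _ ≤ _ := h1
    _ = D * B ^ 2 * h * ((n : ℝ) + 2) ^ 2 * (h * B * (n + 2)) ^ n := by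
      push_cast; rw [show (n : ℝ) + 1 + 1 = n + 2 by ring]
      simp only [mul_pow]
      ring
    _ ≤ D * B ^ 2 * h * (8 * Real.exp (n / 2)) * Real.exp (-n) := by gcongr
    _ = 8 * D * B ^ 2 * h * (Real.exp (-n) * Real.exp (n / 2)) := by ring
    _ ≤ 8 * D * B ^ 2 * h *
        (Real.exp (1 / 2) * Real.exp (-(1 / (2 * Real.exp 1 * C₁)) / h)) := by gcongr
    _ = _ := by ring

/-- `f` is holomorphic on the strip `|Im x| < η`, real on the real axis, and tends to
`fm`, `fp` at `∓∞` with rate `w`. -/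
structure IsScat (w : ℝ → ℝ) (η : ℝ) (f : ℂ → ℂ) (fm fp : ℝ) : Prop where
  diff : DifferentiableOn ℂ f (HStrip (-η) η)
  real : ∀ s : ℝ, (f s).im = 0
  bot : ∃ C R : ℝ, ∀ x ∈ HStrip (-η) η, x.re ≤ -R → ‖f x - fm‖ ≤ C * w x.re
  top : ∃ C R : ℝ, ∀ x ∈ HStrip (-η) η, R ≤ x.re → ‖f x - fp‖ ≤ C * w x.re

lemma isCompact_rect (a b c d : ℝ) : IsCompact (uIcc a b ×ℂ uIcc c d) :=
  isCompact_uIcc.reProdIm isCompact_uIcc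

lemma exists_bound_rect {w : ℝ → ℝ} (hw : IsWeight w) {f : ℂ → ℂ} {η η' a b : ℝ} (hη : η' < η)
    (hf : ContinuousOn f (HStrip (-η) η)) :
    ∃ C, 0 ≤ C ∧ ∀ x ∈ HStrip (-η') η', a ≤ x.re → x.re ≤ b → ‖f x‖ ≤ C * w x.re := by
  rcases le_or_gt η' 0 with h0 | h0
  · exact ⟨0, le_rfl, fun x hx => by have := hx.1.trans hx.2; linarith⟩
  have hsub : uIcc a b ×ℂ uIcc (-η') η' ⊆ HStrip (-η) η := fun x hx => by
    have h2 := hx.2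
    rw [mem_preimage, uIcc_of_le (by linarith)] at h2
    exact ⟨by linarith [h2.1], by linarith [h2.2]⟩
  obtain ⟨C, hC⟩ := (isCompact_rect a b (-η') η').exists_bound_of_continuousOn
    (f := fun x => f x / w x.re) ((hf.mono hsub).div
      (Complex.continuous_ofReal.comp (hw.cont.comp Complex.continuous_re)).continuousOn
      fun x _ => by exact_mod_cast (hw.pos x.re).ne')
  refine ⟨max C 0, le_max_right _ _, fun x hx h1 h2 => ?_⟩
  have h3 : x ∈ uIcc a b ×ℂ uIcc (-η') η' := by
    refine ⟨?_, ?_⟩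
    · rw [mem_preimage, uIcc_of_le (h1.trans h2)]; exact ⟨h1, h2⟩
    · rw [mem_preimage, uIcc_of_le (by linarith)]; exact ⟨hx.1.le, hx.2.le⟩
  have h4 := (hC x h3).trans (le_max_left C 0)
  rw [norm_div, Complex.norm_real, Real.norm_of_nonneg (hw.pos _).le, div_le_iff₀ (hw.pos _)] at h4
  exact h4

namespace IsScat

variable {w : ℝ → ℝ} {η : ℝ} {f : ℂ → ℂ} {fm fp : ℝ}

lemma mono (h : IsScat w η f fm fp) {η' : ℝ} (hη : η' ≤ η) : IsScat w η' f fm fp := by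
  have hsub : HStrip (-η') η' ⊆ HStrip (-η) η := HStrip_mono (by linarith) hη
  obtain ⟨C, R, hb⟩ := h.bot
  obtain ⟨C', R', ht⟩ := h.top
  exact ⟨h.diff.mono hsub, h.real, ⟨C, R, fun x hx => hb x (hsub hx)⟩,
    ⟨C', R', fun x hx => ht x (hsub hx)⟩⟩

lemma bound_left (hw : IsWeight w) (h : IsScat w η f fm fp) {η' : ℝ} (hη : η' < η) (T : ℝ) :
    ∃ C, 0 ≤ C ∧ ∀ x ∈ HStrip (-η') η', x.re ≤ T → ‖f x - fm‖ ≤ C * w x.re := by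
  obtain ⟨C, R, hb⟩ := h.bot
  obtain ⟨C', hC', hb'⟩ := exists_bound_rect hw (a := -R) (b := T) hη
    (f := fun x => f x - fm) (h.diff.continuousOn.sub continuousOn_const)
  refine ⟨max C C', hC'.trans (le_max_right _ _), fun x hx hT => ?_⟩
  have hp := (hw.pos x.re).le
  rcases le_total x.re (-R) with h1 | h1
  · exact (hb x (HStrip_mono (by linarith) hη.le hx) h1).trans
      (mul_le_mul_of_nonneg_right (le_max_left _ _) hp)
  · exact (hb' x hx h1 hT).trans (mul_le_mul_of_nonneg_right (le_max_right _ _) hp)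

lemma bound_right (hw : IsWeight w) (h : IsScat w η f fm fp) {η' : ℝ} (hη : η' < η) (T : ℝ) :
    ∃ C, 0 ≤ C ∧ ∀ x ∈ HStrip (-η') η', T ≤ x.re → ‖f x - fp‖ ≤ C * w x.re := by
  obtain ⟨C, R, hb⟩ := h.top
  obtain ⟨C', hC', hb'⟩ := exists_bound_rect hw (a := T) (b := R) hη
    (f := fun x => f x - fp) (h.diff.continuousOn.sub continuousOn_const)
  refine ⟨max C C', hC'.trans (le_max_right _ _), fun x hx hT => ?_⟩
  have hp := (hw.pos x.re).le
  rcases le_total R x.re with h1 | h1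
  · exact (hb x (HStrip_mono (by linarith) hη.le hx) h1).trans
      (mul_le_mul_of_nonneg_right (le_max_left _ _) hp)
  · exact (hb' x hx hT h1).trans (mul_le_mul_of_nonneg_right (le_max_right _ _) hp)

lemma bounded (hw : IsWeight w) (h : IsScat w η f fm fp) {η' : ℝ} (hη : η' < η) :
    ∃ M, 0 ≤ M ∧ ∀ x ∈ HStrip (-η') η', ‖f x‖ ≤ M := by
  obtain ⟨C, hC, h1⟩ := h.bound_left hw hη 0
  obtain ⟨C', hC', h2⟩ := h.bound_right hw hη 0
  refine ⟨(C + |fm|) + (C' + |fp|), by positivity, fun x hx => ?_⟩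
  have hm : ‖(fm : ℂ)‖ = |fm| := by simp
  have hp : ‖(fp : ℂ)‖ = |fp| := by simp
  have hfm := abs_nonneg fm
  have hfp := abs_nonneg fp
  rcases le_total x.re 0 with h0 | h0
  · have h3 := (h1 x hx h0).trans (mul_le_of_le_one_right hC (hw.le_one _))
    have h4 := norm_add_le (f x - fm) fm
    rw [sub_add_cancel] at h4
    linarith
  · have h3 := (h2 x hx h0).trans (mul_le_of_le_one_right hC' (hw.le_one _))
    have h4 := norm_add_le (f x - fp) fp
    rw [sub_add_cancel] at h4
    linarith

lemma deriv_bound (hw : IsWeight w) (h : IsScat w η f fm fp) {η' : ℝ} (hη : η' < η) :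
    ∃ C, 0 ≤ C ∧ ∀ x ∈ HStrip (-η') η', ‖deriv f x‖ ≤ C * w x.re := by
  obtain ⟨K, hK1, hK⟩ := hw.shift
  obtain ⟨η'', h1, h2⟩ := exists_between hη
  set d := min 1 (η'' - η') with hd
  have hd0 : 0 < d := lt_min one_pos (by linarith)
  have hd1 : d ≤ 1 := min_le_left _ _
  have hd2 : d ≤ η'' - η' := min_le_right _ _
  obtain ⟨C, hC, hl⟩ := h.bound_left hw h2 1
  obtain ⟨C', hC', hr⟩ := h.bound_right hw h2 (-1)
  have aux : ∀ (c : ℂ) (D : ℝ), 0 ≤ D → ∀ x ∈ HStrip (-η') η',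
      (∀ z ∈ Metric.sphere x d, ‖f z - c‖ ≤ D * w z.re) → ‖deriv f x‖ ≤ D * K / d * w x.re := by
    intro c D hD x hx hz
    have hsub : Metric.closedBall x d ⊆ HStrip (-η) η := fun y hy => by
      obtain ⟨h3, h4, -⟩ := im_mem_of_dist hy
      exact ⟨by linarith [hx.1], by linarith [hx.2]⟩
    have h3 := Complex.norm_deriv_le_of_forall_mem_sphere_norm_le (f := fun x => f x - c)
      (C := D * (K * w x.re)) hd0
      (((h.diff.sub_const c).mono hsub).diffContOnCl_ball subset_rfl) (fun z hzs => by
        have := hK x.re (z.re - x.re)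
          ((im_mem_of_dist (Metric.sphere_subset_closedBall hzs)).2.2.trans hd1)
        rw [add_sub_cancel] at this
        exact (hz z hzs).trans (mul_le_mul_of_nonneg_left this hD))
    rw [deriv_sub_const] at h3
    calc _ ≤ _ := h3
      _ = _ := by ring
  refine ⟨(C + C') * K / d, by positivity, fun x hx => ?_⟩
  have hmem : ∀ z ∈ Metric.sphere x d, z ∈ HStrip (-η'') η'' ∧ |z.re - x.re| ≤ 1 := fun z hz => by
    obtain ⟨h3, h4, h5⟩ := im_mem_of_dist (Metric.sphere_subset_closedBall hz)
    exact ⟨⟨by linarith [hx.1], by linarith [hx.2]⟩, h5.trans hd1⟩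
  rcases le_total x.re 0 with h0 | h0
  · refine aux fm (C + C') (by positivity) x hx fun z hz => ?_
    obtain ⟨h3, h4⟩ := hmem z hz
    rw [abs_le] at h4
    exact (hl z h3 (by linarith)).trans
      (mul_le_mul_of_nonneg_right (by linarith) (hw.pos _).le)
  · refine aux fp (C + C') (by positivity) x hx fun z hz => ?_
    obtain ⟨h3, h4⟩ := hmem z hz
    rw [abs_le] at h4
    exact (hr z h3 (by linarith)).trans
      (mul_le_mul_of_nonneg_right (by linarith) (hw.pos _).le)

lemma ofReal_re (h : IsScat w η f fm fp) (s : ℝ) : ((f s).re : ℂ) = f s :=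
  Complex.ext rfl (by simp [h.real s])

lemma ofReal_mem (hη : 0 < η) (s : ℝ) : (s : ℂ) ∈ HStrip (-η) η :=
  ⟨by simpa using hη, by simpa using hη⟩

lemma tendsto_bot (hw : IsWeight w) (h : IsScat w η f fm fp) {γ : ℝ → ℂ}
    (hγ : ∀ s, γ s ∈ HStrip (-η) η) (hre : ∀ s, (γ s).re = s) :
    Tendsto (fun s => f (γ s)) atBot (𝓝 (fm : ℂ)) := by
  obtain ⟨C, R, hb⟩ := h.bot
  rw [tendsto_iff_norm_sub_tendsto_zero]
  refine squeeze_zero' (Eventually.of_forall fun s => norm_nonneg _) ?_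
    (by simpa using hw.tendsto_bot.const_mul C)
  filter_upwards [eventually_le_atBot (-R)] with s hs
  simpa [hre] using hb (γ s) (hγ s) (by rwa [hre])

lemma tendsto_top (hw : IsWeight w) (h : IsScat w η f fm fp) {γ : ℝ → ℂ}
    (hγ : ∀ s, γ s ∈ HStrip (-η) η) (hre : ∀ s, (γ s).re = s) :
    Tendsto (fun s => f (γ s)) atTop (𝓝 (fp : ℂ)) := by
  obtain ⟨C, R, hb⟩ := h.top
  rw [tendsto_iff_norm_sub_tendsto_zero]
  refine squeeze_zero' (Eventually.of_forall fun s => norm_nonneg _) ?_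
    (by simpa using hw.tendsto_top.const_mul C)
  filter_upwards [eventually_ge_atTop R] with s hs
  simpa [hre] using hb (γ s) (hγ s) (by rwa [hre])

lemma continuous_re (h : IsScat w η f fm fp) (hη : 0 < η) : Continuous fun s : ℝ => (f s).re :=
  Complex.continuous_re.comp
    (h.diff.continuousOn.comp_continuous Complex.continuous_ofReal (ofReal_mem hη))

lemma tendsto_re_bot (hw : IsWeight w) (h : IsScat w η f fm fp) (hη : 0 < η) :
    Tendsto (fun s : ℝ => (f s).re) atBot (𝓝 fm) := by
  have := (Complex.continuous_re.tendsto _).comp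
    (h.tendsto_bot hw (γ := fun s => (s : ℂ)) (ofReal_mem hη) (by simp))
  simpa [Function.comp_def] using this

lemma tendsto_re_top (hw : IsWeight w) (h : IsScat w η f fm fp) (hη : 0 < η) :
    Tendsto (fun s : ℝ => (f s).re) atTop (𝓝 fp) := by
  have := (Complex.continuous_re.tendsto _).comp
    (h.tendsto_top hw (γ := fun s => (s : ℂ)) (ofReal_mem hη) (by simp))
  simpa [Function.comp_def] using this

/-- Vertical displacement estimate. -/
lemma vertical_bound (hw : IsWeight w) (h : IsScat w η f fm fp) {η' : ℝ} (hη : η' < η) :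
    ∃ C, 0 ≤ C ∧ ∀ x ∈ HStrip (-η') η', ‖f x - f x.re‖ ≤ C * |x.im| * w x.re := by
  obtain ⟨C, hC, hd⟩ := h.deriv_bound hw hη
  refine ⟨C, hC, fun x hx => ?_⟩
  have hη0 : 0 < η' := by have := hx.1.trans hx.2; linarith
  have hsub : HStrip (-η') η' ⊆ HStrip (-η) η := HStrip_mono (by linarith) hη.le
  have hconv : Convex ℝ (HStrip (-η') η' ∩ {z : ℂ | z.re = x.re}) := by
    refine (convex_HStrip _ _).inter ?_
    exact (convex_singleton x.re).linear_preimage Complex.reLm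
  have := hconv.norm_image_sub_le_of_norm_deriv_le (𝕜 := ℂ) (f := f) (C := C * w x.re)
    (fun z hz => h.diff.differentiableAt ((isOpen_HStrip _ _).mem_nhds (hsub hz.1)))
    (fun z hz => by have h1 := hd z hz.1; rwa [show z.re = x.re from hz.2] at h1)
    (x := (x.re : ℂ)) (y := x) ⟨ofReal_mem hη0 _, by simp⟩ ⟨hx, rfl⟩
  refine this.trans (le_of_eq ?_)
  have h2 : x - (x.re : ℂ) = (x.im : ℂ) * Complex.I := by
    apply Complex.ext <;> simp
  rw [h2]; simp; ring

lemma exists_re_lower (hw : IsWeight w) (h : IsScat w η f fm fp) (hη : 0 < η) (hm : 0 < fm)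
    (hp : 0 < fp) (hpos : ∀ s : ℝ, 0 < (f s).re) :
    ∃ a > 0, ∃ η' > 0, η' < η ∧ ∀ x ∈ HStrip (-η') η', a ≤ (f x).re := by
  have hc := h.continuous_re hη
  obtain ⟨R, hR⟩ := eventually_atBot.1 ((h.tendsto_re_bot hw hη).eventually
    (lt_mem_nhds (half_lt_self hm)))
  obtain ⟨R', hR'⟩ := eventually_atTop.1 ((h.tendsto_re_top hw hη).eventually
    (lt_mem_nhds (half_lt_self hp)))
  obtain ⟨s₀, -, hs₀⟩ := (isCompact_uIcc (a := R) (b := R')).exists_isMinOn ⟨R, left_mem_uIcc⟩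
    hc.continuousOn
  set b := min ((f s₀).re) (min (fm / 2) (fp / 2)) with hb
  have hb0 : 0 < b := lt_min (hpos _) (lt_min (by linarith) (by linarith))
  have hlow : ∀ s : ℝ, b ≤ (f s).re := fun s => by
    rcases le_total s R with h1 | h1
    · exact ((min_le_right _ _).trans (min_le_left _ _)).trans (hR s h1).le
    rcases le_total R' s with h2 | h2
    · exact ((min_le_right _ _).trans (min_le_right _ _)).trans (hR' s h2).le
    · exact (min_le_left _ _).trans (hs₀ (mem_uIcc_of_le h1 h2))
  obtain ⟨C, hC, hv⟩ := h.vertical_bound hw (half_lt_self hη)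
  refine ⟨b / 2, by linarith, min (η / 2) (b / (2 * (C + 1))), by positivity,
    (min_le_left _ _).trans_lt (half_lt_self hη), fun x hx => ?_⟩
  have hx' : x ∈ HStrip (-(η / 2)) (η / 2) :=
    HStrip_mono (neg_le_neg (min_le_left _ _)) (min_le_left _ _) hx
  have h1 := hv x hx'
  have h2 : |x.im| ≤ b / (2 * (C + 1)) :=
    (abs_lt.2 ⟨hx.1, hx.2⟩).le.trans (min_le_right _ _)
  have h3 : C * |x.im| * w x.re ≤ b / 2 := by
    calc _ ≤ C * |x.im| := mul_le_of_le_one_right (by positivity) (hw.le_one _)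
      _ ≤ (C + 1) * (b / (2 * (C + 1))) := by gcongr; linarith
      _ = b / 2 := by field_simp
  have h4 := (Complex.abs_re_le_norm (f x - f x.re)).trans (h1.trans h3)
  rw [Complex.sub_re, abs_le] at h4
  have := hlow x.re
  linarith

end IsScat

/-- The weight `⟨s⟩^{-δ}`. -/
noncomputable def stdWeight (δ s : ℝ) : ℝ := (1 + s ^ 2) ^ (-(δ / 2))

lemma isWeight_stdWeight {δ : ℝ} (h1 : 1 < δ) (h2 : δ ≤ 2) : IsWeight (stdWeight δ) where
  pos s := Real.rpow_pos_of_pos (by positivity) _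
  le_one s := Real.rpow_le_one_of_one_le_of_nonpos (by nlinarith [sq_nonneg s]) (by linarith)
  cont := Continuous.rpow_const (by fun_prop) fun s => Or.inl (by positivity)
  int := by
    have := integrable_rpow_neg_one_add_norm_sq (E := ℝ) (μ := volume) (r := δ) (by simpa using h1)
    refine this.congr (Eventually.of_forall fun s => ?_)
    simp [stdWeight, neg_div]
  tendsto_bot := by
    have h3 : Tendsto (fun s : ℝ => 1 + s ^ 2) atBot atTop :=
      tendsto_atTop_add_const_left _ _ (by
        simpa [Function.comp_def] using
          (tendsto_pow_atTop (α := ℝ) two_ne_zero).comp tendsto_abs_atBot_atTop)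
    exact (tendsto_rpow_neg_atTop (y := δ / 2) (by linarith)).comp h3
  tendsto_top := by
    have h3 : Tendsto (fun s : ℝ => 1 + s ^ 2) atTop atTop :=
      tendsto_atTop_add_const_left _ _ (tendsto_pow_atTop two_ne_zero)
    exact (tendsto_rpow_neg_atTop (y := δ / 2) (by linarith)).comp h3
  shift := by
    refine ⟨3, by norm_num, fun s t ht => ?_⟩
    have h3 : (1 + s ^ 2) / 3 ≤ 1 + (s + t) ^ 2 := by
      have : t ^ 2 ≤ 1 := (sq_le_one_iff_abs_le_one t).2 ht
      nlinarith [sq_nonneg (2 * s + 3 * t)]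
    calc stdWeight δ (s + t) ≤ ((1 + s ^ 2) / 3) ^ (-(δ / 2)) :=
          Real.rpow_le_rpow_of_nonpos (by positivity) h3 (by linarith)
      _ = 3 ^ (δ / 2) * stdWeight δ s := by
          rw [Real.div_rpow (by positivity) (by norm_num), stdWeight,
            Real.rpow_neg (by norm_num : (0 : ℝ) ≤ 3), div_inv_eq_mul, mul_comm]
      _ ≤ 3 * stdWeight δ s := by
          refine mul_le_mul_of_nonneg_right ?_ (Real.rpow_nonneg (by positivity) _)
          calc (3 : ℝ) ^ (δ / 2) ≤ 3 ^ (1 : ℝ) :=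
                Real.rpow_le_rpow_of_exponent_le (by norm_num) (by linarith)
            _ = 3 := Real.rpow_one 3

lemma exp_le_stdWeight {δ : ℝ} (h2 : δ ≤ 2) (t : ℝ) :
    ∃ K, 0 ≤ K ∧ ∀ s, Real.exp (-(2 * |s - t|)) ≤ K * stdWeight δ s := by
  refine ⟨1 + 2 * t ^ 2, by positivity, fun s => ?_⟩
  have h3 : (1 + s ^ 2)⁻¹ ≤ stdWeight δ s := by
    rw [← Real.rpow_neg_one]
    exact Real.rpow_le_rpow_of_exponent_le (by nlinarith [sq_nonneg s]) (by linarith)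
  have h4 := Real.quadratic_le_exp_of_nonneg (x := 2 * |s - t|) (by positivity)
  have h5 : 1 + s ^ 2 ≤ (1 + 2 * t ^ 2) * Real.exp (2 * |s - t|) := by
    have h6 : |s - t| ^ 2 = (s - t) ^ 2 := sq_abs _
    have h7 : 1 + 2 * (s - t) ^ 2 ≤ Real.exp (2 * |s - t|) := by
      have := abs_nonneg (s - t)
      nlinarith
    calc 1 + s ^ 2 ≤ (1 + 2 * t ^ 2) * (1 + 2 * (s - t) ^ 2) := by
          nlinarith [sq_nonneg (s - 2 * t), mul_nonneg (sq_nonneg t) (sq_nonneg (s - t))]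
      _ ≤ _ := by gcongr
  refine le_trans ?_ (mul_le_mul_of_nonneg_left h3 (by positivity))
  rw [Real.exp_neg, ← div_eq_mul_inv, inv_eq_one_div, div_le_div_iff₀ (Real.exp_pos _)
    (by positivity)]
  linarith

/-- `-tanh`, a model function with a simple zero at the origin. -/
noncomputable def mtanh (x : ℂ) : ℂ := (1 - Complex.exp (2 * x)) / (1 + Complex.exp (2 * x))

section mtanh

variable {x : ℂ}

lemma exp_two_mul_re (x : ℂ) :
    (Complex.exp (2 * x)).re = Real.exp (2 * x.re) * Real.cos (2 * x.im) := by
  rw [Complex.exp_re]; simp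

lemma exp_two_mul_im (x : ℂ) :
    (Complex.exp (2 * x)).im = Real.exp (2 * x.re) * Real.sin (2 * x.im) := by
  rw [Complex.exp_im]; simp

lemma norm_exp_two_mul (x : ℂ) : ‖Complex.exp (2 * x)‖ = Real.exp (2 * x.re) := by
  rw [Complex.norm_exp]; simp

lemma exp_two_mul_re_pos (hx : x ∈ HStrip (-(Real.pi / 4)) (Real.pi / 4)) :
    0 < (Complex.exp (2 * x)).re := by
  rw [exp_two_mul_re]
  exact mul_pos (Real.exp_pos _) (Real.cos_pos_of_mem_Ioo ⟨by linarith [hx.1], by linarith [hx.2]⟩)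

lemma one_le_norm_one_add (hx : x ∈ HStrip (-(Real.pi / 4)) (Real.pi / 4)) :
    1 ≤ ‖1 + Complex.exp (2 * x)‖ ∧ Real.exp (2 * x.re) ≤ ‖1 + Complex.exp (2 * x)‖ := by
  have h := exp_two_mul_re_pos hx
  constructor
  · have := Complex.re_le_norm (1 + Complex.exp (2 * x))
    rw [Complex.add_re, Complex.one_re] at this
    linarith
  · rw [← norm_exp_two_mul]
    refine le_of_sq_le_sq ?_ (norm_nonneg _)
    rw [← Complex.normSq_eq_norm_sq, ← Complex.normSq_eq_norm_sq, Complex.normSq_apply,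
      Complex.normSq_apply]
    simp only [Complex.add_re, Complex.one_re, Complex.add_im, Complex.one_im]
    nlinarith

lemma one_add_exp_ne (hx : x ∈ HStrip (-(Real.pi / 4)) (Real.pi / 4)) :
    1 + Complex.exp (2 * x) ≠ 0 :=
  norm_pos_iff.1 (one_pos.trans_le (one_le_norm_one_add hx).1)

lemma hasDerivAt_mtanh (hx : x ∈ HStrip (-(Real.pi / 4)) (Real.pi / 4)) :
    HasDerivAt mtanh (-4 * Complex.exp (2 * x) / (1 + Complex.exp (2 * x)) ^ 2) x := by
  have h1 : HasDerivAt (fun x : ℂ => Complex.exp (2 * x)) (Complex.exp (2 * x) * 2) x := by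
    simpa using ((hasDerivAt_id x).const_mul 2).cexp
  refine ((h1.const_sub 1).div (h1.const_add 1) (one_add_exp_ne hx)).congr_deriv ?_
  congr 1
  ring

lemma norm_mtanh_sub_one (hx : x ∈ HStrip (-(Real.pi / 4)) (Real.pi / 4)) :
    ‖mtanh x - 1‖ ≤ 2 * Real.exp (2 * x.re) := by
  have h := one_add_exp_ne hx
  have h1 : mtanh x - 1 = -(2 * Complex.exp (2 * x)) / (1 + Complex.exp (2 * x)) := by
    rw [mtanh]; field_simp; ring
  rw [h1, norm_div, norm_neg, norm_mul, norm_exp_two_mul, Complex.norm_ofNat]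
  exact div_le_self (by positivity) (one_le_norm_one_add hx).1

lemma norm_mtanh_add_one (hx : x ∈ HStrip (-(Real.pi / 4)) (Real.pi / 4)) :
    ‖mtanh x + 1‖ ≤ 2 * Real.exp (-(2 * x.re)) := by
  have h := one_add_exp_ne hx
  have h1 : mtanh x + 1 = 2 / (1 + Complex.exp (2 * x)) := by
    rw [mtanh]; field_simp; ring
  rw [h1, norm_div, Complex.norm_ofNat, div_eq_mul_inv, Real.exp_neg]
  have := inv_anti₀ (Real.exp_pos _) (one_le_norm_one_add hx).2
  linarith

lemma mtanh_eq (x : ℂ) : mtanh x =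
    ((1 - Real.exp (2 * x.re) ^ 2 : ℝ) - (2 * (Complex.exp (2 * x)).im : ℝ) * Complex.I) /
      ((‖1 + Complex.exp (2 * x)‖ ^ 2 : ℝ) : ℂ) := by
  by_cases h : 1 + Complex.exp (2 * x) = 0
  · rw [mtanh, h]; simp
  rw [← Complex.normSq_eq_norm_sq, mtanh]
  have h2 : ((Complex.normSq (1 + Complex.exp (2 * x)) : ℝ) : ℂ) ≠ 0 := by
    rw [Complex.ofReal_ne_zero]; exact (Complex.normSq_pos.2 h).ne'
  rw [div_eq_div_iff h h2, ← Complex.mul_conj]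
  have h3 : ((1 - Real.exp (2 * x.re) ^ 2 : ℝ) : ℂ) - (2 * (Complex.exp (2 * x)).im : ℝ) * Complex.I
      = (1 - Complex.exp (2 * x)) * (starRingEnd ℂ) (1 + Complex.exp (2 * x)) := by
    rw [← norm_exp_two_mul, ← Complex.normSq_eq_norm_sq, Complex.normSq_apply]
    apply Complex.ext <;> simp <;> ring
  rw [h3]; ring

lemma mtanh_re_nonneg (hx : x.re ≤ 0) : 0 ≤ (mtanh x).re := by
  rw [mtanh_eq, Complex.div_ofReal_re]
  refine div_nonneg ?_ (by positivity)
  simp only [Complex.sub_re, Complex.ofReal_re, Complex.re_ofReal_mul, Complex.I_re, mul_zero,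
    sub_zero, sub_nonneg]
  exact pow_le_one₀ (Real.exp_pos _).le (Real.exp_le_one_iff.2 (by linarith))

lemma mtanh_re_nonpos (hx : 0 ≤ x.re) : (mtanh x).re ≤ 0 := by
  rw [mtanh_eq, Complex.div_ofReal_re]
  refine div_nonpos_of_nonpos_of_nonneg ?_ (by positivity)
  simp only [Complex.sub_re, Complex.ofReal_re, Complex.re_ofReal_mul, Complex.I_re, mul_zero,
    sub_zero, sub_nonpos]
  exact one_le_pow₀ (Real.one_le_exp (by linarith))

lemma mtanh_im_nonpos (h0 : 0 ≤ x.im) (h1 : x.im < Real.pi / 4) : (mtanh x).im ≤ 0 := by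
  rw [mtanh_eq, Complex.div_ofReal_im]
  refine div_nonpos_of_nonpos_of_nonneg ?_ (by positivity)
  have : 0 ≤ (Complex.exp (2 * x)).im := by
    rw [exp_two_mul_im]
    exact mul_nonneg (Real.exp_pos _).le (Real.sin_nonneg_of_nonneg_of_le_pi (by linarith)
      (by linarith [Real.pi_pos]))
  simp only [Complex.sub_im, Complex.ofReal_im, Complex.im_ofReal_mul, Complex.I_im]
  linarith

lemma mtanh_im_neg (h0 : 0 < x.im) (h1 : x.im < Real.pi / 4) : (mtanh x).im < 0 := by
  rw [mtanh_eq, Complex.div_ofReal_im]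
  have hx : x ∈ HStrip (-(Real.pi / 4)) (Real.pi / 4) := ⟨by linarith, h1⟩
  refine div_neg_of_neg_of_pos ?_ (pow_pos (norm_pos_iff.2 (one_add_exp_ne hx)) 2)
  have : 0 < (Complex.exp (2 * x)).im := by
    rw [exp_two_mul_im]
    exact mul_pos (Real.exp_pos _) (Real.sin_pos_of_pos_of_lt_pi (by linarith)
      (by linarith [Real.pi_pos]))
  simp only [Complex.sub_im, Complex.ofReal_im, Complex.im_ofReal_mul, Complex.I_im]
  linarith

lemma mtanh_zero : mtanh 0 = 0 := by simp [mtanh]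

lemma mtanh_ofReal_im (s : ℝ) : (mtanh s).im = 0 := by
  have h : (Complex.exp (2 * (s : ℂ))).im = 0 := by rw [exp_two_mul_im]; simp
  rw [mtanh_eq, Complex.div_ofReal_im, h]
  simp only [Complex.sub_im, Complex.ofReal_im, Complex.im_ofReal_mul]
  simp

/-- Lower bound away from the real axis. -/
lemma mtanh_lower {b : ℝ} (hb : 0 < b) (hb' : b < Real.pi / 4) :
    ∃ a > 0, ∀ x : ℂ, b ≤ x.im → x.im < Real.pi / 4 → a ≤ ‖mtanh x‖ := by
  have hs : 0 < Real.sin (2 * b) := Real.sin_pos_of_pos_of_lt_pi (by linarith) (by linarith)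
  refine ⟨Real.sin (2 * b) / 2, by positivity, fun x h1 h2 => ?_⟩
  have hx : x ∈ HStrip (-(Real.pi / 4)) (Real.pi / 4) := ⟨by linarith, h2⟩
  have hs2 : Real.sin (2 * b) ≤ Real.sin (2 * x.im) :=
    Real.sin_le_sin_of_le_of_le_pi_div_two (by linarith) (by linarith) (by linarith)
  set W := Complex.exp (2 * x) with hW
  have hW0 : 0 < ‖W‖ := by rw [hW, norm_exp_two_mul]; exact Real.exp_pos _
  have him : W.im = ‖W‖ * Real.sin (2 * x.im) := by rw [hW, exp_two_mul_im, norm_exp_two_mul]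
  have e1 : ‖W‖ * Real.sin (2 * b) ≤ ‖1 - W‖ := by
    have h3 := Complex.abs_im_le_norm (1 - W)
    rw [Complex.sub_im, Complex.one_im, zero_sub, abs_neg] at h3
    calc _ ≤ ‖W‖ * Real.sin (2 * x.im) := by gcongr
      _ = W.im := him.symm
      _ ≤ _ := (le_abs_self _).trans h3
  have e2 : Real.sin (2 * b) ≤ ‖1 - W‖ := by
    have h4 : W⁻¹.im = -(W.im / ‖W‖ ^ 2) := by
      rw [Complex.inv_im, Complex.normSq_eq_norm_sq, neg_div]
    have h3 := Complex.abs_im_le_norm (W⁻¹ - 1)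
    rw [Complex.sub_im, Complex.one_im, sub_zero, h4, abs_neg] at h3
    have h5 : ‖1 - W‖ = ‖W‖ * ‖W⁻¹ - 1‖ := by
      rw [← norm_mul, mul_sub, mul_inv_cancel₀ (norm_pos_iff.1 hW0), mul_one]
    have h6 : ‖W‖ * (W.im / ‖W‖ ^ 2) = Real.sin (2 * x.im) := by
      rw [him]; field_simp
    rw [h5]
    calc _ ≤ Real.sin (2 * x.im) := hs2
      _ = ‖W‖ * (W.im / ‖W‖ ^ 2) := h6.symm
      _ ≤ _ := mul_le_mul_of_nonneg_left ((le_abs_self _).trans h3) hW0.le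
  have h7 : ‖1 + W‖ ≤ 1 + ‖W‖ := by simpa using norm_add_le (1 : ℂ) W
  rw [mtanh, norm_div, le_div_iff₀ (one_pos.trans_le (one_le_norm_one_add hx).1)]
  calc _ ≤ Real.sin (2 * b) / 2 * (1 + ‖W‖) := by gcongr
    _ ≤ _ := by nlinarith

lemma mtanh_ne_zero (hx : x ∈ HStrip (-(Real.pi / 4)) (Real.pi / 4)) (h0 : x ≠ 0) :
    mtanh x ≠ 0 := by
  rw [mtanh]
  refine div_ne_zero (fun h => h0 ?_) (one_add_exp_ne hx)
  have h1 : Complex.exp (2 * x) = 1 := by linear_combination -h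
  have h2 : Real.exp (2 * x.re) = 1 := by rw [← norm_exp_two_mul, h1, norm_one]
  have h3 : x.re = 0 := by rw [Real.exp_eq_one_iff] at h2; linarith
  have h4 := exp_two_mul_im x
  rw [h1, h2, Complex.one_im, one_mul] at h4
  have h5 : 2 * x.im = 0 := (Real.sin_eq_zero_iff_of_lt_of_lt (by linarith [hx.1, Real.pi_pos])
    (by linarith [hx.2, Real.pi_pos])).1 h4.symm
  exact Complex.ext (by simpa using h3) (by simpa using h5)

end mtanh

/-- Factor a simple real zero out of a function on a strip. -/
theorem IsScat.exists_factor {w : ℝ → ℝ} {η : ℝ} {q : ℂ → ℂ} {qm qp t : ℝ} (hw : IsWeight w)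
    (h : IsScat w η q qm qp) (hη : 0 < η) (hη4 : η ≤ Real.pi / 4) (hqm : 0 < qm) (hqp : qp ≠ 0)
    (ht : q t = 0) (ht' : deriv q t ≠ 0) (hne : ∀ s : ℝ, s ≠ t → q s ≠ 0)
    (hwt : ∃ K, 0 ≤ K ∧ ∀ s, Real.exp (-(2 * |s - t|)) ≤ K * w s) :
    qp < 0 ∧ ∃ η' > 0, η' < η ∧ ∃ Q : ℂ → ℂ, IsScat w η' Q qm (-qp) ∧
      (∃ a > 0, ∀ x ∈ HStrip (-η') η', a ≤ (Q x).re) ∧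
      ∀ x ∈ HStrip (-η') η', q x = mtanh (x - t) * Q x := by
  obtain ⟨K, hK, hwK⟩ := hwt
  have hmem : ∀ x ∈ HStrip (-η) η, x - (t : ℂ) ∈ HStrip (-(Real.pi / 4)) (Real.pi / 4) :=
    fun x hx => by
      have : (x - (t : ℂ)).im = x.im := by simp
      exact ⟨by rw [this]; linarith [hx.1], by rw [this]; linarith [hx.2]⟩
  set f : ℂ → ℂ := fun x => mtanh (x - t) with hf
  have hfd : ∀ x ∈ HStrip (-η) η, HasDerivAt f
      (-4 * Complex.exp (2 * (x - t)) / (1 + Complex.exp (2 * (x - t))) ^ 2) x := fun x hx =>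
    (hasDerivAt_mtanh (hmem x hx)).comp_sub_const x t
  have hft : f t = 0 := by simp [hf, mtanh_zero]
  have hfne : ∀ x ∈ HStrip (-η) η, x ≠ t → f x ≠ 0 := fun x hx hxt =>
    mtanh_ne_zero (hmem x hx) (sub_ne_zero.2 hxt)
  have htm : (t : ℂ) ∈ HStrip (-η) η := ofReal_mem hη t
  have hnhds : HStrip (-η) η ∈ 𝓝 (t : ℂ) := (isOpen_HStrip _ _).mem_nhds htm
  have hdf : DifferentiableOn ℂ f (HStrip (-η) η) := fun x hx =>
    (hfd x hx).differentiableAt.differentiableWithinAt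
  have hdsf : DifferentiableOn ℂ (dslope f t) (HStrip (-η) η) :=
    (Complex.differentiableOn_dslope hnhds).2 hdf
  have hdsq : DifferentiableOn ℂ (dslope q t) (HStrip (-η) η) :=
    (Complex.differentiableOn_dslope hnhds).2 h.diff
  have hdsne : ∀ x ∈ HStrip (-η) η, dslope f t x ≠ 0 := fun x hx => by
    by_cases hxt : x = t
    · rw [hxt, dslope_same, (hfd t htm).deriv]
      simp
    · rw [dslope_of_ne _ hxt, slope, vsub_eq_sub, hft, sub_zero, smul_eq_mul]
      exact mul_ne_zero (inv_ne_zero (sub_ne_zero.2 hxt)) (hfne x hx hxt)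
  set Q : ℂ → ℂ := fun x => dslope q t x / dslope f t x with hQ
  have hQd : DifferentiableOn ℂ Q (HStrip (-η) η) := hdsq.div hdsf hdsne
  have hQf : ∀ x ∈ HStrip (-η) η, q x = f x * Q x := fun x hx => by
    have h1 := sub_smul_dslope q t x
    have h2 := sub_smul_dslope f t x
    rw [ht, sub_zero, smul_eq_mul] at h1
    rw [hft, sub_zero, smul_eq_mul] at h2
    rw [← h1, ← h2, hQ]
    field_simp [hdsne x hx]
  have hcont : Continuous fun s : ℝ => Q s :=
    hQd.continuousOn.comp_continuous Complex.continuous_ofReal (ofReal_mem hη)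
  have hreal : ∀ s : ℝ, (Q s).im = 0 := by
    have h1 : EqOn (fun s : ℝ => (Q s).im) (fun _ => 0) {t}ᶜ := fun s hs => by
      have hst : (s : ℂ) ≠ t := by exact_mod_cast hs
      have h2 := hQf s (ofReal_mem hη s)
      have h3 := hfne s (ofReal_mem hη s) hst
      have h4 : (f s).im = 0 := by
        have := mtanh_ofReal_im (s - t)
        rwa [Complex.ofReal_sub] at this
      have h5 : Q s = q s / f s := by rw [h2]; field_simp
      have h6 : f s = ((f s).re : ℂ) := Complex.ext rfl (by simp [h4])
      show (Q s).im = 0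
      rw [h5, h6, Complex.div_ofReal_im, h.real, zero_div]
    have := Continuous.ext_on (dense_compl_singleton t) (Complex.continuous_im.comp hcont)
      continuous_const h1
    exact fun s => congrFun this s
  have half : ∀ x : ℝ, 1 ≤ x → 2 * Real.exp (-(2 * x)) ≤ 1 / 2 := fun x hx => by
    have h1 := Real.quadratic_le_exp_of_nonneg (x := 2 * x) (by linarith)
    have h2 : 4 ≤ Real.exp (2 * x) := by nlinarith
    rw [Real.exp_neg]
    have := inv_anti₀ (by norm_num) h2
    linarith
  have hscat : IsScat w η Q qm (-qp) := by
    refine ⟨hQd, hreal, ?_, ?_⟩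
    · obtain ⟨C, R, hb⟩ := h.bot
      refine ⟨2 * (C + qm * (2 * K)), max R (1 - t), fun x hx hR => ?_⟩
      have hR1 : x.re ≤ -R := hR.trans (neg_le_neg (le_max_left _ _))
      have hR2 : x.re ≤ t - 1 := by have := neg_le_neg (le_max_right R (1 - t)); linarith
      have e1 := hb x hx hR1
      have e2 := norm_mtanh_sub_one (hmem x hx)
      have e3 : (x - (t : ℂ)).re = x.re - t := by simp
      have e4 := hwK x.re
      rw [abs_of_nonpos (by linarith)] at e4
      rw [e3] at e2
      have e5 := half (t - x.re) (by linarith)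
      rw [show -(2 * -(x.re - t)) = 2 * (x.re - t) by ring] at e4
      rw [show -(2 * (t - x.re)) = 2 * (x.re - t) by ring] at e5
      have e6 : 1 / 2 ≤ ‖f x‖ := by
        have h7 : ‖f x - 1‖ ≤ 1 / 2 := e2.trans e5
        have h8 := norm_sub_norm_le (1 : ℂ) (1 - f x)
        rw [norm_one, sub_sub_cancel, norm_sub_rev] at h8
        linarith
      have e7 : f x * (Q x - qm) = (q x - qm) - qm * (f x - 1) := by rw [hQf x hx]; ring
      have e8 : ‖f x‖ * ‖Q x - qm‖ ≤ (C + qm * (2 * K)) * w x.re := by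
        rw [← norm_mul, e7]
        refine (norm_sub_le _ _).trans ?_
        rw [norm_mul, Complex.norm_real, Real.norm_of_nonneg hqm.le]
        have : ‖f x - 1‖ ≤ 2 * K * w x.re := by
          calc _ ≤ _ := e2
            _ ≤ 2 * (K * w x.re) := by linarith
            _ = _ := by ring
        calc _ ≤ C * w x.re + qm * (2 * K * w x.re) := by gcongr
          _ = _ := by ring
      have := mul_le_mul_of_nonneg_right e6 (norm_nonneg (Q x - qm))
      linarith
    · obtain ⟨C, R, hb⟩ := h.top
      refine ⟨2 * (C + |qp| * (2 * K)), max R (1 + t), fun x hx hR => ?_⟩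
      have hR1 : R ≤ x.re := (le_max_left _ _).trans hR
      have hR2 : 1 + t ≤ x.re := (le_max_right _ _).trans hR
      have e1 := hb x hx hR1
      have e2 := norm_mtanh_add_one (hmem x hx)
      have e3 : (x - (t : ℂ)).re = x.re - t := by simp
      have e4 := hwK x.re
      rw [abs_of_nonneg (by linarith)] at e4
      rw [e3] at e2
      have e5 := half (x.re - t) (by linarith)
      have e6 : 1 / 2 ≤ ‖f x‖ := by
        have h7 : ‖f x + 1‖ ≤ 1 / 2 := e2.trans e5
        have h8 := norm_sub_norm_le (1 : ℂ) (1 + f x)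
        rw [norm_one, sub_add_cancel_left, norm_neg, add_comm] at h8
        linarith
      have e7 : f x * (Q x - (-qp : ℝ)) = (q x - qp) + qp * (f x + 1) := by
        rw [hQf x hx]; push_cast; ring
      have e8 : ‖f x‖ * ‖Q x - (-qp : ℝ)‖ ≤ (C + |qp| * (2 * K)) * w x.re := by
        rw [← norm_mul, e7]
        refine (norm_add_le _ _).trans ?_
        rw [norm_mul, Complex.norm_real, Real.norm_eq_abs]
        have : ‖f x + 1‖ ≤ 2 * K * w x.re := by
          calc _ ≤ _ := e2
            _ ≤ 2 * (K * w x.re) := by linarith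
            _ = _ := by ring
        calc _ ≤ C * w x.re + |qp| * (2 * K * w x.re) := by gcongr
          _ = _ := by ring
      have := mul_le_mul_of_nonneg_right e6 (norm_nonneg (Q x - (-qp : ℝ)))
      linarith
  have hQne : ∀ s : ℝ, (Q s).re ≠ 0 := fun s h0 => by
    have h1 : Q s = 0 := Complex.ext h0 (hreal s)
    by_cases hst : s = t
    · rw [hQ, hst] at h1
      simp only [dslope_same, div_eq_zero_iff, ht', false_or] at h1
      exact hdsne t htm (by rw [dslope_same, h1])
    · exact hne s hst (by rw [hQf s (ofReal_mem hη s), h1, mul_zero])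
  have hpos : ∀ s : ℝ, 0 < (Q s).re := fun s => by
    by_contra hneg
    obtain ⟨s', hs'⟩ := ((hscat.tendsto_re_bot hw hη).eventually (lt_mem_nhds hqm)).exists
    obtain ⟨r, hr⟩ := mem_range_of_exists_le_of_exists_ge (hscat.continuous_re hη)
      ⟨s, not_lt.1 hneg⟩ ⟨s', hs'.le⟩
    exact hQne r hr
  have hqp' : qp < 0 := by
    have h1 : 0 ≤ -qp := ge_of_tendsto (hscat.tendsto_re_top hw hη)
      (Eventually.of_forall fun s => (hpos s).le)
    exact lt_of_le_of_ne (by linarith) hqp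
  obtain ⟨a, ha, η', hη', hlt, hlow⟩ := hscat.exists_re_lower hw hη hqm (by linarith) hpos
  exact ⟨hqp', η', hη', hlt, Q, hscat.mono hlt.le, ⟨a, ha, hlow⟩, fun x hx =>
    hQf x (HStrip_mono (by linarith) hlt.le hx)⟩

/-- The square root on the closed lower half plane with values in the fourth quadrant. -/
noncomputable def usqrt (f : ℂ) : ℂ :=
  Complex.exp (-(Real.pi / 4 : ℝ) * Complex.I) * (Complex.I * f) ^ (1 / 2 : ℂ)

lemma usqrt_sq (f : ℂ) : usqrt f ^ 2 = f := by
  have h1 : Complex.exp (-(Real.pi / 4 : ℝ) * Complex.I) ^ 2 = -Complex.I := by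
    rw [← Complex.exp_nat_mul]
    have : ((2 : ℕ) : ℂ) * (-(Real.pi / 4 : ℝ) * Complex.I) = -Real.pi / 2 * Complex.I := by
      push_cast; ring
    rw [this, Complex.exp_neg_pi_div_two_mul_I]
  have h2 : ((Complex.I * f) ^ (1 / 2 : ℂ)) ^ 2 = Complex.I * f := by
    simp
  rw [usqrt, mul_pow, h1, h2, ← mul_assoc, neg_mul, Complex.I_mul_I, neg_neg, one_mul]

lemma usqrt_ne_zero {f : ℂ} (hf : f ≠ 0) : usqrt f ≠ 0 := fun h => hf (by
  rw [← usqrt_sq f, h]; ring)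

lemma usqrt_polar {f : ℂ} (hf : f.im ≤ 0) : ∃ ρ θ : ℝ, 0 ≤ ρ ∧ -(Real.pi / 2) ≤ θ ∧ θ ≤ 0 ∧
    usqrt f = ρ * Complex.exp (θ * Complex.I) := by
  by_cases h0 : f = 0
  · exact ⟨0, 0, le_rfl, by linarith [Real.pi_pos], le_rfl, by simp [usqrt, h0]⟩
  have h1 : Complex.I * f ≠ 0 := mul_ne_zero Complex.I_ne_zero h0
  have h2 : |Complex.arg (Complex.I * f)| ≤ Real.pi / 2 :=
    Complex.abs_arg_le_pi_div_two_iff.2 (by simpa using hf)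
  rw [abs_le] at h2
  refine ⟨Real.exp (Real.log ‖Complex.I * f‖ / 2), Complex.arg (Complex.I * f) / 2 - Real.pi / 4,
    (Real.exp_pos _).le, by linarith [h2.1], by linarith [h2.2], ?_⟩
  rw [usqrt, Complex.cpow_def_of_ne_zero h1, Complex.log, Complex.ofReal_exp, ← Complex.exp_add,
    ← Complex.exp_add]
  congr 1
  push_cast
  ring

lemma usqrt_re_nonneg {f : ℂ} (hf : f.im ≤ 0) : 0 ≤ (usqrt f).re := by
  obtain ⟨ρ, θ, hρ, h1, h2, h⟩ := usqrt_polar hf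
  rw [h, Complex.re_ofReal_mul, Complex.exp_ofReal_mul_I_re]
  exact mul_nonneg hρ (Real.cos_nonneg_of_neg_pi_div_two_le_of_le h1 (by linarith [Real.pi_pos]))

lemma usqrt_im_nonpos {f : ℂ} (hf : f.im ≤ 0) : (usqrt f).im ≤ 0 := by
  obtain ⟨ρ, θ, hρ, h1, h2, h⟩ := usqrt_polar hf
  rw [h, Complex.im_ofReal_mul, Complex.exp_ofReal_mul_I_im]
  exact mul_nonpos_of_nonneg_of_nonpos hρ
    (Real.sin_nonpos_of_nonpos_of_neg_pi_le h2 (by linarith [Real.pi_pos]))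

lemma usqrt_im_neg {f : ℂ} (hf : f.im < 0) : (usqrt f).im < 0 := by
  refine (usqrt_im_nonpos hf.le).lt_of_ne fun h => hf.ne ?_
  rw [← usqrt_sq f, sq, Complex.mul_im, h]; ring

lemma re_eq_usqrt (f : ℂ) : f.re = (usqrt f).re ^ 2 - (usqrt f).im ^ 2 := by
  conv_lhs => rw [← usqrt_sq f, sq, Complex.mul_re]
  ring

/-- For nonnegative real part, the square root lies in the upper octant. -/
lemma neg_im_usqrt_le_re {f : ℂ} (hf : f.im ≤ 0) (hr : 0 ≤ f.re) :
    -(usqrt f).im ≤ (usqrt f).re := by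
  rw [re_eq_usqrt] at hr
  exact le_of_sq_le_sq (by nlinarith) (usqrt_re_nonneg hf)

lemma re_usqrt_le_neg_im {f : ℂ} (hf : f.im ≤ 0) (hr : f.re ≤ 0) :
    (usqrt f).re ≤ -(usqrt f).im := by
  rw [re_eq_usqrt] at hr
  exact le_of_sq_le_sq (by nlinarith) (neg_nonneg.2 (usqrt_im_nonpos hf))

lemma norm_usqrt_sub_one_le {f : ℂ} (hf : f.im ≤ 0) : ‖usqrt f - 1‖ ≤ ‖f - 1‖ := by
  have h1 : f - 1 = (usqrt f - 1) * (usqrt f + 1) := by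
    conv_lhs => rw [← usqrt_sq f]
    ring
  have h2 := Complex.abs_re_le_norm (usqrt f + 1)
  have h3 := usqrt_re_nonneg hf
  rw [Complex.add_re, Complex.one_re, abs_of_nonneg (by linarith)] at h2
  rw [h1, norm_mul]
  exact le_mul_of_one_le_right (norm_nonneg _) (by linarith)

lemma norm_usqrt_add_I_le {f : ℂ} (hf : f.im ≤ 0) : ‖usqrt f + Complex.I‖ ≤ ‖f + 1‖ := by
  have h1 : f + 1 = (usqrt f + Complex.I) * (usqrt f - Complex.I) := by
    conv_lhs => rw [← usqrt_sq f]
    linear_combination Complex.I_sq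
  have h2 := Complex.abs_im_le_norm (usqrt f - Complex.I)
  have h3 := usqrt_im_nonpos hf
  rw [Complex.sub_im, Complex.I_im, abs_of_nonpos (by linarith)] at h2
  rw [h1, norm_mul]
  exact le_mul_of_one_le_right (norm_nonneg _) (by linarith)

lemma continuousAt_usqrt {f : ℂ} (hf : f.im ≤ 0) : ContinuousAt usqrt f := by
  refine continuousAt_const.mul ?_
  exact ContinuousAt.comp (f := fun f => Complex.I * f) (g := fun z => z ^ (1 / 2 : ℂ))
    (Complex.continuousAt_cpow_const_of_re_pos (Or.inl (by simpa using hf)) (by norm_num))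
    (by fun_prop)

lemma differentiableAt_usqrt {f : ℂ} (hf : f.im < 0) : DifferentiableAt ℂ usqrt f :=
  ((differentiableAt_id.const_mul Complex.I).cpow_const
    (Or.inl (by simpa using hf))).const_mul _

lemma usqrt_of_nonneg {r : ℝ} (hr : 0 ≤ r) : usqrt r = (Real.sqrt r : ℝ) := by
  have h1 : (usqrt r).im ≤ 0 := usqrt_im_nonpos (by simp)
  have h2 : 0 ≤ (usqrt r).re := usqrt_re_nonneg (by simp)
  have h3 := neg_im_usqrt_le_re (f := r) (by simp) (by simpa using hr)
  have h4 : (usqrt r).re * (usqrt r).im = 0 := by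
    have : ((r : ℂ)).im = 0 := by simp
    rw [← usqrt_sq (r : ℂ), sq, Complex.mul_im] at this
    linarith
  have h5 : (usqrt r).im = 0 := by
    rcases mul_eq_zero.1 h4 with h | h
    · linarith
    · exact h
  have h6 := re_eq_usqrt (r : ℂ)
  rw [h5, Complex.ofReal_re] at h6
  refine Complex.ext ?_ (by simpa using h5)
  rw [Complex.ofReal_re, h6]
  rw [show (usqrt ((((usqrt r).re ^ 2 - 0 ^ 2 : ℝ)) : ℂ)).re = (usqrt r).re by rw [← h6]]
  simp [Real.sqrt_sq h2]

lemma usqrt_of_nonpos {r : ℝ} (hr : r ≤ 0) :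
    usqrt r = -Complex.I * (Real.sqrt (-r) : ℝ) := by
  have h1 : (usqrt r).im ≤ 0 := usqrt_im_nonpos (by simp)
  have h2 : 0 ≤ (usqrt r).re := usqrt_re_nonneg (by simp)
  have h3 := re_usqrt_le_neg_im (f := r) (by simp) (by simpa using hr)
  have h4 : (usqrt r).re * (usqrt r).im = 0 := by
    have : ((r : ℂ)).im = 0 := by simp
    rw [← usqrt_sq (r : ℂ), sq, Complex.mul_im] at this
    linarith
  have h5 : (usqrt r).re = 0 := by
    rcases mul_eq_zero.1 h4 with h | h
    · exact h
    · linarith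
  have h6 := re_eq_usqrt (r : ℂ)
  rw [h5, Complex.ofReal_re] at h6
  have h7 : Real.sqrt (-r) = -(usqrt r).im := by
    rw [Real.sqrt_eq_iff_mul_self_eq (by linarith) (by linarith)]; linarith
  rw [h7]
  apply Complex.ext <;> simp [h5]

/-- Logarithm of a function with positive real part. -/
lemma IsScat.log {w : ℝ → ℝ} {η fm fp a : ℝ} {f : ℂ → ℂ} (h : IsScat w η f fm fp) (ha : 0 < a)
    (hf : ∀ x ∈ HStrip (-η) η, a ≤ (f x).re) (hη : 0 < η) (hm : a ≤ fm) (hp : a ≤ fp) :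
    IsScat w η (fun x => Complex.log (f x)) (Real.log fm) (Real.log fp) := by
  have hslit : ∀ z : ℂ, a ≤ z.re → z ∈ Complex.slitPlane := fun z hz => Or.inl (ha.trans_le hz)
  have hlip : ∀ z z' : ℂ, a ≤ z.re → a ≤ z'.re →
      ‖Complex.log z - Complex.log z'‖ ≤ a⁻¹ * ‖z - z'‖ := fun z z' hz hz' => by
    refine (convex_halfSpace_re_ge a).norm_image_sub_le_of_norm_deriv_le (𝕜 := ℂ)
      (f := Complex.log) (fun y hy => (Complex.hasDerivAt_log (hslit y hy)).differentiableAt)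
      (fun y hy => ?_) hz' hz
    rw [(Complex.hasDerivAt_log (hslit y hy)).deriv, norm_inv]
    exact inv_anti₀ ha (le_trans hy (Complex.re_le_norm y))
  have hre : ∀ r : ℝ, a ≤ r → a ≤ (r : ℂ).re := fun r hr => by simpa using hr
  refine ⟨fun x hx => (h.diff x hx).clog (hslit _ (hf x hx)), fun s => ?_, ?_, ?_⟩
  · rw [← h.ofReal_re s, ← Complex.ofReal_log (ha.le.trans (hf _ (ofReal_mem hη s)))]
    exact Complex.ofReal_im _
  · obtain ⟨C, R, hb⟩ := h.bot
    refine ⟨a⁻¹ * C, R, fun x hx hR => ?_⟩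
    rw [Complex.ofReal_log (ha.le.trans hm), mul_assoc]
    exact (hlip _ _ (hf x hx) (hre _ hm)).trans
      (mul_le_mul_of_nonneg_left (hb x hx hR) (inv_nonneg.2 ha.le))
  · obtain ⟨C, R, hb⟩ := h.top
    refine ⟨a⁻¹ * C, R, fun x hx hR => ?_⟩
    rw [Complex.ofReal_log (ha.le.trans hp), mul_assoc]
    exact (hlip _ _ (hf x hx) (hre _ hp)).trans
      (mul_le_mul_of_nonneg_left (hb x hx hR) (inv_nonneg.2 ha.le))

/-- Two functions `p`, `q` on a strip with exactly one simple real zero each, `t₂` and `t₁`,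
and with the zeros factored out. -/
structure Barrier (w : ℝ → ℝ) (η t₁ t₂ : ℝ) (p q P Q : ℂ → ℂ) (pm pp qm qp a₀ : ℝ) : Prop where
  weight : IsWeight w
  exp_le : ∀ t : ℝ, ∃ K, 0 ≤ K ∧ ∀ s, Real.exp (-(2 * |s - t|)) ≤ K * w s
  η_pos : 0 < η
  η_le : η ≤ Real.pi / 4
  lt : t₁ < t₂
  scat_p : IsScat w η p pm pp
  scat_q : IsScat w η q qm qp
  scat_P : IsScat w η P pm (-pp)
  scat_Q : IsScat w η Q qm (-qp)
  a₀_pos : 0 < a₀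
  le_pm : a₀ ≤ pm
  le_pp : a₀ ≤ -pp
  le_qm : a₀ ≤ qm
  le_qp : a₀ ≤ -qp
  re_P : ∀ x ∈ HStrip (-η) η, a₀ ≤ (P x).re
  re_Q : ∀ x ∈ HStrip (-η) η, a₀ ≤ (Q x).re
  eq_p : ∀ x ∈ HStrip (-η) η, p x = mtanh (x - t₂) * P x
  eq_q : ∀ x ∈ HStrip (-η) η, q x = mtanh (x - t₁) * Q x

/-- The holomorphic branch of `√(pq)` in the upper half strip. -/
noncomputable def mom (t₁ t₂ : ℝ) (P Q : ℂ → ℂ) (x : ℂ) : ℂ :=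
  usqrt (mtanh (x - t₁)) * usqrt (mtanh (x - t₂)) *
    Complex.exp ((Complex.log (Q x) + Complex.log (P x)) / 2)

/-- The holomorphic branch of `(p/q)^{1/4}` in the upper half strip. -/
noncomputable def amp (t₁ t₂ : ℝ) (P Q : ℂ → ℂ) (x : ℂ) : ℂ :=
  usqrt (usqrt (mtanh (x - t₂))) / usqrt (usqrt (mtanh (x - t₁))) *
    Complex.exp ((Complex.log (P x) - Complex.log (Q x)) / 4)

namespace Barrier

variable {w : ℝ → ℝ} {η t₁ t₂ : ℝ} {p q P Q : ℂ → ℂ} {pm pp qm qp a₀ : ℝ}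
variable (h : Barrier w η t₁ t₂ p q P Q pm pp qm qp a₀)
include h

lemma mem_of_upper {x : ℂ} (hx : x ∈ HStrip 0 η) : x ∈ HStrip (-η) η :=
  HStrip_mono (by linarith [h.η_pos]) le_rfl hx

omit h in
lemma mem_of_closed {x : ℂ} (h0 : 0 ≤ x.im) (h1 : x.im < η) : x ∈ HStrip (-η) η :=
  ⟨by linarith, h1⟩

lemma P_ne {x : ℂ} (hx : x ∈ HStrip (-η) η) : P x ≠ 0 := fun h0 => by
  have := h.re_P x hx
  rw [h0, Complex.zero_re] at this
  linarith [h.a₀_pos]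

lemma Q_ne {x : ℂ} (hx : x ∈ HStrip (-η) η) : Q x ≠ 0 := fun h0 => by
  have := h.re_Q x hx
  rw [h0, Complex.zero_re] at this
  linarith [h.a₀_pos]

lemma exp_half_sq {x : ℂ} (hx : x ∈ HStrip (-η) η) :
    Complex.exp ((Complex.log (Q x) + Complex.log (P x)) / 2) ^ 2 = Q x * P x := by
  rw [← Complex.exp_nat_mul, Nat.cast_ofNat, mul_div_cancel₀ _ two_ne_zero, Complex.exp_add,
    Complex.exp_log (h.Q_ne hx), Complex.exp_log (h.P_ne hx)]

lemma mom_sq {x : ℂ} (hx : x ∈ HStrip (-η) η) : mom t₁ t₂ P Q x ^ 2 = p x * q x := by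
  rw [mom, mul_pow, mul_pow, usqrt_sq, usqrt_sq, h.exp_half_sq hx, h.eq_p x hx, h.eq_q x hx]
  ring

omit h in
lemma sub_im (x : ℂ) (t : ℝ) : (x - (t : ℂ)).im = x.im := by simp

lemma factor_im_nonpos {x : ℂ} (h0 : 0 ≤ x.im) (h1 : x.im < η) (t : ℝ) :
    (mtanh (x - t)).im ≤ 0 :=
  mtanh_im_nonpos (by rwa [sub_im]) (by rw [sub_im]; linarith [h.η_le])

lemma factor_im_neg {x : ℂ} (hx : x ∈ HStrip 0 η) (t : ℝ) : (mtanh (x - t)).im < 0 :=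
  mtanh_im_neg (by rw [sub_im]; exact hx.1) (by rw [sub_im]; linarith [h.η_le, hx.2])

lemma factor_ne {x : ℂ} (hx : x ∈ HStrip 0 η) (t : ℝ) : mtanh (x - t) ≠ 0 := fun h0 => by
  have := h.factor_im_neg hx t
  rw [h0] at this; simp at this

lemma sub_mem {x : ℂ} (hx : x ∈ HStrip (-η) η) (t : ℝ) :
    x - t ∈ HStrip (-(Real.pi / 4)) (Real.pi / 4) :=
  ⟨by rw [sub_im]; linarith [h.η_le, hx.1], by rw [sub_im]; linarith [h.η_le, hx.2]⟩

lemma differentiableAt_factor {x : ℂ} (hx : x ∈ HStrip (-η) η) (t : ℝ) :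
    DifferentiableAt ℂ (fun x : ℂ => mtanh (x - t)) x :=
  ((hasDerivAt_mtanh (h.sub_mem hx t)).comp_sub_const x t).differentiableAt

lemma mom_ne {x : ℂ} (hx : x ∈ HStrip 0 η) : mom t₁ t₂ P Q x ≠ 0 :=
  mul_ne_zero (mul_ne_zero (usqrt_ne_zero (h.factor_ne hx _)) (usqrt_ne_zero (h.factor_ne hx _)))
    (Complex.exp_ne_zero _)

lemma amp_ne {x : ℂ} (hx : x ∈ HStrip 0 η) : amp t₁ t₂ P Q x ≠ 0 :=
  mul_ne_zero (div_ne_zero (usqrt_ne_zero (usqrt_ne_zero (h.factor_ne hx _)))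
    (usqrt_ne_zero (usqrt_ne_zero (h.factor_ne hx _)))) (Complex.exp_ne_zero _)

lemma log_P {x : ℂ} (hx : x ∈ HStrip (-η) η) :
    DifferentiableAt ℂ (fun x => Complex.log (P x)) x :=
  ((h.scat_P.diff.differentiableAt ((isOpen_HStrip _ _).mem_nhds hx))).clog
    (Or.inl (h.a₀_pos.trans_le (h.re_P x hx)))

lemma log_Q {x : ℂ} (hx : x ∈ HStrip (-η) η) :
    DifferentiableAt ℂ (fun x => Complex.log (Q x)) x :=
  ((h.scat_Q.diff.differentiableAt ((isOpen_HStrip _ _).mem_nhds hx))).clog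
    (Or.inl (h.a₀_pos.trans_le (h.re_Q x hx)))

lemma continuousAt_mom {x : ℂ} (h0 : 0 ≤ x.im) (h1 : x.im < η) :
    ContinuousAt (mom t₁ t₂ P Q) x := by
  have hx := mem_of_closed h0 h1
  have hf : ∀ t : ℝ, ContinuousAt (fun x : ℂ => usqrt (mtanh (x - t))) x := fun t =>
    ContinuousAt.comp (f := fun x : ℂ => mtanh (x - t))
      (continuousAt_usqrt (h.factor_im_nonpos h0 h1 t))
      (h.differentiableAt_factor hx t).continuousAt
  exact ((hf t₁).mul (hf t₂)).mul
    (((h.log_Q hx).continuousAt.add (h.log_P hx).continuousAt).div_const 2).cexp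

lemma differentiableAt_sqrt_factor {x : ℂ} (hx : x ∈ HStrip 0 η) (t : ℝ) :
    DifferentiableAt ℂ (fun x : ℂ => usqrt (mtanh (x - t))) x :=
  DifferentiableAt.comp (g := usqrt) x (differentiableAt_usqrt (h.factor_im_neg hx t))
    (h.differentiableAt_factor (h.mem_of_upper hx) t)

lemma differentiableAt_mom {x : ℂ} (hx : x ∈ HStrip 0 η) :
    DifferentiableAt ℂ (mom t₁ t₂ P Q) x := by
  have hx' := h.mem_of_upper hx
  have hf := h.differentiableAt_sqrt_factor hx
  exact ((hf t₁).mul (hf t₂)).mul (((h.log_Q hx').add (h.log_P hx')).div_const 2).cexp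

lemma differentiableAt_amp {x : ℂ} (hx : x ∈ HStrip 0 η) :
    DifferentiableAt ℂ (amp t₁ t₂ P Q) x := by
  have hx' := h.mem_of_upper hx
  have hf : ∀ t : ℝ, DifferentiableAt ℂ (fun x : ℂ => usqrt (usqrt (mtanh (x - t)))) x := fun t =>
    DifferentiableAt.comp (g := usqrt) x
      (differentiableAt_usqrt (usqrt_im_neg (h.factor_im_neg hx t)))
      (h.differentiableAt_sqrt_factor hx t)
  exact ((hf t₂).div (hf t₁) (usqrt_ne_zero (usqrt_ne_zero (h.factor_ne hx _)))).mul
    (((h.log_P hx').sub (h.log_Q hx')).div_const 4).cexp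

lemma p_eq {x : ℂ} (hx : x ∈ HStrip 0 η) :
    p x = mom t₁ t₂ P Q x * amp t₁ t₂ P Q x ^ 2 := by
  have hx' := h.mem_of_upper hx
  have h1 := usqrt_ne_zero (h.factor_ne hx t₁)
  rw [mom, amp, mul_pow, div_pow, usqrt_sq, usqrt_sq, h.eq_p x hx', ← usqrt_sq (mtanh (x - t₂)),
    ← Complex.exp_nat_mul]
  conv_lhs => rw [← Complex.exp_log (h.P_ne hx')]
  have h2 : Complex.exp (Complex.log (P x)) =
      Complex.exp ((Complex.log (Q x) + Complex.log (P x)) / 2) *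
        Complex.exp ((2 : ℕ) * ((Complex.log (P x) - Complex.log (Q x)) / 4)) := by
    rw [← Complex.exp_add]; congr 1; push_cast; ring
  rw [h2, usqrt_sq]
  field_simp
  rw [usqrt_sq]

lemma q_mul {x : ℂ} (hx : x ∈ HStrip 0 η) :
    q x * amp t₁ t₂ P Q x ^ 2 = mom t₁ t₂ P Q x := by
  have h1 := h.mom_sq (h.mem_of_upper hx)
  rw [h.p_eq hx] at h1
  refine mul_left_cancel₀ (h.mom_ne hx) ?_
  linear_combination -h1

lemma hasDerivAt_amp {x : ℂ} (hx : x ∈ HStrip 0 η) :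
    HasDerivAt (amp t₁ t₂ P Q) ((deriv p x / p x - deriv q x / q x) / 4 * amp t₁ t₂ P Q x) x := by
  have ha := (h.differentiableAt_amp hx).hasDerivAt
  have hx' := h.mem_of_upper hx
  have hnhds := (isOpen_HStrip _ _).mem_nhds hx'
  have hp := (h.scat_p.diff.differentiableAt hnhds).hasDerivAt
  have hq := (h.scat_q.diff.differentiableAt hnhds).hasDerivAt
  have hane := h.amp_ne hx
  have hkne := h.mom_ne hx
  have hp0 : p x ≠ 0 := by
    rw [h.p_eq hx]; exact mul_ne_zero hkne (pow_ne_zero _ hane)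
  have hq0 : q x ≠ 0 := fun h0 => hkne (by rw [← h.q_mul hx, h0, zero_mul])
  have h4 : ∀ y ∈ HStrip 0 η, q y * amp t₁ t₂ P Q y ^ 4 = p y := fun y hy => by
    rw [h.p_eq hy, ← h.q_mul hy]; ring
  have h5 : (fun y => q y * amp t₁ t₂ P Q y ^ 4) =ᶠ[𝓝 x] p :=
    (eventually_of_mem ((isOpen_HStrip _ _).mem_nhds hx) h4)
  have h6 := ((hq.mul (ha.pow 4)).congr_of_eventuallyEq h5.symm).unique hp
  refine ha.congr_deriv ?_
  have h7 := h4 x hx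
  rw [← h6, ← h7]
  simp only [Pi.pow_apply]
  field_simp
  push_cast
  ring

lemma scat_log_P : IsScat w η (fun x => Complex.log (P x)) (Real.log pm) (Real.log (-pp)) :=
  h.scat_P.log h.a₀_pos h.re_P h.η_pos h.le_pm h.le_pp

lemma scat_log_Q : IsScat w η (fun x => Complex.log (Q x)) (Real.log qm) (Real.log (-qp)) :=
  h.scat_Q.log h.a₀_pos h.re_Q h.η_pos h.le_qm h.le_qp

lemma exp_half_re_pos {x : ℂ} (hx : x ∈ HStrip (-η) η) :
    0 < (Complex.exp ((Complex.log (Q x) + Complex.log (P x)) / 2)).re := by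
  rw [Complex.exp_re]
  refine mul_pos (Real.exp_pos _) (Real.cos_pos_of_mem_Ioo ?_)
  have h1 := Complex.abs_arg_lt_pi_div_two_iff.2 (Or.inl (h.a₀_pos.trans_le (h.re_P x hx)))
  have h2 := Complex.abs_arg_lt_pi_div_two_iff.2 (Or.inl (h.a₀_pos.trans_le (h.re_Q x hx)))
  rw [abs_lt] at h1 h2
  have h3 : ((Complex.log (Q x) + Complex.log (P x)) / 2).im =
      (Complex.arg (Q x) + Complex.arg (P x)) / 2 := by
    rw [Complex.div_ofNat_im, Complex.add_im, Complex.log_im, Complex.log_im]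
  rw [h3]
  exact ⟨by linarith, by linarith⟩

lemma norm_exp_half_sub_le {x : ℂ} (hx : x ∈ HStrip (-η) η) {a b : ℝ} (ha : 0 < a) (hb : 0 < b) :
    ‖Complex.exp ((Complex.log (Q x) + Complex.log (P x)) / 2) - Real.sqrt (a * b)‖ ≤
      (‖Q x‖ * ‖P x - b‖ + b * ‖Q x - a‖) / Real.sqrt (a * b) := by
  set F := Complex.exp ((Complex.log (Q x) + Complex.log (P x)) / 2) with hF
  have hc : 0 < Real.sqrt (a * b) := Real.sqrt_pos.2 (mul_pos ha hb)
  have h1 : (F - Real.sqrt (a * b)) * (F + Real.sqrt (a * b)) =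
      Q x * (P x - b) + b * (Q x - a) := by
    have h2 : ((Real.sqrt (a * b) : ℝ) : ℂ) ^ 2 = a * b := by
      rw [← Complex.ofReal_pow, Real.sq_sqrt (mul_pos ha hb).le, Complex.ofReal_mul]
    linear_combination h.exp_half_sq hx - h2
  have h3 : Real.sqrt (a * b) ≤ ‖F + Real.sqrt (a * b)‖ := by
    refine le_trans ?_ (Complex.re_le_norm _)
    have := h.exp_half_re_pos hx
    rw [Complex.add_re, Complex.ofReal_re]; linarith
  rw [le_div_iff₀ hc]
  calc _ ≤ ‖F - Real.sqrt (a * b)‖ * ‖F + Real.sqrt (a * b)‖ := by gcongr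
    _ = ‖Q x * (P x - b) + b * (Q x - a)‖ := by rw [← norm_mul, h1]
    _ ≤ _ := by
      refine (norm_add_le _ _).trans (le_of_eq ?_)
      rw [norm_mul, norm_mul, Complex.norm_real, Real.norm_of_nonneg hb.le]

omit h in
lemma mom_sub_le {x v : ℂ} (hv : ‖v‖ = 1) {c C D y : ℝ} (hc : 0 ≤ c) (hC : 0 ≤ C) (hy' : y ≤ 1)
    (h1 : ‖usqrt (mtanh (x - t₁)) - v‖ ≤ C * y) (h2 : ‖usqrt (mtanh (x - t₂)) - v‖ ≤ C * y)
    (hF : ‖Complex.exp ((Complex.log (Q x) + Complex.log (P x)) / 2) - c‖ ≤ D * y) :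
    ‖mom t₁ t₂ P Q x - v ^ 2 * c‖ ≤ ((1 + C) * (1 + C) * D + c * ((1 + C) * C + C)) * y := by
  rw [mom]
  set s₁ := usqrt (mtanh (x - t₁))
  set s₂ := usqrt (mtanh (x - t₂))
  set F := Complex.exp ((Complex.log (Q x) + Complex.log (P x)) / 2)
  have hCy : C * y ≤ C := mul_le_of_le_one_right hC hy'
  have n1 : ‖s₁‖ ≤ 1 + C := by
    have := norm_add_le (s₁ - v) v
    rw [sub_add_cancel, hv] at this; linarith
  have n2 : ‖s₂‖ ≤ 1 + C := by
    have := norm_add_le (s₂ - v) v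
    rw [sub_add_cancel, hv] at this; linarith
  have e : s₁ * s₂ * F - v ^ 2 * c = s₁ * s₂ * (F - c) + c * (s₁ * (s₂ - v) + v * (s₁ - v)) := by
    ring
  have e2 : ‖s₁ * (s₂ - v) + v * (s₁ - v)‖ ≤ (1 + C) * (C * y) + 1 * (C * y) := by
    refine (norm_add_le _ _).trans ?_
    rw [norm_mul, norm_mul, hv]
    gcongr
  rw [e]
  refine (norm_add_le _ _).trans ?_
  rw [norm_mul, norm_mul, norm_mul, Complex.norm_real, Real.norm_of_nonneg hc]
  calc _ ≤ (1 + C) * (1 + C) * (D * y) + c * ((1 + C) * (C * y) + 1 * (C * y)) := by gcongr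
    _ = _ := by ring

lemma mom_left {η' : ℝ} (hη : η' < η) (T : ℝ) : ∃ C, 0 ≤ C ∧ ∀ x : ℂ, 0 ≤ x.im → x.im < η' →
    x.re ≤ T → ‖mom t₁ t₂ P Q x - Real.sqrt (qm * pm)‖ ≤ C * w x.re := by
  have hw := h.weight
  have hqm := h.a₀_pos.trans_le h.le_qm
  have hpm := h.a₀_pos.trans_le h.le_pm
  obtain ⟨M, hM, hMb⟩ := h.scat_Q.bounded hw hη
  obtain ⟨C₁, hC₁, h1⟩ := h.scat_P.bound_left hw hη T
  obtain ⟨C₂, hC₂, h2⟩ := h.scat_Q.bound_left hw hη T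
  have hroot : ∀ t : ℝ, ∃ C, 0 ≤ C ∧ ∀ x : ℂ, 0 ≤ x.im → x.im < η' → x.re ≤ T →
      ‖usqrt (mtanh (x - t)) - 1‖ ≤ C * w x.re := fun t => by
    obtain ⟨K, hK, hKb⟩ := h.exp_le t
    refine ⟨2 * Real.exp (4 * |T - t|) * K, by positivity, fun x h3 h4 h5 => ?_⟩
    have h6 := norm_mtanh_sub_one (h.sub_mem (mem_of_closed h3 (h4.trans hη)) t)
    rw [Complex.sub_re, Complex.ofReal_re] at h6
    refine (norm_usqrt_sub_one_le (h.factor_im_nonpos h3 (h4.trans hη) t)).trans (h6.trans ?_)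
    have h7 : Real.exp (2 * (x.re - t)) ≤
        Real.exp (4 * |T - t|) * Real.exp (-(2 * |x.re - t|)) := by
      rw [← Real.exp_add, Real.exp_le_exp]
      have := le_abs_self (T - t)
      have := abs_nonneg (T - t)
      rcases abs_cases (x.re - t) with ⟨h8, -⟩ | ⟨h8, -⟩ <;> rw [h8] <;> linarith
    have h8 := mul_le_mul_of_nonneg_left (hKb x.re) (Real.exp_pos (4 * |T - t|)).le
    linarith
  obtain ⟨D₁, hD₁, r1⟩ := hroot t₁
  obtain ⟨D₂, hD₂, r2⟩ := hroot t₂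
  set c := Real.sqrt (qm * pm) with hc
  refine ⟨(1 + (D₁ + D₂)) * (1 + (D₁ + D₂)) * ((M * C₁ + pm * C₂) / c) +
    c * ((1 + (D₁ + D₂)) * (D₁ + D₂) + (D₁ + D₂)), by positivity, fun x h3 h4 h5 => ?_⟩
  have hp := (hw.pos x.re).le
  have hx' : x ∈ HStrip (-η') η' := mem_of_closed h3 h4
  have := mom_sub_le (P := P) (Q := Q) (t₁ := t₁) (t₂ := t₂) (x := x) (v := 1) norm_one
    (c := c) (C := D₁ + D₂) (D := (M * C₁ + pm * C₂) / c) (Real.sqrt_nonneg _)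
    (by positivity) (hw.le_one _)
    ((r1 x h3 h4 h5).trans (mul_le_mul_of_nonneg_right (by linarith) hp))
    ((r2 x h3 h4 h5).trans (mul_le_mul_of_nonneg_right (by linarith) hp))
    (by
      refine (h.norm_exp_half_sub_le (mem_of_closed h3 (h4.trans hη)) hqm hpm).trans ?_
      rw [div_mul_eq_mul_div]
      refine div_le_div_of_nonneg_right ?_ (Real.sqrt_nonneg _)
      calc _ ≤ M * (C₁ * w x.re) + pm * (C₂ * w x.re) := by
            have := hMb x hx'
            have := h1 x hx' h5
            have := h2 x hx' h5
            gcongr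
        _ = _ := by ring)
  simpa using this

lemma mom_right {η' : ℝ} (hη : η' < η) (T : ℝ) : ∃ C, 0 ≤ C ∧ ∀ x : ℂ, 0 ≤ x.im → x.im < η' →
    T ≤ x.re → ‖mom t₁ t₂ P Q x + Real.sqrt (qp * pp)‖ ≤ C * w x.re := by
  have hw := h.weight
  have hqp := h.a₀_pos.trans_le h.le_qp
  have hpp := h.a₀_pos.trans_le h.le_pp
  obtain ⟨M, hM, hMb⟩ := h.scat_Q.bounded hw hη
  obtain ⟨C₁, hC₁, h1⟩ := h.scat_P.bound_right hw hη T
  obtain ⟨C₂, hC₂, h2⟩ := h.scat_Q.bound_right hw hη T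
  have hroot : ∀ t : ℝ, ∃ C, 0 ≤ C ∧ ∀ x : ℂ, 0 ≤ x.im → x.im < η' → T ≤ x.re →
      ‖usqrt (mtanh (x - t)) - -Complex.I‖ ≤ C * w x.re := fun t => by
    obtain ⟨K, hK, hKb⟩ := h.exp_le t
    refine ⟨2 * Real.exp (4 * |T - t|) * K, by positivity, fun x h3 h4 h5 => ?_⟩
    have h6 := norm_mtanh_add_one (h.sub_mem (mem_of_closed h3 (h4.trans hη)) t)
    rw [Complex.sub_re, Complex.ofReal_re] at h6
    rw [sub_neg_eq_add]
    refine (norm_usqrt_add_I_le (h.factor_im_nonpos h3 (h4.trans hη) t)).trans (h6.trans ?_)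
    have h7 : Real.exp (-(2 * (x.re - t))) ≤
        Real.exp (4 * |T - t|) * Real.exp (-(2 * |x.re - t|)) := by
      rw [← Real.exp_add, Real.exp_le_exp]
      have := neg_abs_le (T - t)
      have := abs_nonneg (T - t)
      rcases abs_cases (x.re - t) with ⟨h8, -⟩ | ⟨h8, -⟩ <;> rw [h8] <;> linarith
    have h8 := mul_le_mul_of_nonneg_left (hKb x.re) (Real.exp_pos (4 * |T - t|)).le
    linarith
  obtain ⟨D₁, hD₁, r1⟩ := hroot t₁
  obtain ⟨D₂, hD₂, r2⟩ := hroot t₂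
  have hc' : qp * pp = -qp * -pp := by ring
  set c := Real.sqrt (qp * pp) with hc
  refine ⟨(1 + (D₁ + D₂)) * (1 + (D₁ + D₂)) * ((M * C₁ + -pp * C₂) / c) +
    c * ((1 + (D₁ + D₂)) * (D₁ + D₂) + (D₁ + D₂)), by positivity, fun x h3 h4 h5 => ?_⟩
  have hp := (hw.pos x.re).le
  have hx' : x ∈ HStrip (-η') η' := mem_of_closed h3 h4
  have := mom_sub_le (P := P) (Q := Q) (t₁ := t₁) (t₂ := t₂) (x := x) (v := -Complex.I) (by simp)
    (c := c) (C := D₁ + D₂) (D := (M * C₁ + -pp * C₂) / c) (Real.sqrt_nonneg _)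
    (by positivity) (hw.le_one _)
    ((r1 x h3 h4 h5).trans (mul_le_mul_of_nonneg_right (by linarith) hp))
    ((r2 x h3 h4 h5).trans (mul_le_mul_of_nonneg_right (by linarith) hp))
    (by
      rw [hc, hc']
      refine (h.norm_exp_half_sub_le (mem_of_closed h3 (h4.trans hη)) hqp hpp).trans ?_
      rw [div_mul_eq_mul_div]
      refine div_le_div_of_nonneg_right ?_ (Real.sqrt_nonneg _)
      calc _ ≤ M * (C₁ * w x.re) + -pp * (C₂ * w x.re) := by
            have := hMb x hx'
            have := h1 x hx' h5
            have := h2 x hx' h5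
            gcongr
        _ = _ := by ring)
  simpa using this

lemma exp_half_real (s : ℝ) : ∃ e : ℝ, 0 < e ∧
    Complex.exp ((Complex.log (Q s) + Complex.log (P s)) / 2) = e := by
  have h1 : ((Complex.log (Q s) + Complex.log (P s)) / 2).im = 0 := by
    rw [Complex.div_ofNat_im, Complex.add_im, h.scat_log_P.real, h.scat_log_Q.real]; simp
  refine ⟨_, Real.exp_pos ((Complex.log (Q s) + Complex.log (P s)) / 2).re, ?_⟩
  rw [Complex.ofReal_exp]; congr 1; exact Complex.ext rfl (by simp [h1])

lemma mom_sq_real (s : ℝ) : mom t₁ t₂ P Q s ^ 2 = ((p s).re * (q s).re : ℝ) := by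
  rw [h.mom_sq (IsScat.ofReal_mem h.η_pos s), Complex.ofReal_mul, h.scat_p.ofReal_re,
    h.scat_q.ofReal_re]

omit h in
lemma factor_real (s t : ℝ) : mtanh ((s : ℂ) - t) = ((mtanh ((s : ℂ) - t)).re : ℝ) := by
  refine Complex.ext rfl ?_
  rw [Complex.ofReal_im, ← Complex.ofReal_sub]
  exact mtanh_ofReal_im _

omit h in
lemma usqrt_factor_left {s t : ℝ} (hs : s ≤ t) :
    ∃ r : ℝ, 0 ≤ r ∧ usqrt (mtanh ((s : ℂ) - t)) = r :=
  ⟨_, Real.sqrt_nonneg _, by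
    rw [factor_real s t]; exact usqrt_of_nonneg (mtanh_re_nonneg (by simpa using hs))⟩

omit h in
lemma usqrt_factor_right {s t : ℝ} (hs : t ≤ s) :
    ∃ r : ℝ, 0 ≤ r ∧ usqrt (mtanh ((s : ℂ) - t)) = -Complex.I * r :=
  ⟨_, Real.sqrt_nonneg _, by
    rw [factor_real s t]; exact usqrt_of_nonpos (mtanh_re_nonpos (by simpa using hs))⟩

lemma mom_real_left {s : ℝ} (hs : s ≤ t₁) :
    mom t₁ t₂ P Q s = Real.sqrt ((p s).re * (q s).re) := by
  obtain ⟨a, ha, h1⟩ := usqrt_factor_left hs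
  obtain ⟨b, hb, h2⟩ := usqrt_factor_left (hs.trans h.lt.le)
  obtain ⟨e, he, h3⟩ := h.exp_half_real s
  have h4 : mom t₁ t₂ P Q s = (a * b * e : ℝ) := by rw [mom, h1, h2, h3]; push_cast; ring
  have h5 := h.mom_sq_real s
  rw [h4, ← Complex.ofReal_pow, Complex.ofReal_inj] at h5
  rw [h4, ← h5, Real.sqrt_sq (by positivity)]

lemma mom_real_mid {s : ℝ} (hs : t₁ ≤ s) (hs' : s ≤ t₂) :
    mom t₁ t₂ P Q s = -Complex.I * Real.sqrt (-((p s).re * (q s).re)) := by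
  obtain ⟨a, ha, h1⟩ := usqrt_factor_right hs
  obtain ⟨b, hb, h2⟩ := usqrt_factor_left hs'
  obtain ⟨e, he, h3⟩ := h.exp_half_real s
  have h4 : mom t₁ t₂ P Q s = -Complex.I * (a * b * e : ℝ) := by
    rw [mom, h1, h2, h3]; push_cast; ring
  have h5 := h.mom_sq_real s
  rw [h4, mul_pow, neg_sq, Complex.I_sq, ← Complex.ofReal_pow, ← Complex.ofReal_one,
    ← Complex.ofReal_neg, ← Complex.ofReal_mul, Complex.ofReal_inj] at h5
  rw [h4, ← h5, neg_one_mul, neg_neg, Real.sqrt_sq (by positivity)]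

lemma mom_real_right {s : ℝ} (hs : t₂ ≤ s) :
    mom t₁ t₂ P Q s = -Real.sqrt ((p s).re * (q s).re) := by
  obtain ⟨a, ha, h1⟩ := usqrt_factor_right (h.lt.le.trans hs)
  obtain ⟨b, hb, h2⟩ := usqrt_factor_right hs
  obtain ⟨e, he, h3⟩ := h.exp_half_real s
  have h4 : mom t₁ t₂ P Q s = -(a * b * e : ℝ) := by
    rw [mom, h1, h2, h3]; push_cast; linear_combination (a * b * e : ℂ) * Complex.I_sq
  have h5 := h.mom_sq_real s
  rw [h4, neg_sq, ← Complex.ofReal_pow, Complex.ofReal_inj] at h5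
  rw [h4, ← h5, Real.sqrt_sq (by positivity)]

end Barrier

lemma im_mul_nonpos_of_quadrant {A B ψ y : ℝ} (hψ : |ψ| ≤ 1 / 8) (hy : |y| ≤ 1 / 4) (hB : 0 ≤ B)
    (h : (0 ≤ A ∧ y ≤ -(2 * |ψ|)) ∨ |A| ≤ B ∨ (A ≤ 0 ∧ 2 * |ψ| ≤ y)) :
    A * (Real.sin ψ + y * Real.cos ψ) - B * (Real.cos ψ - y * Real.sin ψ) ≤ 0 := by
  have hs : |Real.sin ψ| ≤ |ψ| := Real.abs_sin_le_abs
  have hc1 : Real.cos ψ ≤ 1 := Real.cos_le_one ψ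
  have hψ2 : ψ ^ 2 ≤ 1 / 64 := by
    have := pow_le_pow_left₀ (abs_nonneg ψ) hψ 2
    rw [sq_abs] at this; linarith
  have hc : 1 / 2 ≤ Real.cos ψ := by
    have := Real.one_sub_sq_div_two_le_cos (x := ψ); linarith
  have hys : |y * Real.sin ψ| ≤ 1 / 32 := by
    rw [abs_mul]
    calc _ ≤ 1 / 4 * (1 / 8 : ℝ) := mul_le_mul hy (hs.trans hψ) (abs_nonneg _) (by norm_num)
      _ = _ := by norm_num
  have hyc : |y * Real.cos ψ| ≤ 1 / 4 := by
    rw [abs_mul, abs_of_nonneg (by linarith : 0 ≤ Real.cos ψ)]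
    calc _ ≤ 1 / 4 * (1 : ℝ) := mul_le_mul hy hc1 (by linarith) (by norm_num)
      _ = _ := by norm_num
  have hN : |Real.sin ψ + y * Real.cos ψ| ≤ 3 / 8 := by
    have := abs_add_le (Real.sin ψ) (y * Real.cos ψ); linarith
  have hP : 3 / 8 ≤ Real.cos ψ - y * Real.sin ψ := by
    have := (abs_le.1 hys).2; linarith
  have hBP : 0 ≤ B * (Real.cos ψ - y * Real.sin ψ) := mul_nonneg hB (by linarith)
  have hψ0 := abs_nonneg ψ
  rcases h with ⟨hA, hy'⟩ | hA | ⟨hA, hy'⟩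
  · have : Real.sin ψ + y * Real.cos ψ ≤ 0 := by
      have := (abs_le.1 hs).2; nlinarith
    nlinarith
  · have h1 : A * (Real.sin ψ + y * Real.cos ψ) ≤ B * (3 / 8) := by
      refine (le_abs_self _).trans ?_
      rw [abs_mul]
      exact mul_le_mul hA hN (abs_nonneg _) hB
    nlinarith
  · have : 0 ≤ Real.sin ψ + y * Real.cos ψ := by
      have := (abs_le.1 hs).1; nlinarith
    nlinarith

/-- Piecewise linear cutoff from `-1` to `1`. -/
noncomputable def ramp (t₁ t₂ s : ℝ) : ℝ := max (-1) (min 1 ((s - (t₁ + t₂) / 2) / ((t₂ - t₁) / 2)))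

lemma continuous_ramp (t₁ t₂ : ℝ) : Continuous (ramp t₁ t₂) := by unfold ramp; fun_prop

lemma abs_ramp_le (t₁ t₂ s : ℝ) : |ramp t₁ t₂ s| ≤ 1 :=
  abs_le.2 ⟨le_max_left _ _, max_le (by norm_num) (min_le_left _ _)⟩

lemma ramp_left {t₁ t₂ s : ℝ} (h : t₁ < t₂) (hs : s ≤ t₁) : ramp t₁ t₂ s = -1 := by
  refine max_eq_left ((min_le_right _ _).trans ?_)
  rw [div_le_iff₀ (by linarith)]; linarith

lemma ramp_right {t₁ t₂ s : ℝ} (h : t₁ < t₂) (hs : t₂ ≤ s) : ramp t₁ t₂ s = 1 := by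
  rw [ramp, min_eq_left, max_eq_right (by norm_num)]
  rw [le_div_iff₀ (by linarith)]; linarith

lemma IsWeight.exists_primitive_ramp {w : ℝ → ℝ} (hw : IsWeight w) (t₁ t₂ : ℝ) :
    ∃ W : ℝ → ℝ, (∀ s, HasDerivAt W (ramp t₁ t₂ s * w s) s) ∧ ∀ s, |W s| ≤ ∫ t, w t := by
  have hc : Continuous fun s => ramp t₁ t₂ s * w s := (continuous_ramp t₁ t₂).mul hw.cont
  refine ⟨fun s => ∫ t in (0 : ℝ)..s, ramp t₁ t₂ t * w t, fun s =>
    (hc.integral_hasStrictDerivAt 0 s).hasDerivAt, fun s => ?_⟩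
  have h1 := intervalIntegral.norm_integral_le_integral_norm_uIoc
    (f := fun t => ramp t₁ t₂ t * w t) (μ := volume) (a := 0) (b := s)
  refine h1.trans ((setIntegral_mono_on (hc.norm.integrableOn_uIoc) hw.int.integrableOn
    measurableSet_uIoc fun t _ => ?_).trans (setIntegral_le_integral hw.int
    (Eventually.of_forall fun t => (hw.pos t).le)))
  rw [Real.norm_eq_abs, abs_mul, abs_of_pos (hw.pos t)]
  exact mul_le_of_le_one_left (hw.pos t).le (abs_ramp_le _ _ _)

namespace Barrier

variable {w : ℝ → ℝ} {η t₁ t₂ : ℝ} {p q P Q : ℂ → ℂ} {pm pp qm qp a₀ : ℝ}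
variable (h : Barrier w η t₁ t₂ p q P Q pm pp qm qp a₀)
include h

lemma exists_bounds {b η' : ℝ} (hb : 0 < b) (hη : η' < η) : ∃ G K₀ : ℝ, 0 ≤ G ∧ 0 ≤ K₀ ∧
    ∀ x ∈ HStrip b η', ‖(deriv p x / p x - deriv q x / q x) / 4‖ ≤ G * w x.re ∧
      ‖(Complex.I * mom t₁ t₂ P Q x)⁻¹‖ ≤ K₀ := by
  rcases le_or_gt (Real.pi / 4) b with h0 | h0
  · refine ⟨0, 0, le_rfl, le_rfl, fun x hx => ?_⟩
    have := hx.1.trans hx.2; linarith [h.η_le]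
  obtain ⟨C₁, hC₁, h1⟩ := h.scat_p.deriv_bound h.weight hη
  obtain ⟨C₂, hC₂, h2⟩ := h.scat_q.deriv_bound h.weight hη
  obtain ⟨a, ha, h3⟩ := mtanh_lower hb h0
  have ha₀ := h.a₀_pos
  refine ⟨(C₁ + C₂) / (a * a₀) / 4, (a * a₀)⁻¹, by positivity, by positivity, fun x hx => ?_⟩
  have hx' : x ∈ HStrip (-η') η' := ⟨by linarith [hx.1, hx.2], hx.2⟩
  have hxη : x ∈ HStrip (-η) η := HStrip_mono (by linarith) hη.le hx'
  have hf : ∀ t : ℝ, a ≤ ‖mtanh (x - t)‖ := fun t =>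
    h3 _ (by rw [sub_im]; exact hx.1.le) (by rw [sub_im]; linarith [h.η_le, hxη.2])
  have hp : a * a₀ ≤ ‖p x‖ := by
    rw [h.eq_p x hxη, norm_mul]
    exact mul_le_mul (hf _) ((h.re_P x hxη).trans (Complex.re_le_norm _)) ha₀.le (norm_nonneg _)
  have hq : a * a₀ ≤ ‖q x‖ := by
    rw [h.eq_q x hxη, norm_mul]
    exact mul_le_mul (hf _) ((h.re_Q x hxη).trans (Complex.re_le_norm _)) ha₀.le (norm_nonneg _)
  have haa : 0 < a * a₀ := mul_pos ha ha₀
  have hwx := (h.weight.pos x.re).le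
  constructor
  · rw [norm_div, Complex.norm_ofNat]
    have e1 : ‖deriv p x / p x‖ ≤ C₁ * w x.re / (a * a₀) := by
      rw [norm_div]; exact div_le_div₀ (by positivity) (h1 x hx') haa hp
    have e2 : ‖deriv q x / q x‖ ≤ C₂ * w x.re / (a * a₀) := by
      rw [norm_div]; exact div_le_div₀ (by positivity) (h2 x hx') haa hq
    have e3 := norm_sub_le (deriv p x / p x) (deriv q x / q x)
    calc _ ≤ (C₁ * w x.re / (a * a₀) + C₂ * w x.re / (a * a₀)) / 4 := by linarith
      _ = _ := by ring
  · rw [norm_inv, norm_mul, Complex.norm_I, one_mul]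
    refine inv_anti₀ haa (le_of_sq_le_sq ?_ (norm_nonneg _))
    rw [← norm_pow, h.mom_sq hxη, norm_mul, sq]
    exact mul_le_mul hp hq haa.le (norm_nonneg _)

lemma transData {y₀ y₁ r : ℝ} (hr : 0 < r) (hr' : r ≤ 1) (h0 : 0 < y₀ - r) (h1 : y₁ + r < η) :
    ∃ G K₀ : ℝ, TransData w (fun x => (deriv p x / p x - deriv q x / q x) / 4)
      (fun x => Complex.I * mom t₁ t₂ P Q x) y₀ y₁ r G K₀ := by
  obtain ⟨G, K₀, hG, hK, hb⟩ := h.exists_bounds h0 h1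
  have hsub : HStrip (y₀ - r) (y₁ + r) ⊆ HStrip 0 η := HStrip_mono h0.le h1.le
  have hsub' : HStrip (y₀ - r) (y₁ + r) ⊆ HStrip (-η) η := fun x hx => h.mem_of_upper (hsub hx)
  have hne : ∀ x ∈ HStrip 0 η, p x ≠ 0 ∧ q x ≠ 0 := fun x hx => by
    rw [← mul_ne_zero_iff, ← h.mom_sq (h.mem_of_upper hx)]
    exact pow_ne_zero _ (h.mom_ne hx)
  refine ⟨G, K₀, h.weight, hr, hr', hG, hK, ?_, fun x hx => ?_, fun x hx => ?_,
    fun x hx => (hb x hx).1, fun x hx => (hb x hx).2⟩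
  · exact ((((h.scat_p.diff.deriv (isOpen_HStrip _ _)).mono hsub').div (h.scat_p.diff.mono hsub')
      fun x hx => (hne x (hsub hx)).1).sub (((h.scat_q.diff.deriv (isOpen_HStrip _ _)).mono
      hsub').div (h.scat_q.diff.mono hsub') fun x hx => (hne x (hsub hx)).2)).div_const 4
  · exact ((h.differentiableAt_mom (hsub hx)).const_mul _).differentiableWithinAt
  · exact mul_ne_zero Complex.I_ne_zero (h.mom_ne (hsub hx))

lemma norm_mom_le {η' : ℝ} (hη : η' < η) :
    ∃ M, ∀ x ∈ HStrip (-η') η', ‖mom t₁ t₂ P Q x‖ ≤ M := by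
  obtain ⟨M₁, hM₁, h1⟩ := h.scat_p.bounded h.weight hη
  obtain ⟨M₂, hM₂, h2⟩ := h.scat_q.bounded h.weight hη
  refine ⟨M₁ + M₂, fun x hx => le_of_sq_le_sq ?_ (by positivity)⟩
  rw [← norm_pow, h.mom_sq (HStrip_mono (by linarith) hη.le hx), norm_mul]
  have := mul_le_mul (h1 x hx) (h2 x hx) (norm_nonneg _) hM₁
  nlinarith

lemma arg_bound {η' : ℝ} (hη : η' < η) : ∃ C, 0 ≤ C ∧ ∀ x ∈ HStrip (-η') η',
    |((Complex.log (Q x) + Complex.log (P x)) / 2).im| ≤ C * |x.im| * w x.re := by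
  obtain ⟨C₁, hC₁, h1⟩ := h.scat_log_P.vertical_bound h.weight hη
  obtain ⟨C₂, hC₂, h2⟩ := h.scat_log_Q.vertical_bound h.weight hη
  refine ⟨(C₁ + C₂) / 2, by positivity, fun x hx => ?_⟩
  have e1 := (Complex.abs_im_le_norm _).trans (h1 x hx)
  have e2 := (Complex.abs_im_le_norm _).trans (h2 x hx)
  rw [Complex.sub_im, h.scat_log_P.real, sub_zero] at e1
  rw [Complex.sub_im, h.scat_log_Q.real, sub_zero] at e2
  rw [Complex.div_ofNat_im, Complex.add_im, abs_div, abs_two]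
  have := abs_add_le (Complex.log (Q x)).im (Complex.log (P x)).im
  linarith

lemma re_mom_mul_nonneg {x : ℂ} (h0 : 0 ≤ x.im) (h1 : x.im < η) {y : ℝ} (hy : |y| ≤ 1 / 4)
    (hψ : |((Complex.log (Q x) + Complex.log (P x)) / 2).im| ≤ 1 / 8)
    (hl : x.re ≤ t₁ → y ≤ -(2 * |((Complex.log (Q x) + Complex.log (P x)) / 2).im|))
    (hr : t₂ ≤ x.re → 2 * |((Complex.log (Q x) + Complex.log (P x)) / 2).im| ≤ y) :
    0 ≤ (Complex.I * mom t₁ t₂ P Q x * (1 + y * Complex.I)).re := by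
  set L := (Complex.log (Q x) + Complex.log (P x)) / 2 with hL
  have f1 := h.factor_im_nonpos h0 h1 t₁
  have f2 := h.factor_im_nonpos h0 h1 t₂
  have ha1 := usqrt_re_nonneg f1
  have ha2 := usqrt_re_nonneg f2
  have hb1 := usqrt_im_nonpos f1
  have hb2 := usqrt_im_nonpos f2
  have l1 : x.re ≤ t₁ → _ := fun hx => neg_im_usqrt_le_re f1 (mtanh_re_nonneg (by simpa using hx))
  have l2 : x.re ≤ t₂ → _ := fun hx => neg_im_usqrt_le_re f2 (mtanh_re_nonneg (by simpa using hx))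
  have r1 : t₁ ≤ x.re → _ := fun hx => re_usqrt_le_neg_im f1 (mtanh_re_nonpos (by simpa using hx))
  have r2 : t₂ ≤ x.re → _ := fun hx => re_usqrt_le_neg_im f2 (mtanh_re_nonpos (by simpa using hx))
  rw [mom, ← hL]
  set s₁ := usqrt (mtanh (x - t₁))
  set s₂ := usqrt (mtanh (x - t₂))
  set A := (s₁ * s₂).re with hA
  set B := -(s₁ * s₂).im with hB
  have hA' : A = s₁.re * s₂.re - s₁.im * s₂.im := Complex.mul_re _ _
  have hB' : B = -(s₁.re * s₂.im + s₁.im * s₂.re) := by rw [hB, Complex.mul_im]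
  have hB0 : 0 ≤ B := by rw [hB']; nlinarith
  have key := im_mul_nonpos_of_quadrant (A := A) (B := B) hψ hy hB0 (by
    rcases le_total x.re t₁ with hx | hx
    · refine Or.inl ⟨?_, hl hx⟩
      have := l1 hx; have := l2 (hx.trans h.lt.le)
      rw [hA']; nlinarith
    rcases le_total x.re t₂ with hx' | hx'
    · refine Or.inr (Or.inl (abs_le.2 ⟨?_, ?_⟩))
      · have := l2 hx'
        rw [hA', hB']; nlinarith
      · have := r1 hx
        rw [hA', hB']; nlinarith
    · refine Or.inr (Or.inr ⟨?_, hr hx'⟩)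
      have := r1 hx; have := r2 hx'
      rw [hA']; nlinarith)
  have hexp : (Complex.I * (s₁ * s₂ * Complex.exp L) * (1 + y * Complex.I)).re =
      Real.exp L.re * -(A * (Real.sin L.im + y * Real.cos L.im) -
        B * (Real.cos L.im - y * Real.sin L.im)) := by
    have : s₁ * s₂ = A - B * Complex.I := by
      apply Complex.ext <;> simp [hA, hB]
    rw [this]
    simp [Complex.exp_re, Complex.exp_im]
    ring
  rw [hexp]
  exact mul_nonneg (Real.exp_pos _).le (by linarith)

/-- A path in the upper half strip along which the phase is monotone. -/
theorem exists_path : ∃ (γ γ' : ℝ → ℂ) (y₀ y₁ r : ℝ), 0 < r ∧ r ≤ 1 ∧ 0 < y₀ - r ∧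
    y₁ + r < η ∧ TransPath (fun x => Complex.I * mom t₁ t₂ P Q x) y₀ y₁ γ γ' := by
  have hw := h.weight
  have hη := h.η_pos
  obtain ⟨C, hC, hψ⟩ := h.arg_bound (half_lt_self hη)
  obtain ⟨W, hW, hWI⟩ := hw.exists_primitive_ramp t₁ t₂
  set I := ∫ t, w t
  have hI : 0 ≤ I := (abs_nonneg _).trans (hWI 0)
  set E := Real.exp (2 * C * I) with hE
  have hE1 : 1 ≤ E := Real.one_le_exp (by positivity)
  set m := min (η / 8) (1 / (8 * (C + 1))) with hm
  have hm0 : 0 < m := by positivity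
  have hm1 : m ≤ η / 8 := min_le_left _ _
  have hm2 : C * m ≤ 1 / 8 := by
    calc C * m ≤ (C + 1) * (1 / (8 * (C + 1))) :=
          mul_le_mul (by linarith) (min_le_right _ _) hm0.le (by linarith)
      _ = 1 / 8 := by field_simp
  set y : ℝ → ℝ := fun s => m / E * Real.exp (2 * C * W s) with hy
  have hyd : ∀ s, HasDerivAt y (y s * (2 * C * (ramp t₁ t₂ s * w s))) s := fun s =>
    ((((hW s).const_mul (2 * C)).exp).const_mul (m / E)).congr_deriv (by simp only [hy]; ring)
  have hyle : ∀ s, y s ≤ m := fun s => by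
    have h1 : Real.exp (2 * C * W s) ≤ E :=
      Real.exp_le_exp.2 (mul_le_mul_of_nonneg_left ((le_abs_self _).trans (hWI s)) (by positivity))
    calc y s ≤ m / E * E := by simp only [hy]; gcongr
      _ = m := by field_simp
  have hyge : ∀ s, m / E / E ≤ y s := fun s => by
    have h1 : E⁻¹ ≤ Real.exp (2 * C * W s) := by
      rw [hE, ← Real.exp_neg, Real.exp_le_exp, ← mul_neg]
      exact mul_le_mul_of_nonneg_left ((neg_le_neg (hWI s)).trans (neg_abs_le _)) (by positivity)
    rw [div_eq_mul_inv _ E]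
    simp only [hy]; gcongr
  have hy0 : ∀ s, 0 < y s := fun s => by simp only [hy]; positivity
  have hq0 : 0 < m / E / E := by positivity
  have hqm : m / E / E ≤ m := by
    rw [div_div]; exact div_le_self hm0.le (by nlinarith)
  set y' : ℝ → ℝ := fun s => y s * (2 * C * (ramp t₁ t₂ s * w s)) with hy'
  have hy'b : ∀ s, |y' s| ≤ 1 / 4 := fun s => by
    have h1 : |ramp t₁ t₂ s * w s| ≤ 1 := by
      rw [abs_mul, abs_of_pos (hw.pos s)]
      exact mul_le_one₀ (abs_ramp_le _ _ _) (hw.pos s).le (hw.le_one s)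
    show |y s * (2 * C * (ramp t₁ t₂ s * w s))| ≤ 1 / 4
    rw [abs_mul, abs_of_pos (hy0 s), abs_mul, abs_of_nonneg (by positivity : 0 ≤ 2 * C)]
    calc _ ≤ m * (2 * C * 1) := by have := hyle s; gcongr
      _ ≤ _ := by linarith
  refine ⟨fun s => s + y s * Complex.I, fun s => 1 + y' s * Complex.I, m / E / E / 2, 2 * m,
    min 1 (m / E / E / 4), by positivity, min_le_left _ _, ?_, ?_, ?_, ?_, ?_, ?_, ?_, ?_⟩
  · have := min_le_right 1 (m / E / E / 4); linarith
  · have := min_le_right 1 (m / E / E / 4); linarith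
  · exact fun s => (Complex.ofRealCLM.hasDerivAt (x := s)).add
      ((hyd s).ofReal_comp.mul_const Complex.I)
  · have h1 : Continuous W := continuous_iff_continuousAt.2 fun s => (hW s).continuousAt
    have h2 := continuous_ramp t₁ t₂
    have h3 := hw.cont
    have h4 : Continuous y' := by simp only [hy', hy]; fun_prop
    fun_prop
  · intro s
    refine (norm_add_le _ _).trans ?_
    rw [norm_one, norm_mul, Complex.norm_I, Complex.norm_real, mul_one, Real.norm_eq_abs]
    linarith [hy'b s]
  · intro s; simp
  · intro s
    have him : ((s : ℂ) + y s * Complex.I).im = y s := by simp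
    refine ⟨?_, ?_⟩ <;> rw [him]
    · linarith [hyge s]
    · linarith [hyle s]
  · intro s
    have him : ((s : ℂ) + y s * Complex.I).im = y s := by simp
    have hre : ((s : ℂ) + y s * Complex.I).re = s := by simp
    have hpsi := hψ ((s : ℂ) + y s * Complex.I)
      ⟨by rw [him]; linarith [hy0 s], by rw [him]; linarith [hyle s]⟩
    rw [him, hre, abs_of_pos (hy0 s)] at hpsi
    refine h.re_mom_mul_nonneg (by rw [him]; exact (hy0 s).le) (by rw [him]; linarith [hyle s])
      (hy'b s) ?_ (fun hs => ?_) (fun hs => ?_)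
    · refine hpsi.trans (le_trans ?_ hm2)
      rw [mul_assoc]
      exact mul_le_mul_of_nonneg_left
        ((mul_le_of_le_one_right (hy0 s).le (hw.le_one s)).trans (hyle s)) hC
    · rw [hre] at hs
      simp only [hy', ramp_left h.lt hs]
      linarith
    · rw [hre] at hs
      simp only [hy', ramp_right h.lt hs]
      linarith

lemma tendsto_factor_bot {γ : ℝ → ℂ} (hγ : ∀ s, γ s ∈ HStrip (-η) η) (hre : ∀ s, (γ s).re = s)
    (t : ℝ) : Tendsto (fun s => mtanh (γ s - t)) atBot (𝓝 1) := by
  rw [tendsto_iff_norm_sub_tendsto_zero]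
  refine squeeze_zero (fun s => norm_nonneg _) (g := fun s => 2 * Real.exp (2 * (s - t)))
    (fun s => ?_) ?_
  · have := norm_mtanh_sub_one (h.sub_mem (hγ s) t)
    rwa [Complex.sub_re, Complex.ofReal_re, hre] at this
  · have h1 : Tendsto (fun s : ℝ => 2 * (s - t)) atBot atBot :=
      (tendsto_atBot_add_const_right _ (-t) tendsto_id).const_mul_atBot two_pos
    simpa using (Real.tendsto_exp_atBot.comp h1).const_mul 2

lemma tendsto_factor_top {γ : ℝ → ℂ} (hγ : ∀ s, γ s ∈ HStrip (-η) η) (hre : ∀ s, (γ s).re = s)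
    (t : ℝ) : Tendsto (fun s => mtanh (γ s - t)) atTop (𝓝 (-1)) := by
  rw [tendsto_iff_norm_sub_tendsto_zero]
  refine squeeze_zero (fun s => norm_nonneg _) (g := fun s => 2 * Real.exp (-(2 * (s - t))))
    (fun s => ?_) ?_
  · have := norm_mtanh_add_one (h.sub_mem (hγ s) t)
    rw [sub_neg_eq_add]
    rwa [Complex.sub_re, Complex.ofReal_re, hre] at this
  · have h1 : Tendsto (fun s : ℝ => -(2 * (s - t))) atTop atBot := tendsto_neg_atTop_atBot.comp
      ((tendsto_atTop_add_const_right _ (-t) tendsto_id).const_mul_atTop two_pos)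
    simpa using (Real.tendsto_exp_atBot.comp h1).const_mul 2

omit h in
private lemma tendsto_ratio {l : Filter ℝ} {f g : ℝ → ℂ} {v : ℂ} (hv : v.im ≤ 0) (hv0 : v ≠ 0)
    (hf : Tendsto f l (𝓝 v)) (hg : Tendsto g l (𝓝 v)) :
    Tendsto (fun s => usqrt (usqrt (f s)) / usqrt (usqrt (g s))) l (𝓝 1) := by
  have h1 : ContinuousAt (fun z => usqrt (usqrt z)) v :=
    ContinuousAt.comp (g := usqrt) (continuousAt_usqrt (usqrt_im_nonpos hv)) (continuousAt_usqrt hv)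
  have h2 := (h1.tendsto.comp hf).div (h1.tendsto.comp hg)
    (usqrt_ne_zero (usqrt_ne_zero hv0))
  rw [div_self (usqrt_ne_zero (usqrt_ne_zero hv0))] at h2
  exact h2

lemma tendsto_amp_bot {γ : ℝ → ℂ} (hγ : ∀ s, γ s ∈ HStrip (-η) η) (hre : ∀ s, (γ s).re = s) :
    Tendsto (fun s => amp t₁ t₂ P Q (γ s)) atBot (𝓝 (((pm / qm) ^ (1 / 4 : ℝ) : ℝ) : ℂ)) := by
  have hqm := h.a₀_pos.trans_le h.le_qm
  have hpm := h.a₀_pos.trans_le h.le_pm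
  have h1 := tendsto_ratio (v := 1) (by simp) one_ne_zero (h.tendsto_factor_bot hγ hre t₂)
    (h.tendsto_factor_bot hγ hre t₁)
  have h2 := (((h.scat_log_P.tendsto_bot h.weight hγ hre).sub
    (h.scat_log_Q.tendsto_bot h.weight hγ hre)).div_const 4).cexp
  have h3 := h1.mul h2
  have e : (((pm / qm) ^ (1 / 4 : ℝ) : ℝ) : ℂ) =
      1 * Complex.exp (((Real.log pm : ℝ) - (Real.log qm : ℝ)) / 4) := by
    rw [Real.rpow_def_of_pos (div_pos hpm hqm), Real.log_div hpm.ne' hqm.ne']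
    push_cast; rw [one_mul]; congr 1; ring
  rw [e]
  exact h3

lemma tendsto_amp_top {γ : ℝ → ℂ} (hγ : ∀ s, γ s ∈ HStrip (-η) η) (hre : ∀ s, (γ s).re = s) :
    Tendsto (fun s => amp t₁ t₂ P Q (γ s)) atTop (𝓝 (((pp / qp) ^ (1 / 4 : ℝ) : ℝ) : ℂ)) := by
  have hqp := h.a₀_pos.trans_le h.le_qp
  have hpp := h.a₀_pos.trans_le h.le_pp
  have h1 := tendsto_ratio (v := -1) (by simp) (by simp) (h.tendsto_factor_top hγ hre t₂)
    (h.tendsto_factor_top hγ hre t₁)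
  have h2 := (((h.scat_log_P.tendsto_top h.weight hγ hre).sub
    (h.scat_log_Q.tendsto_top h.weight hγ hre)).div_const 4).cexp
  have h3 := h1.mul h2
  have e : (((pp / qp) ^ (1 / 4 : ℝ) : ℝ) : ℂ) =
      1 * Complex.exp (((Real.log (-pp) : ℝ) - (Real.log (-qp) : ℝ)) / 4) := by
    rw [← neg_div_neg_eq, Real.rpow_def_of_pos (div_pos hpp hqp), Real.log_div hpp.ne' hqp.ne']
    push_cast; rw [one_mul]; congr 1; ring
  rw [e]
  exact h3

end Barrier

section HolomorphicODE

variable {E : Type*} [NormedAddCommGroup E] [NormedSpace ℂ E] [CompleteSpace E]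

/-- A holomorphic linear differential equation with bounded coefficient on a convex open set
has a holomorphic solution with any prescribed value at the origin. -/
theorem exists_holomorphic_solution {S : Set ℂ} (hS : Convex ℝ S) (hSo : IsOpen S)
    (h0 : (0 : ℂ) ∈ S) {A : ℂ → E →L[ℂ] E} (hA : DifferentiableOn ℂ A S) {M : ℝ}
    (hM : ∀ x ∈ S, ‖A x‖ ≤ M) (v₀ : E) :
    ∃ U : ℂ → E, U 0 = v₀ ∧ ∀ x ∈ S, HasDerivAt U (A x (U x)) x := by
  have hM0 : 0 ≤ M := (norm_nonneg _).trans (hM 0 h0)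
  have hstep : ∀ f : ℂ → E, ∃ g : ℂ → E, DifferentiableOn ℂ f S →
      g 0 = 0 ∧ ∀ x ∈ S, HasDerivAt g (A x (f x)) x := fun f => by
    by_cases hf : DifferentiableOn ℂ f S
    · obtain ⟨g, hg⟩ := hS.exists_forall_hasDerivWithinAt (hA.clm_apply hf)
      exact ⟨fun x => g x - g 0, fun _ => ⟨sub_self _, fun x hx =>
        ((hg x hx).hasDerivAt (hSo.mem_nhds hx)).sub_const _⟩⟩
    · exact ⟨f, fun h => (hf h).elim⟩
  choose T hT using hstep
  set v : ℕ → ℂ → E := fun n => Nat.rec (fun _ => v₀) (fun _ f => T f) n with hv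
  have hvd : ∀ n, DifferentiableOn ℂ (v n) S := fun n => by
    induction n with
    | zero => exact differentiableOn_const _
    | succ n ih => exact fun x hx => ((hT _ ih).2 x hx).differentiableAt.differentiableWithinAt
  have hvD : ∀ n, ∀ x ∈ S, HasDerivAt (v (n + 1)) (A x (v n x)) x := fun n => (hT _ (hvd n)).2
  have hbound : ∀ n, ∀ x ∈ S, ‖v n x‖ ≤ ‖v₀‖ * ((M * ‖x‖) ^ n / (n.factorial : ℝ)) := fun n => by
    induction n with
    | zero => intro x _; simp [hv]
    | succ n ih =>
      intro x hx
      have hseg : ∀ s ∈ Icc (0 : ℝ) 1, (s : ℂ) * x ∈ S := fun s hs => by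
        have := hS.smul_mem_of_zero_mem h0 hx hs
        rwa [Complex.real_smul] at this
      have hd : ∀ s ∈ Icc (0 : ℝ) 1, HasDerivAt (fun s : ℝ => v (n + 1) ((s : ℂ) * x))
          (x • A (s * x) (v n (s * x))) s := fun s hs =>
        (hvD n _ (hseg s hs)).scomp s
          (((Complex.ofRealCLM.hasDerivAt (x := s)).mul_const x).congr_deriv (by simp))
      have key := image_norm_le_of_norm_deriv_right_le_deriv_boundary' (a := 0) (b := 1)
        (f := fun s : ℝ => v (n + 1) ((s : ℂ) * x))
        (f' := fun s : ℝ => x • A (s * x) (v n (s * x)))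
        (fun s hs => (hd s hs).continuousAt.continuousWithinAt)
        (fun s hs => (hd s (Ico_subset_Icc_self hs)).hasDerivWithinAt)
        (B := fun s => ‖v₀‖ * ((M * ‖x‖ * s) ^ (n + 1) / ((n + 1).factorial : ℝ)))
        (B' := fun s => ‖v₀‖ * (M * ‖x‖ * ((M * ‖x‖ * s) ^ n / (n.factorial : ℝ))))
        (by have h1 : v (n + 1) 0 = 0 := (hT _ (hvd n)).1
            simp [h1])
        (by fun_prop)
        (fun s _ => by
          have h1 : HasDerivAt (fun s : ℝ => ‖v₀‖ * ((M * ‖x‖ * s) ^ (n + 1) /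
              ((n + 1).factorial : ℝ))) (‖v₀‖ * (((n + 1 : ℕ) : ℝ) * (M * ‖x‖ * s) ^ n *
              (M * ‖x‖ * 1) / ((n + 1).factorial : ℝ))) s :=
            ((((hasDerivAt_id s).const_mul (M * ‖x‖)).pow (n + 1)).div_const _).const_mul _
          refine (h1.congr_deriv ?_).hasDerivWithinAt
          have : (n.factorial : ℝ) ≠ 0 := by positivity
          rw [Nat.factorial_succ]; push_cast; field_simp)
        (fun s hs => by
          have hs' := Ico_subset_Icc_self hs
          have h2 := ih _ (hseg s hs')
          rw [norm_mul, Complex.norm_real, Real.norm_of_nonneg hs.1] at h2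
          rw [norm_smul]
          calc _ ≤ ‖x‖ * (M * (‖v₀‖ * ((M * (s * ‖x‖)) ^ n / (n.factorial : ℝ)))) := by
                refine mul_le_mul_of_nonneg_left ?_ (norm_nonneg _)
                exact ((A _).le_opNorm _).trans
                  (mul_le_mul (hM _ (hseg s hs')) h2 (norm_nonneg _) hM0)
            _ = _ := by ring)
      simpa using key (right_mem_Icc.2 zero_le_one)
  refine ⟨fun x => ∑' n, v n x, ?_, fun x hx => ?_⟩
  · refine tsum_eq_single 0 ?_
    intro n hn
    obtain ⟨k, rfl⟩ := Nat.exists_eq_succ_of_ne_zero hn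
    exact (hT _ (hvd k)).1
  set R := ‖x‖ + 1
  set S' := S ∩ Metric.ball 0 R
  have hS'o : IsOpen S' := hSo.inter Metric.isOpen_ball
  have hx' : x ∈ S' := ⟨hx, by rw [mem_ball_zero_iff]; exact lt_add_one _⟩
  have hsum : Summable fun n : ℕ => ‖v₀‖ * ((M * R) ^ n / (n.factorial : ℝ)) :=
    (Real.summable_pow_div_factorial _).mul_left _
  have hle : ∀ n, ∀ y ∈ S', ‖v n y‖ ≤ ‖v₀‖ * ((M * R) ^ n / (n.factorial : ℝ)) :=
    fun n y hy => (hbound n y hy.1).trans (by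
      have h1 := mem_ball_zero_iff.1 hy.2
      gcongr)
  have hd : ∀ n, DifferentiableOn ℂ (v n) S' := fun n => (hvd n).mono inter_subset_left
  have h1 := Complex.hasSum_deriv_of_summable_norm hsum hd hS'o hle hx'
  have h2 := (Complex.differentiableOn_tsum_of_summable_norm hsum hd hS'o hle).differentiableAt
    (hS'o.mem_nhds hx')
  have hs : Summable fun n => v n x := Summable.of_norm_bounded hsum fun n => hle n x hx'
  have h3 : HasSum (fun n => deriv (v (n + 1)) x) (A x (∑' n, v n x)) := by
    simp only [fun n => (hvD n x hx).deriv]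
    exact (A x).hasSum hs.hasSum
  have h4 : deriv (v 0) x = 0 := by
    have : v 0 = fun _ => v₀ := rfl
    rw [this, deriv_const]
  have h5 := (hasSum_nat_add_iff (f := fun n => deriv (v n) x) 1).1 h3
  simp only [Finset.range_one, Finset.sum_singleton, h4, add_zero] at h5
  exact h2.hasDerivAt.congr_deriv (h1.unique h5)

/-- Solutions on the real line of a holomorphic linear equation extend to the complex domain. -/
theorem exists_holomorphic_extension {S : Set ℂ} (hS : Convex ℝ S) (hSo : IsOpen S)
    (hR : ∀ s : ℝ, (s : ℂ) ∈ S) {A : ℂ → E →L[ℂ] E} (hA : DifferentiableOn ℂ A S) {M : ℝ}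
    (hM : ∀ x ∈ S, ‖A x‖ ≤ M) {u : ℝ → E} (hu : ∀ s : ℝ, HasDerivAt u (A s (u s)) s) :
    ∃ U : ℂ → E, (∀ s : ℝ, U s = u s) ∧ ∀ x ∈ S, HasDerivAt U (A x (U x)) x := by
  obtain ⟨U, hU0, hU⟩ := exists_holomorphic_solution hS hSo (by simpa using hR 0) hA hM (u 0)
  refine ⟨U, fun s => ?_, hU⟩
  have hM0 : 0 ≤ M := (norm_nonneg _).trans (hM _ (hR 0))
  have h1 : ∀ s : ℝ, HasDerivAt (fun s : ℝ => U s) (A s (U s)) s := fun s => by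
    simpa [Function.comp_def] using (hU s (hR s)).scomp s (Complex.ofRealCLM.hasDerivAt (x := s))
  have := ODE_solution_unique_univ (v := fun (s : ℝ) y => A s y) (s := fun _ => univ)
    (K := M.toNNReal) (t₀ := 0) (f := fun s : ℝ => U s) (g := u)
    (fun s => ((A s).lipschitz.weaken (by
      rw [← NNReal.coe_le_coe, Real.coe_toNNReal _ hM0]; exact hM _ (hR s))).lipschitzOnWith)
    (fun s => ⟨h1 s, mem_univ _⟩) (fun s => ⟨hu s, mem_univ _⟩) (by simpa using hU0)
  exact congrFun this s

end HolomorphicODE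

section HolomorphicODE

variable {E : Type*} [NormedAddCommGroup E] [NormedSpace ℂ E]

/-- The asymptotic behaviour of a solution on the real line persists along a curve at bounded
height over it. -/
theorem tendsto_along_curve {S : Set ℂ} {A : ℂ → E →L[ℂ] E} {U : ℂ → E}
    (hU : ∀ x ∈ S, HasDerivAt U (A x (U x)) x) {M : ℝ} (hM : ∀ x ∈ S, ‖A x‖ ≤ M)
    {γ : ℝ → ℂ} {Y : ℝ} (hre : ∀ s, (γ s).re = s) (h0 : ∀ s, 0 ≤ (γ s).im)
    (hY : ∀ s, (γ s).im ≤ Y)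
    (hS : ∀ s t : ℝ, 0 ≤ t → t ≤ (γ s).im → (s : ℂ) + t * Complex.I ∈ S)
    {l : Filter ℝ} {θ : ℂ} {v : E} {ε : ℝ → ℝ} (hε : Tendsto ε l (𝓝 0))
    (hv : ∀ᶠ s in l, ∀ t : ℝ, 0 ≤ t → t ≤ (γ s).im →
      ‖A ((s : ℂ) + t * Complex.I) v - θ • v‖ ≤ ε s)
    (hlim : Tendsto (fun s : ℝ => Complex.exp (-(θ * s)) • U s) l (𝓝 v)) :
    Tendsto (fun s => Complex.exp (-(θ * γ s)) • U (γ s)) l (𝓝 v) := by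
  set K := |M| + ‖θ‖ + 1 with hK
  have hK0 : 0 < K := by positivity
  have hbound : ∀ᶠ s in l, ‖Complex.exp (-(θ * γ s)) • U (γ s) - v‖ ≤
      ‖Complex.exp (-(θ * s)) • U s - v‖ * Real.exp (K * Y) +
        ε s / K * (Real.exp (K * Y) - 1) := by
    filter_upwards [hv] with s hs
    set G : ℝ → E := fun t => Complex.exp (-(θ * ((s : ℂ) + t * Complex.I))) •
      U ((s : ℂ) + t * Complex.I) - v with hG
    have hd : ∀ t ∈ Icc 0 (γ s).im, HasDerivAt G
        (Complex.I • ((A ((s : ℂ) + t * Complex.I) (G t) - θ • G t) +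
          (A ((s : ℂ) + t * Complex.I) v - θ • v))) t := fun t ht => by
      have h1 : HasDerivAt (fun t : ℝ => (s : ℂ) + t * Complex.I) Complex.I t :=
        (((Complex.ofRealCLM.hasDerivAt (x := t)).mul_const Complex.I).const_add
          (s : ℂ)).congr_deriv (by simp)
      have h2 : HasDerivAt (fun x => Complex.exp (-(θ * x)) • U x - v)
          (Complex.exp (-(θ * (s + t * Complex.I))) • A (s + t * Complex.I)
            (U (s + t * Complex.I)) +
          (Complex.exp (-(θ * (s + t * Complex.I))) * -(θ * 1)) • U (s + t * Complex.I))
          ((s : ℂ) + t * Complex.I) :=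
        ((((hasDerivAt_id _).const_mul θ).fun_neg.cexp).smul (hU _ (hS s t ht.1 ht.2))).sub_const v
      refine (h2.scomp t h1).congr_deriv ?_
      simp only [hG, map_sub, map_smul, smul_sub, smul_add]
      module
    have key := norm_le_gronwallBound_of_norm_deriv_right_le (δ := ‖G 0‖) (K := K) (ε := ε s)
      (fun t ht => (hd t ht).continuousAt.continuousWithinAt)
      (fun t ht => (hd t (Ico_subset_Icc_self ht)).hasDerivWithinAt) le_rfl
      (fun t ht => by
        have h1 := hs t ht.1 ht.2.le
        rw [norm_smul, Complex.norm_I, one_mul]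
        refine (norm_add_le _ _).trans (add_le_add ?_ h1)
        refine (norm_sub_le _ _).trans ?_
        have h2 := (A ((s : ℂ) + t * Complex.I)).le_opNorm (G t)
        have h3 := (hM _ (hS s t ht.1 ht.2.le)).trans (le_abs_self M)
        rw [norm_smul]
        have h4 := mul_le_mul_of_nonneg_right h3 (norm_nonneg (G t))
        have := norm_nonneg (G t)
        rw [hK]; linarith) (γ s).im (right_mem_Icc.2 (h0 s))
    have hε0 : 0 ≤ ε s := (norm_nonneg _).trans (hs 0 le_rfl (h0 s))
    have e1 : (s : ℂ) + (γ s).im * Complex.I = γ s := by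
      conv_rhs => rw [← Complex.re_add_im (γ s), hre]
    have e2 : G (γ s).im = Complex.exp (-(θ * γ s)) • U (γ s) - v := by simp only [hG, e1]
    have e3 : G 0 = Complex.exp (-(θ * s)) • U s - v := by simp [hG]
    rw [e2, gronwallBound_of_K_ne_0 hK0.ne', e3, sub_zero] at key
    have h5 : Real.exp (K * (γ s).im) ≤ Real.exp (K * Y) :=
      Real.exp_le_exp.2 (mul_le_mul_of_nonneg_left (hY s) hK0.le)
    exact key.trans (add_le_add (mul_le_mul_of_nonneg_left h5 (norm_nonneg _))
      (mul_le_mul_of_nonneg_left (sub_le_sub_right h5 1) (div_nonneg hε0 hK0.le)))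
  rw [tendsto_iff_norm_sub_tendsto_zero] at hlim ⊢
  refine squeeze_zero' (Eventually.of_forall fun s => norm_nonneg _) hbound ?_
  simpa using (hlim.mul_const (Real.exp (K * Y))).add
    ((hε.div_const K).mul_const (Real.exp (K * Y) - 1))

end HolomorphicODE

/-- The complex phase accumulated across the barrier, the free phases at infinity being
subtracted. -/
noncomputable def tunnelPhase (t₁ t₂ : ℝ) (p q : ℂ → ℂ) (pm pp qm qp : ℝ) : ℂ :=
  Complex.I * ((((∫ t in Iic t₁,
      (Real.sqrt ((p (t : ℂ)).re * (q (t : ℂ)).re) - Real.sqrt (qm * pm)))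
    + Real.sqrt (qm * pm) * t₁ : ℝ)) : ℂ)
  + Complex.I * ((((-∫ t in Ici t₂,
      (Real.sqrt ((p (t : ℂ)).re * (q (t : ℂ)).re) - Real.sqrt (qp * pp)))
    + Real.sqrt (qp * pp) * t₂ : ℝ)) : ℂ)
  + ((∫ t in t₁..t₂, Real.sqrt (-((p (t : ℂ)).re * (q (t : ℂ)).re)) : ℝ) : ℂ)

lemma norm_vertical_sub_le {f κ : ℂ → ℂ} {η s B : ℝ} {d x y : ℂ}
    (hf : ∀ x ∈ HStrip 0 η, HasDerivAt f (κ x) x)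
    (hκ : ∀ x ∈ HStrip 0 η, x.re = s → ‖κ x - d‖ ≤ B)
    (hx : x ∈ HStrip 0 η) (hy : y ∈ HStrip 0 η) (hxs : x.re = s) (hys : y.re = s) :
    ‖(f y - d * y) - (f x - d * x)‖ ≤ B * η := by
  have hconv : Convex ℝ (HStrip 0 η ∩ {z : ℂ | z.re = s}) :=
    (convex_HStrip _ _).inter (convex_hyperplane Complex.reLm.isLinear s)
  have h1 := hconv.norm_image_sub_le_of_norm_hasDerivWithin_le (f := fun x => f x - d * x)
    (f' := fun x => κ x - d) (C := B)
    (fun z hz => (((hf z hz.1).sub ((hasDerivAt_id z).const_mul d)).congr_deriv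
      (by ring)).hasDerivWithinAt) (fun z hz => hκ z hz.1 hz.2) ⟨hx, hxs⟩ ⟨hy, hys⟩
  refine h1.trans (mul_le_mul_of_nonneg_left ?_ ((norm_nonneg _).trans (hκ x hx hxs)))
  have h2 : y - x = ((y.im - x.im : ℝ) : ℂ) * Complex.I := by
    apply Complex.ext <;> simp [hxs, hys]
  rw [h2, norm_mul, Complex.norm_I, mul_one, Complex.norm_real, Real.norm_eq_abs, abs_le]
  constructor <;> linarith [hx.1, hx.2, hy.1, hy.2]

namespace Barrier

variable {w : ℝ → ℝ} {η t₁ t₂ : ℝ} {p q P Q : ℂ → ℂ} {pm pp qm qp a₀ : ℝ}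
variable (h : Barrier w η t₁ t₂ p q P Q pm pp qm qp a₀)
include h

lemma continuous_sqrt_mul :
    Continuous fun t : ℝ => Real.sqrt ((p (t : ℂ)).re * (q (t : ℂ)).re) :=
  ((h.scat_p.continuous_re h.η_pos).mul (h.scat_q.continuous_re h.η_pos)).sqrt

lemma integrableOn_left : IntegrableOn
    (fun t : ℝ => Real.sqrt ((p (t : ℂ)).re * (q (t : ℂ)).re) - Real.sqrt (qm * pm)) (Iic t₁) := by
  obtain ⟨C, hC, hb⟩ := h.mom_left (half_lt_self h.η_pos) t₁
  refine Integrable.mono' (h.weight.int.const_mul C).integrableOn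
    (h.continuous_sqrt_mul.sub continuous_const).aestronglyMeasurable ?_
  refine (ae_restrict_iff' measurableSet_Iic).2 (Eventually.of_forall fun t ht => ?_)
  have h1 := hb t (by simp) (by simpa using h.η_pos) (by simpa using ht)
  rwa [h.mom_real_left ht, ← Complex.ofReal_sub, Complex.norm_real, Complex.ofReal_re] at h1

lemma integrableOn_right : IntegrableOn
    (fun t : ℝ => Real.sqrt ((p (t : ℂ)).re * (q (t : ℂ)).re) - Real.sqrt (qp * pp)) (Ioi t₂) := by
  obtain ⟨C, hC, hb⟩ := h.mom_right (half_lt_self h.η_pos) t₂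
  refine Integrable.mono' (h.weight.int.const_mul C).integrableOn
    (h.continuous_sqrt_mul.sub continuous_const).aestronglyMeasurable ?_
  refine (ae_restrict_iff' measurableSet_Ioi).2 (Eventually.of_forall fun t ht => ?_)
  have h1 := hb t (by simp) (by simpa using h.η_pos) (by simpa using (mem_Ioi.1 ht).le)
  rwa [h.mom_real_right (mem_Ioi.1 ht).le, neg_add_eq_sub, norm_sub_rev, ← Complex.ofReal_sub,
    Complex.norm_real, Complex.ofReal_re] at h1

lemma continuous_mom_real : Continuous fun t : ℝ => mom t₁ t₂ P Q t :=
  continuous_iff_continuousAt.2 fun t => ContinuousAt.comp (g := mom t₁ t₂ P Q)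
    (h.continuousAt_mom (by simp) (by simpa using h.η_pos)) Complex.continuous_ofReal.continuousAt

lemma integral_mom_real {R : ℝ} (h1 : -R ≤ t₁) (h2 : t₂ ≤ R) :
    (∫ t in (-R)..R, Complex.I * mom t₁ t₂ P Q t) + Complex.I * Real.sqrt (qp * pp) * R
      - Complex.I * Real.sqrt (qm * pm) * R =
    Complex.I * (((∫ t in (-R)..t₁, (Real.sqrt ((p (t : ℂ)).re * (q (t : ℂ)).re) -
        Real.sqrt (qm * pm))) + Real.sqrt (qm * pm) * t₁ : ℝ) : ℂ)
    + Complex.I * ((-(∫ t in t₂..R, (Real.sqrt ((p (t : ℂ)).re * (q (t : ℂ)).re) -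
        Real.sqrt (qp * pp))) + Real.sqrt (qp * pp) * t₂ : ℝ) : ℂ)
    + ((∫ t in t₁..t₂, Real.sqrt (-((p (t : ℂ)).re * (q (t : ℂ)).re)) : ℝ) : ℂ) := by
  have hc : ∀ a b : ℝ, IntervalIntegrable (fun t : ℝ => Complex.I * mom t₁ t₂ P Q t) volume a b :=
    fun a b => (h.continuous_mom_real.const_mul _).intervalIntegrable a b
  have hn : ∀ a b : ℝ, IntervalIntegrable
      (fun t : ℝ => Real.sqrt ((p (t : ℂ)).re * (q (t : ℂ)).re)) volume a b :=
    fun a b => h.continuous_sqrt_mul.intervalIntegrable a b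
  have e1 : ∫ t in (-R)..t₁, Complex.I * mom t₁ t₂ P Q t = Complex.I *
      ((∫ t in (-R)..t₁, Real.sqrt ((p (t : ℂ)).re * (q (t : ℂ)).re) : ℝ) : ℂ) := by
    rw [intervalIntegral.integral_const_mul, ← intervalIntegral.integral_ofReal]
    congr 1
    refine intervalIntegral.integral_congr fun t ht => ?_
    rw [uIcc_of_le h1] at ht
    exact h.mom_real_left ht.2
  have e2 : ∫ t in t₂..R, Complex.I * mom t₁ t₂ P Q t = -Complex.I *
      ((∫ t in t₂..R, Real.sqrt ((p (t : ℂ)).re * (q (t : ℂ)).re) : ℝ) : ℂ) := by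
    rw [← intervalIntegral.integral_ofReal, ← intervalIntegral.integral_const_mul]
    refine intervalIntegral.integral_congr fun t ht => ?_
    rw [uIcc_of_le h2] at ht
    have := h.mom_real_right ht.1
    simp only [this]; ring
  have e3 : ∫ t in t₁..t₂, Complex.I * mom t₁ t₂ P Q t =
      ((∫ t in t₁..t₂, Real.sqrt (-((p (t : ℂ)).re * (q (t : ℂ)).re)) : ℝ) : ℂ) := by
    rw [← intervalIntegral.integral_ofReal]
    refine intervalIntegral.integral_congr fun t ht => ?_
    rw [uIcc_of_le h.lt.le] at ht
    have := h.mom_real_mid ht.1 ht.2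
    simp only [this]
    linear_combination -(Real.sqrt (-((p (t : ℂ)).re * (q (t : ℂ)).re)) : ℂ) * Complex.I_sq
  rw [← intervalIntegral.integral_add_adjacent_intervals (hc (-R) t₁) (hc t₁ R),
    ← intervalIntegral.integral_add_adjacent_intervals (hc t₁ t₂) (hc t₂ R), e1, e2, e3,
    intervalIntegral.integral_sub (hn _ _) (by simp), intervalIntegral.integral_sub (hn _ _)
    (by simp), intervalIntegral.integral_const, intervalIntegral.integral_const, smul_eq_mul,
    smul_eq_mul]
  push_cast
  ring

lemma tendsto_integral_mom_real :
    Tendsto (fun R : ℝ => (∫ t in (-R)..R, Complex.I * mom t₁ t₂ P Q t) +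
      Complex.I * Real.sqrt (qp * pp) * R - Complex.I * Real.sqrt (qm * pm) * R) atTop
      (𝓝 (tunnelPhase t₁ t₂ p q pm pp qm qp)) := by
  have h1 := intervalIntegral_tendsto_integral_Iic t₁ h.integrableOn_left
    (tendsto_neg_atTop_atBot (G := ℝ))
  have h2 := intervalIntegral_tendsto_integral_Ioi t₂ h.integrableOn_right
    (tendsto_id (α := ℝ) (x := atTop))
  rw [tunnelPhase, integral_Ici_eq_integral_Ioi]
  have h3 := ((((Complex.continuous_ofReal.tendsto _).comp
    (h1.add_const (Real.sqrt (qm * pm) * t₁))).const_mul Complex.I).add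
    (((Complex.continuous_ofReal.tendsto _).comp
    (h2.neg.add_const (Real.sqrt (qp * pp) * t₂))).const_mul Complex.I)).add_const
    ((∫ t in t₁..t₂, Real.sqrt (-((p (t : ℂ)).re * (q (t : ℂ)).re)) : ℝ) : ℂ)
  refine h3.congr' ?_
  filter_upwards [eventually_ge_atTop (-t₁), eventually_ge_atTop t₂] with R hR1 hR2
  exact (h.integral_mom_real (by linarith) hR2).symm

/-- Moving the contour up from the real axis. -/
lemma integral_mom_shift {z : ℂ → ℂ} (hz : ∀ x ∈ HStrip 0 η, HasDerivAt z (Complex.I *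
    mom t₁ t₂ P Q x) x) {y R : ℝ} (hy : 0 < y) (hyη : y < η) :
    z (R + y * Complex.I) - z (-R + y * Complex.I) =
      (∫ t in (-R)..R, Complex.I * mom t₁ t₂ P Q t)
      + Complex.I * (∫ s in (0 : ℝ)..y, Complex.I * mom t₁ t₂ P Q (R + s * Complex.I))
      - Complex.I * (∫ s in (0 : ℝ)..y, Complex.I * mom t₁ t₂ P Q (-R + s * Complex.I)) := by
  have hmem : ∀ t : ℝ, (t : ℂ) + y * Complex.I ∈ HStrip 0 η := fun t => by
    constructor <;> simpa
  have h1 : ∫ t in (-R)..R, Complex.I * mom t₁ t₂ P Q (t + y * Complex.I) =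
      z (R + y * Complex.I) - z ((-R : ℝ) + y * Complex.I) := by
    refine intervalIntegral.integral_eq_sub_of_hasDerivAt
      (f := fun t : ℝ => z (t + y * Complex.I)) (fun t _ => ?_) ?_
    · have := (hz _ (hmem t)).scomp t (((Complex.ofRealCLM.hasDerivAt (x := t)).add_const
        (y * Complex.I)))
      exact this.congr_deriv (by simp)
    · refine Continuous.intervalIntegrable (continuous_const.mul
        (continuous_iff_continuousAt.2 fun t => ?_)) _ _
      exact ContinuousAt.comp (g := mom t₁ t₂ P Q)
        (h.differentiableAt_mom (hmem t)).continuousAt (by fun_prop)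
  have h2 := Complex.integral_boundary_rect_eq_zero_of_continuousOn_of_differentiableOn
    (fun x => Complex.I * mom t₁ t₂ P Q x) ((-R : ℝ) : ℂ) (R + y * Complex.I)
    (fun x hx => by
      have h3 := hx.2
      simp only [Complex.ofReal_im, Complex.add_im, Complex.mul_im, Complex.I_im, Complex.I_re,
        Complex.ofReal_re, mul_one, mul_zero, zero_add, add_zero, mem_preimage, uIcc_of_le hy.le]
        at h3
      exact (continuousAt_const.mul
        (h.continuousAt_mom h3.1 (h3.2.trans_lt hyη))).continuousWithinAt)
    (fun x hx => by
      have h3 := hx.2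
      simp only [Complex.ofReal_im, Complex.add_im, Complex.mul_im, Complex.I_im, Complex.I_re,
        Complex.ofReal_re, mul_one, mul_zero, zero_add, add_zero, mem_preimage, min_eq_left hy.le,
        max_eq_right hy.le] at h3
      exact ((h.differentiableAt_mom ⟨h3.1, h3.2.trans hyη⟩).const_mul _).differentiableWithinAt)
  simp only [Complex.ofReal_im, Complex.add_im, Complex.mul_im, Complex.I_im, Complex.I_re,
    Complex.ofReal_re, mul_one, mul_zero, zero_add, add_zero, Complex.add_re, Complex.mul_re,
    sub_zero, smul_eq_mul, Complex.ofReal_zero, zero_mul] at h2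
  rw [h1] at h2
  push_cast at h2
  linear_combination -h2

lemma intervalIntegrable_mom_vertical (R : ℝ) {y : ℝ} (hy : 0 ≤ y) (hyη : y < η) :
    IntervalIntegrable (fun s : ℝ => mom t₁ t₂ P Q (R + s * Complex.I)) volume 0 y := by
  refine ContinuousOn.intervalIntegrable fun s hs => ?_
  rw [uIcc_of_le hy] at hs
  refine (ContinuousAt.comp (g := mom t₁ t₂ P Q) (h.continuousAt_mom ?_ ?_)
    (by fun_prop)).continuousWithinAt
  · simpa using hs.1
  · simpa using hs.2.trans_lt hyη

lemma tendsto_integral_vertical_bot {y : ℝ} (hy : 0 ≤ y) (hyη : y < η) :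
    Tendsto (fun R : ℝ => ∫ s in (0 : ℝ)..y,
      (mom t₁ t₂ P Q (R + s * Complex.I) - Real.sqrt (qm * pm))) atBot (𝓝 0) := by
  obtain ⟨η', h1, h2⟩ := exists_between hyη
  obtain ⟨C, hC, hb⟩ := h.mom_left h2 0
  rw [tendsto_zero_iff_norm_tendsto_zero]
  refine squeeze_zero' (Eventually.of_forall fun R => norm_nonneg _)
    ((eventually_le_atBot 0).mono fun R hR =>
      intervalIntegral.norm_integral_le_of_norm_le_const (C := C * w R) fun s hs => ?_)
    (by simpa using (h.weight.tendsto_bot.const_mul C).mul_const |y - 0|)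
  rw [uIoc_of_le hy] at hs
  simpa using hb (R + s * Complex.I) (by simpa using hs.1.le) (by simpa using hs.2.trans_lt h1)
    (by simpa using hR)

lemma tendsto_integral_vertical_top {y : ℝ} (hy : 0 ≤ y) (hyη : y < η) :
    Tendsto (fun R : ℝ => ∫ s in (0 : ℝ)..y,
      (mom t₁ t₂ P Q (R + s * Complex.I) + Real.sqrt (qp * pp))) atTop (𝓝 0) := by
  obtain ⟨η', h1, h2⟩ := exists_between hyη
  obtain ⟨C, hC, hb⟩ := h.mom_right h2 0
  rw [tendsto_zero_iff_norm_tendsto_zero]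
  refine squeeze_zero' (Eventually.of_forall fun R => norm_nonneg _)
    ((eventually_ge_atTop 0).mono fun R hR =>
      intervalIntegral.norm_integral_le_of_norm_le_const (C := C * w R) fun s hs => ?_)
    (by simpa using (h.weight.tendsto_top.const_mul C).mul_const |y - 0|)
  rw [uIoc_of_le hy] at hs
  simpa using hb (R + s * Complex.I) (by simpa using hs.1.le) (by simpa using hs.2.trans_lt h1)
    (by simpa using hR)

omit h in
lemma hasDerivAt_line {z : ℂ → ℂ} (hz : ∀ x ∈ HStrip 0 η, HasDerivAt z (Complex.I *
    mom t₁ t₂ P Q x) x) {y : ℝ} (hy : 0 < y) (hyη : y < η) (d : ℂ) (s : ℝ) :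
    HasDerivAt (fun s : ℝ => z (s + y * Complex.I) - d * (s + y * Complex.I))
      (Complex.I * mom t₁ t₂ P Q (s + y * Complex.I) - d) s := by
  have h1 := (Complex.ofRealCLM.hasDerivAt (x := s)).add_const (y * Complex.I)
  have h2 := (hz (s + y * Complex.I) (by constructor <;> simpa)).scomp s h1
  exact (h2.sub (h1.const_mul d)).congr_deriv (by simp)

lemma exists_phase_line {z : ℂ → ℂ} (hz : ∀ x ∈ HStrip 0 η, HasDerivAt z (Complex.I *
    mom t₁ t₂ P Q x) x) {y : ℝ} (hy : 0 < y) (hyη : y < η) :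
    ∃ c : ℂ, Tendsto (fun s : ℝ => z (s + y * Complex.I) -
      Complex.I * Real.sqrt (qm * pm) * (s + y * Complex.I)) atBot (𝓝 c) ∧
    Tendsto (fun s : ℝ => z (s + y * Complex.I) +
      Complex.I * Real.sqrt (qp * pp) * (s + y * Complex.I)) atTop
      (𝓝 (c + tunnelPhase t₁ t₂ p q pm pp qm qp)) := by
  obtain ⟨η', hyη', h2⟩ := exists_between hyη
  have hmem : ∀ t : ℝ, (t : ℂ) + y * Complex.I ∈ HStrip 0 η := fun t => by
    constructor <;> simpa
  have hcont : Continuous fun t : ℝ => mom t₁ t₂ P Q (t + y * Complex.I) :=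
    continuous_iff_continuousAt.2 fun t => ContinuousAt.comp (g := mom t₁ t₂ P Q)
        (h.differentiableAt_mom (hmem t)).continuousAt (by fun_prop)
  obtain ⟨C, hC, hb⟩ := h.mom_left h2 0
  have hintegr : IntegrableOn (fun s : ℝ => Complex.I * mom t₁ t₂ P Q (s + y * Complex.I) -
      Complex.I * Real.sqrt (qm * pm)) (Iic 0) := by
    refine Integrable.mono' (h.weight.int.const_mul C).integrableOn
      (by fun_prop : Continuous _).aestronglyMeasurable ?_
    refine (ae_restrict_iff' measurableSet_Iic).2 (Eventually.of_forall fun t ht => ?_)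
    rw [← mul_sub, norm_mul, Complex.norm_I, one_mul]
    simpa using hb (t + y * Complex.I) (by simpa using hy.le) (by simpa using hyη')
      (by simpa using ht)
  have hbot := tendsto_limUnder_of_hasDerivAt_of_integrableOn_Iic
    (fun s _ => hasDerivAt_line hz hy hyη _ s) hintegr
  refine ⟨_, hbot, ?_⟩
  set c := limUnder atBot fun s : ℝ => z (s + y * Complex.I) -
    Complex.I * Real.sqrt (qm * pm) * (s + y * Complex.I)
  have h3 := ((hbot.comp (tendsto_neg_atTop_atBot (G := ℝ))).add h.tendsto_integral_mom_real).add
    (((h.tendsto_integral_vertical_bot hy.le hyη).comp (tendsto_neg_atTop_atBot (G := ℝ))).sub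
    (h.tendsto_integral_vertical_top hy.le hyη))
  rw [sub_zero, add_zero] at h3
  refine h3.congr fun R => ?_
  have h4 := h.integral_mom_shift hz hy hyη (R := R)
  have h5 := h.intervalIntegrable_mom_vertical R hy.le hyη
  have h6 := h.intervalIntegrable_mom_vertical (-R) hy.le hyη
  simp only [Function.comp_apply]
  rw [intervalIntegral.integral_sub h6 (by simp), intervalIntegral.integral_add h5 (by simp)]
  simp only [intervalIntegral.integral_const, intervalIntegral.integral_const_mul,
    Complex.ofReal_neg, sub_zero, Complex.real_smul] at h4 ⊢
  linear_combination -h4 - ((∫ s in (0 : ℝ)..y, mom t₁ t₂ P Q (R + s * Complex.I)) -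
    (∫ s in (0 : ℝ)..y, mom t₁ t₂ P Q (-R + s * Complex.I)) + y * Real.sqrt (qm * pm)
    + y * Real.sqrt (qp * pp)) * Complex.I_sq

/-- The phase function along a contour in the upper half strip, and its total variation relative
to the free phases. -/
theorem exists_phase {γ : ℝ → ℂ} {y₁ : ℝ} (hy₁ : y₁ < η) (hγ : ∀ s, γ s ∈ HStrip 0 y₁)
    (hre : ∀ s, (γ s).re = s) :
    ∃ (z : ℂ → ℂ) (c : ℂ), (∀ x ∈ HStrip 0 η, HasDerivAt z (Complex.I * mom t₁ t₂ P Q x) x) ∧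
      Tendsto (fun s => z (γ s) - Complex.I * Real.sqrt (qm * pm) * γ s) atBot (𝓝 c) ∧
      Tendsto (fun s => z (γ s) + Complex.I * Real.sqrt (qp * pp) * γ s) atTop
        (𝓝 (c + tunnelPhase t₁ t₂ p q pm pp qm qp)) := by
  obtain ⟨z, hz⟩ := (convex_HStrip 0 η).exists_forall_hasDerivWithinAt
    (f := fun x => Complex.I * mom t₁ t₂ P Q x)
    fun x hx => ((h.differentiableAt_mom hx).const_mul _).differentiableWithinAt
  replace hz : ∀ x ∈ HStrip 0 η, HasDerivAt z (Complex.I * mom t₁ t₂ P Q x) x :=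
    fun x hx => (hz x hx).hasDerivAt ((isOpen_HStrip 0 η).mem_nhds hx)
  have hy : 0 < (γ 0).im := (hγ 0).1
  have hyy : (γ 0).im < y₁ := (hγ 0).2
  set y := (γ 0).im
  obtain ⟨c, hc1, hc2⟩ := h.exists_phase_line hz hy (hyy.trans hy₁)
  have hz' : ∀ x ∈ HStrip 0 y₁, HasDerivAt z (Complex.I * mom t₁ t₂ P Q x) x :=
    fun x hx => hz x (HStrip_mono le_rfl hy₁.le hx)
  have hline : ∀ s : ℝ, (s : ℂ) + y * Complex.I ∈ HStrip 0 y₁ := fun s => by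
    constructor <;> simpa
  refine ⟨z, c, hz, ?_, ?_⟩
  · obtain ⟨C, hC, hb⟩ := h.mom_left hy₁ 0
    have h1 : Tendsto (fun s => (z (γ s) - Complex.I * Real.sqrt (qm * pm) * γ s) -
        (z (s + y * Complex.I) - Complex.I * Real.sqrt (qm * pm) * (s + y * Complex.I)))
        atBot (𝓝 0) := by
      rw [tendsto_zero_iff_norm_tendsto_zero]
      refine squeeze_zero' (Eventually.of_forall fun R => norm_nonneg _)
        ((eventually_le_atBot 0).mono fun s hs => norm_vertical_sub_le (B := C * w s) hz'
          (s := s) (fun x hx hxs => ?_) (hline s) (hγ s) (by simp) (hre s))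
        (by simpa using (h.weight.tendsto_bot.const_mul C).mul_const y₁)
      rw [← mul_sub, norm_mul, Complex.norm_I, one_mul, ← hxs]
      exact hb x hx.1.le hx.2 (hxs.trans_le hs)
    simpa using h1.add hc1
  · obtain ⟨C, hC, hb⟩ := h.mom_right hy₁ 0
    have h1 : Tendsto (fun s => (z (γ s) - -(Complex.I * Real.sqrt (qp * pp)) * γ s) -
        (z (s + y * Complex.I) - -(Complex.I * Real.sqrt (qp * pp)) * (s + y * Complex.I)))
        atTop (𝓝 0) := by
      rw [tendsto_zero_iff_norm_tendsto_zero]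
      refine squeeze_zero' (Eventually.of_forall fun R => norm_nonneg _)
        ((eventually_ge_atTop 0).mono fun s hs => norm_vertical_sub_le (B := C * w s) hz'
          (s := s) (fun x hx hxs => ?_) (hline s) (hγ s) (by simp) (hre s))
        (by simpa using (h.weight.tendsto_top.const_mul C).mul_const y₁)
      rw [sub_neg_eq_add, ← mul_add, norm_mul, Complex.norm_I, one_mul, ← hxs]
      exact hb x hx.1.le hx.2 (hs.trans_eq hxs.symm)
    refine (h1.add hc2).congr' (Eventually.of_forall fun s => ?_) |>.trans_eq (by simp)
    ring

end Barrier

/-- The off-diagonal operator `(v₁, v₂) ↦ (α v₂, β v₁)`. -/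
noncomputable def offDiag (α β : ℂ) : ℂ × ℂ →L[ℂ] ℂ × ℂ :=
  α • (ContinuousLinearMap.inl ℂ ℂ ℂ).comp (ContinuousLinearMap.snd ℂ ℂ ℂ) +
    β • (ContinuousLinearMap.inr ℂ ℂ ℂ).comp (ContinuousLinearMap.fst ℂ ℂ ℂ)

@[simp] lemma offDiag_apply (α β : ℂ) (v : ℂ × ℂ) : offDiag α β v = (α * v.2, β * v.1) := by
  simp [offDiag]

lemma norm_offDiag_le (α β : ℂ) : ‖offDiag α β‖ ≤ ‖α‖ + ‖β‖ := by
  refine ContinuousLinearMap.opNorm_le_bound _ (by positivity) fun v => ?_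
  rw [offDiag_apply, Prod.norm_mk, norm_mul, norm_mul]
  have h1 := norm_fst_le v
  have h2 := norm_snd_le v
  have h3 := mul_le_mul_of_nonneg_left h1 (norm_nonneg β)
  have h4 := mul_le_mul_of_nonneg_left h2 (norm_nonneg α)
  have := norm_nonneg v
  refine max_le ?_ ?_ <;> nlinarith [norm_nonneg α, norm_nonneg β]

/-- The system `u₁' = (i/h) p u₂`, `u₂' = (i/h) q u₁` at the point `x`. -/
def SolvesAt (hb : ℝ) (p q : ℂ → ℂ) (U : ℂ → ℂ × ℂ) (x : ℂ) : Prop :=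
  HasDerivAt U (offDiag (Complex.I / hb * p x) (Complex.I / hb * q x) (U x)) x

lemma SolvesAt.fst {hb : ℝ} {p q : ℂ → ℂ} {U : ℂ → ℂ × ℂ} {x : ℂ} (h : SolvesAt hb p q U x) :
    HasDerivAt (fun x => (U x).1) (Complex.I / hb * p x * (U x).2) x := by
  simpa [Function.comp_def] using
    (ContinuousLinearMap.fst ℂ ℂ ℂ).hasFDerivAt.comp_hasDerivAt x h

lemma SolvesAt.snd {hb : ℝ} {p q : ℂ → ℂ} {U : ℂ → ℂ × ℂ} {x : ℂ} (h : SolvesAt hb p q U x) :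
    HasDerivAt (fun x => (U x).2) (Complex.I / hb * q x * (U x).1) x := by
  simpa [Function.comp_def] using
    (ContinuousLinearMap.snd ℂ ℂ ℂ).hasFDerivAt.comp_hasDerivAt x h

/-- The Wronskian of two solutions is constant. -/
lemma SolvesAt.wron_eq {hb : ℝ} {p q : ℂ → ℂ} {U X : ℂ → ℂ × ℂ} {S : Set ℂ} (hS : Convex ℝ S)
    (hU : ∀ x ∈ S, SolvesAt hb p q U x) (hX : ∀ x ∈ S, SolvesAt hb p q X x) {x y : ℂ}
    (hx : x ∈ S) (hy : y ∈ S) : Wron (U x) (X x) = Wron (U y) (X y) := by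
  have h1 : ∀ x ∈ S, HasDerivWithinAt (fun x => Wron (U x) (X x)) 0 S x := fun x hx =>
    ((((hU x hx).fst.mul (hX x hx).snd).sub ((hU x hx).snd.mul (hX x hx).fst)).congr_deriv
      (by ring)).hasDerivWithinAt
  have h2 := hS.norm_image_sub_le_of_norm_hasDerivWithin_le (C := 0) h1 (fun x _ => by simp) hy hx
  rw [zero_mul] at h2
  exact sub_eq_zero.1 (norm_le_zero_iff.1 h2)

lemma quarter_root {x y : ℝ} (hx : 0 < x) (hy : 0 < y) :
    0 < (x / y) ^ (1 / 4 : ℝ) ∧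
    Real.sqrt (y * x) * (x / y) ^ (1 / 4 : ℝ) = x * ((x / y) ^ (1 / 4 : ℝ))⁻¹ ∧
    Real.sqrt (y * x) * ((x / y) ^ (1 / 4 : ℝ))⁻¹ = y * (x / y) ^ (1 / 4 : ℝ) := by
  have ha : 0 < (x / y) ^ (1 / 4 : ℝ) := by positivity
  have h2 : ((x / y) ^ (1 / 4 : ℝ)) ^ 2 = Real.sqrt (x / y) := by
    rw [← Real.rpow_natCast, ← Real.rpow_mul (by positivity), Real.sqrt_eq_rpow]
    norm_num
  set a := (x / y) ^ (1 / 4 : ℝ)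
  have h3 : Real.sqrt (y * x) = y * Real.sqrt (x / y) := by
    rw [Real.sqrt_eq_iff_mul_self_eq (by positivity) (by positivity)]
    have := Real.mul_self_sqrt (by positivity : 0 ≤ x / y)
    rw [mul_mul_mul_comm, this]
    field_simp
  have h4 : y * (a ^ 2 * a ^ 2) = x := by
    rw [h2, Real.mul_self_sqrt (by positivity)]; field_simp
  refine ⟨ha, ?_, ?_⟩
  · rw [h3, ← h2, eq_mul_inv_iff_mul_eq₀ ha.ne', ← h4]; ring
  · rw [h3, ← h2, mul_inv_eq_iff_eq_mul₀ ha.ne']; ring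

/-- Asymptotics `u ~ exp(θ x) v` of a solution persist along a curve in the upper half strip. -/
lemma SolvesAt.tendsto_along {hb : ℝ} (hhb : 0 < hb) {p q : ℂ → ℂ} {U : ℂ → ℂ × ℂ} {η M : ℝ}
    (hη : 0 < η) (hU : ∀ x ∈ HStrip (-η) η, SolvesAt hb p q U x)
    (hp : ∀ x ∈ HStrip (-η) η, ‖p x‖ ≤ M) (hq : ∀ x ∈ HStrip (-η) η, ‖q x‖ ≤ M)
    {γ : ℝ → ℂ} (hre : ∀ s, (γ s).re = s) (hγ : ∀ s, γ s ∈ HStrip 0 η) {l : Filter ℝ}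
    {k p₀ q₀ : ℝ} {v : ℂ × ℂ} (h1 : k * v.1 = p₀ * v.2) (h2 : k * v.2 = q₀ * v.1)
    {ε : ℝ → ℝ} (hε : Tendsto ε l (𝓝 0))
    (hpl : ∀ᶠ s in l, ∀ x ∈ HStrip (-η) η, x.re = s → ‖p x - p₀‖ ≤ ε s)
    (hql : ∀ᶠ s in l, ∀ x ∈ HStrip (-η) η, x.re = s → ‖q x - q₀‖ ≤ ε s)
    (hlim : Tendsto (fun s : ℝ => Complex.exp (-(Complex.I * k / hb * s)) • U s) l (𝓝 v)) :
    Tendsto (fun s => Complex.exp (-(Complex.I * k / hb * γ s)) • U (γ s)) l (𝓝 v) := by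
  have hn : ‖Complex.I / hb‖ = hb⁻¹ := by
    rw [norm_div, Complex.norm_I, Complex.norm_real, Real.norm_of_nonneg hhb.le, one_div]
  have hmem : ∀ s t : ℝ, 0 ≤ t → t ≤ (γ s).im → (s : ℂ) + t * Complex.I ∈ HStrip (-η) η :=
    fun s t ht ht' => ⟨by simp; linarith, by simpa using ht'.trans_lt (hγ s).2⟩
  refine tendsto_along_curve (S := HStrip (-η) η)
    (A := fun x => offDiag (Complex.I / hb * p x) (Complex.I / hb * q x)) hU
    (M := hb⁻¹ * M + hb⁻¹ * M) (fun x hx => (norm_offDiag_le _ _).trans ?_) hre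
    (fun s => (hγ s).1.le) (fun s => (hγ s).2.le) hmem
    (ε := fun s => hb⁻¹ * ε s * (‖v.1‖ + ‖v.2‖))
    (by simpa using (hε.const_mul hb⁻¹).mul_const (‖v.1‖ + ‖v.2‖)) ?_ hlim
  · rw [norm_mul, norm_mul, hn]
    have : (0 : ℝ) ≤ hb⁻¹ := by positivity
    exact add_le_add (mul_le_mul_of_nonneg_left (hp x hx) this)
      (mul_le_mul_of_nonneg_left (hq x hx) this)
  · filter_upwards [hpl, hql] with s hps hqs t ht ht'
    have hx := hmem s t ht ht'
    have h3 := hps _ hx (by simp)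
    have h4 := hqs _ hx (by simp)
    set x := (s : ℂ) + t * Complex.I
    have e : offDiag (Complex.I / hb * p x) (Complex.I / hb * q x) v -
        (Complex.I * k / hb) • v =
        (Complex.I / hb * ((p x - p₀) * v.2), Complex.I / hb * ((q x - q₀) * v.1)) := by
      rw [offDiag_apply]
      refine Prod.ext ?_ ?_
      · simp only [Prod.fst_sub, Prod.smul_fst, smul_eq_mul]
        linear_combination -(Complex.I / hb) * h1
      · simp only [Prod.snd_sub, Prod.smul_snd, smul_eq_mul]
        linear_combination -(Complex.I / hb) * h2
    have hε0 : 0 ≤ ε s := (norm_nonneg _).trans h3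
    rw [e, Prod.norm_mk, norm_mul, norm_mul, norm_mul, norm_mul, hn]
    have h5 := mul_le_mul_of_nonneg_right h3 (norm_nonneg v.2)
    have h6 := mul_le_mul_of_nonneg_right h4 (norm_nonneg v.1)
    have h7 := mul_nonneg hε0 (norm_nonneg v.1)
    have h8 := mul_nonneg hε0 (norm_nonneg v.2)
    have : (0 : ℝ) ≤ hb⁻¹ := by positivity
    rw [mul_assoc]
    exact max_le (mul_le_mul_of_nonneg_left (by linarith) this)
      (mul_le_mul_of_nonneg_left (by linarith) this)

namespace Barrier

variable {w : ℝ → ℝ} {η t₁ t₂ : ℝ} {p q P Q : ℂ → ℂ} {pm pp qm qp a₀ : ℝ}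
variable (h : Barrier w η t₁ t₂ p q P Q pm pp qm qp a₀)
include h

lemma exists_bound {η' : ℝ} (hη : η' < η) :
    ∃ M, ∀ x ∈ HStrip (-η') η', ‖p x‖ ≤ M ∧ ‖q x‖ ≤ M := by
  obtain ⟨M₁, -, h1⟩ := h.scat_p.bounded h.weight hη
  obtain ⟨M₂, -, h2⟩ := h.scat_q.bounded h.weight hη
  exact ⟨max M₁ M₂, fun x hx =>
    ⟨(h1 x hx).trans (le_max_left _ _), (h2 x hx).trans (le_max_right _ _)⟩⟩

/-- Solutions on the real line extend holomorphically to the strip. -/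
lemma exists_extension {η' hb : ℝ} (hη0 : 0 < η') (hη : η' < η) {u : ℝ → ℂ × ℂ}
    (hu : ∀ s : ℝ, HasDerivAt u
      (offDiag (Complex.I / hb * p s) (Complex.I / hb * q s) (u s)) s) :
    ∃ U : ℂ → ℂ × ℂ, (∀ s : ℝ, U s = u s) ∧ ∀ x ∈ HStrip (-η') η', SolvesAt hb p q U x := by
  obtain ⟨M, hM⟩ := h.exists_bound hη
  have hsub : HStrip (-η') η' ⊆ HStrip (-η) η := HStrip_mono (by linarith) hη.le
  have hp := h.scat_p.diff.mono hsub
  have hq := h.scat_q.diff.mono hsub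
  refine exists_holomorphic_extension (convex_HStrip _ _) (isOpen_HStrip _ _)
    (IsScat.ofReal_mem hη0)
    (A := fun x => offDiag (Complex.I / hb * p x) (Complex.I / hb * q x)) ?_
    (M := ‖Complex.I / hb‖ * M + ‖Complex.I / hb‖ * M) (fun x hx => ?_) hu
  · exact ((hp.const_mul _).smul_const _).add ((hq.const_mul _).smul_const _)
  · refine (norm_offDiag_le _ _).trans ?_
    rw [norm_mul, norm_mul]
    exact add_le_add (mul_le_mul_of_nonneg_left (hM x hx).1 (norm_nonneg _))
      (mul_le_mul_of_nonneg_left (hM x hx).2 (norm_nonneg _))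

lemma tendsto_left {η' hb : ℝ} (hhb : 0 < hb) (hη0 : 0 < η') (hη : η' < η) {U : ℂ → ℂ × ℂ}
    (hU : ∀ x ∈ HStrip (-η') η', SolvesAt hb p q U x) {γ : ℝ → ℂ} (hre : ∀ s, (γ s).re = s)
    (hγ : ∀ s, γ s ∈ HStrip 0 η') (hlim : Tendsto (fun s : ℝ => Complex.exp
      (-(Complex.I * Real.sqrt (qm * pm) / hb * s)) • U s) atBot
      (𝓝 ((((pm / qm) ^ (1 / 4 : ℝ) : ℝ) : ℂ), (((pm / qm) ^ (1 / 4 : ℝ) : ℝ) : ℂ)⁻¹))) :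
    Tendsto (fun s : ℝ => Complex.exp
      (-(Complex.I * Real.sqrt (qm * pm) / hb * γ s)) • U (γ s)) atBot
      (𝓝 ((((pm / qm) ^ (1 / 4 : ℝ) : ℝ) : ℂ), (((pm / qm) ^ (1 / 4 : ℝ) : ℝ) : ℂ)⁻¹)) := by
  obtain ⟨M, hM⟩ := h.exists_bound hη
  obtain ⟨C₁, hC₁, hb₁⟩ := h.scat_p.bound_left h.weight hη 0
  obtain ⟨C₂, hC₂, hb₂⟩ := h.scat_q.bound_left h.weight hη 0
  obtain ⟨-, e1, e2⟩ := quarter_root (h.a₀_pos.trans_le h.le_pm) (h.a₀_pos.trans_le h.le_qm)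
  have hw := fun s => (h.weight.pos s).le
  refine SolvesAt.tendsto_along hhb hη0 hU (fun x hx => (hM x hx).1) (fun x hx => (hM x hx).2)
    hre hγ (p₀ := pm) (q₀ := qm) (by dsimp only; exact_mod_cast e1)
    (by dsimp only; exact_mod_cast e2)
    (ε := fun s => (C₁ + C₂) * w s) (by simpa using h.weight.tendsto_bot.const_mul (C₁ + C₂))
    ?_ ?_ hlim
  · filter_upwards [eventually_le_atBot 0] with s hs x hx hxs
    have := hb₁ x hx (hxs.trans_le hs)
    rw [hxs] at this
    nlinarith [mul_nonneg hC₂ (hw s)]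
  · filter_upwards [eventually_le_atBot 0] with s hs x hx hxs
    have := hb₂ x hx (hxs.trans_le hs)
    rw [hxs] at this
    nlinarith [mul_nonneg hC₁ (hw s)]

lemma tendsto_right {η' hb : ℝ} (hhb : 0 < hb) (hη0 : 0 < η') (hη : η' < η) {U : ℂ → ℂ × ℂ}
    (hU : ∀ x ∈ HStrip (-η') η', SolvesAt hb p q U x) {γ : ℝ → ℂ} (hre : ∀ s, (γ s).re = s)
    (hγ : ∀ s, γ s ∈ HStrip 0 η') (hlim : Tendsto (fun s : ℝ => Complex.exp
      (-(Complex.I * Real.sqrt (qp * pp) / hb * s)) • U s) atTop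
      (𝓝 ((((pp / qp) ^ (1 / 4 : ℝ) : ℝ) : ℂ), -(((pp / qp) ^ (1 / 4 : ℝ) : ℝ) : ℂ)⁻¹))) :
    Tendsto (fun s : ℝ => Complex.exp
      (-(Complex.I * Real.sqrt (qp * pp) / hb * γ s)) • U (γ s)) atTop
      (𝓝 ((((pp / qp) ^ (1 / 4 : ℝ) : ℝ) : ℂ), -(((pp / qp) ^ (1 / 4 : ℝ) : ℝ) : ℂ)⁻¹)) := by
  obtain ⟨M, hM⟩ := h.exists_bound hη
  obtain ⟨C₁, hC₁, hb₁⟩ := h.scat_p.bound_right h.weight hη 0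
  obtain ⟨C₂, hC₂, hb₂⟩ := h.scat_q.bound_right h.weight hη 0
  obtain ⟨-, e1, e2⟩ := quarter_root (h.a₀_pos.trans_le h.le_pp) (h.a₀_pos.trans_le h.le_qp)
  rw [neg_div_neg_eq, neg_mul_neg] at e1 e2
  have hw := fun s => (h.weight.pos s).le
  refine SolvesAt.tendsto_along hhb hη0 hU (fun x hx => (hM x hx).1) (fun x hx => (hM x hx).2)
    hre hγ (p₀ := pp) (q₀ := qp) (by dsimp only; rw [neg_mul_comm] at e1; exact_mod_cast e1)
    (by dsimp only; rw [mul_neg, neg_eq_iff_eq_neg, ← neg_mul]; exact_mod_cast e2)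
    (ε := fun s => (C₁ + C₂) * w s) (by simpa using h.weight.tendsto_top.const_mul (C₁ + C₂))
    ?_ ?_ hlim
  · filter_upwards [eventually_ge_atTop 0] with s hs x hx hxs
    have := hb₁ x hx (hs.trans_eq hxs.symm)
    rw [hxs] at this
    nlinarith [mul_nonneg hC₂ (hw s)]
  · filter_upwards [eventually_ge_atTop 0] with s hs x hx hxs
    have := hb₂ x hx (hs.trans_eq hxs.symm)
    rw [hxs] at this
    nlinarith [mul_nonneg hC₁ (hw s)]

end Barrier

/-- The component of a solution along the first exact WKB direction. -/
noncomputable def wkbFst (A : ℂ → ℂ) (U : ℂ → ℂ × ℂ) (x : ℂ) : ℂ :=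
  ((U x).1 / A x + A x * (U x).2) / 2

/-- The component of a solution along the second exact WKB direction. -/
noncomputable def wkbSnd (A : ℂ → ℂ) (U : ℂ → ℂ × ℂ) (x : ℂ) : ℂ :=
  ((U x).1 / A x - A x * (U x).2) / 2

lemma wron_eq_wkb {A : ℂ → ℂ} {x : ℂ} (hA : A x ≠ 0) (U X : ℂ → ℂ × ℂ) :
    Wron (U x) (X x) =
      -2 * wkbFst A U x * wkbSnd A X x + 2 * wkbSnd A U x * wkbFst A X x := by
  simp only [Wron, wkbFst, wkbSnd]
  field_simp
  ring

lemma tendsto_wkb {A : ℂ → ℂ} {U : ℂ → ℂ × ℂ} {γ : ℝ → ℂ} {τ : ℝ → ℂ} {l : Filter ℝ} {a b : ℂ}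
    (ha : a ≠ 0) (hA : Tendsto (fun s => A (γ s)) l (𝓝 a))
    (hU : Tendsto (fun s => τ s • U (γ s)) l (𝓝 (a, b))) :
    Tendsto (fun s => τ s * wkbFst A U (γ s)) l (𝓝 ((1 + a * b) / 2)) ∧
    Tendsto (fun s => τ s * wkbSnd A U (γ s)) l (𝓝 ((1 - a * b) / 2)) := by
  have h1 : Tendsto (fun s => τ s * (U (γ s)).1) l (𝓝 a) :=
    (continuous_fst.tendsto (a, b)).comp hU
  have h2 : Tendsto (fun s => τ s * (U (γ s)).2) l (𝓝 b) :=
    (continuous_snd.tendsto (a, b)).comp hU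
  have h3 := h1.div hA ha
  have h4 := hA.mul h2
  rw [div_self ha] at h3
  constructor
  · exact ((h3.add h4).div_const 2).congr fun s => by simp only [wkbFst, Pi.div_apply]; ring
  · exact ((h3.sub h4).div_const 2).congr fun s => by simp only [wkbSnd, Pi.div_apply]; ring

/-- The transmitted amplitude cannot blow up along a monotone path. -/
lemma TransData.exists_bound_reflected {w : ℝ → ℝ} {g κ : ℂ → ℂ} {y₀ y₁ r G K₀ hb : ℝ}
    (h : TransData w g κ y₀ y₁ r G K₀) {γ γ' : ℝ → ℂ} (hγ : TransPath κ y₀ y₁ γ γ') (hhb : 0 < hb)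
    {we wo : ℝ → ℂ} (hwe : ∀ s, HasDerivAt we (-(γ' s * g (γ s) * wo s)) s)
    (hwo : ∀ s, HasDerivAt wo (-(γ' s * (2 * κ (γ s) / hb * wo s + g (γ s) * we s))) s)
    (hwe0 : Tendsto we atBot (𝓝 1)) (hwo0 : Tendsto wo atBot (𝓝 0)) : ∃ M, ∀ s, ‖wo s‖ ≤ M := by
  have hα : ∀ s, ‖γ' s * g (γ s)‖ ≤ 2 * G * w s := fun s => by
    have h1 := h.bound_g (γ s)
      (HStrip_mono (by linarith [h.r_pos]) (by linarith [h.r_pos]) (hγ.mem s))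
    rw [hγ.re_eq] at h1
    rw [norm_mul, mul_assoc]
    exact mul_le_mul (hγ.norm_le s) h1 (norm_nonneg _) two_pos.le
  refine ⟨Real.sqrt (Real.exp ((2 * (2 * G) + 1) * ∫ t, w t) * ((2 * G) ^ 2 * ∫ t, w t)),
    fun s => Real.le_sqrt_of_sq_le ((le_add_of_nonneg_left (sq_nonneg ‖we s - 1‖)).trans ?_)⟩
  refine energy_estimate (u := fun s => we s - 1) (α := fun s => γ' s * g (γ s))
    (β := fun s => 2 / hb * (κ (γ s) * γ' s)) (R := fun s => -(γ' s * g (γ s)))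
    h.weight (mul_nonneg two_pos.le h.G_nonneg) (fun s => (hwe s).sub_const 1)
    (fun s => (hwo s).congr_deriv (by ring)) hα (fun s => ?_) (fun s => by simpa using hα s)
    (by simpa using hwe0.sub_const 1) hwo0 s
  have e : (2 / hb * (κ (γ s) * γ' s) : ℂ) = ((2 / hb : ℝ) : ℂ) * (κ (γ s) * γ' s) := by
    push_cast
    ring
  rw [e, Complex.re_ofReal_mul]
  exact mul_nonneg (by positivity) (hγ.mono s)

namespace Barrier

variable {w : ℝ → ℝ} {η t₁ t₂ : ℝ} {p q P Q : ℂ → ℂ} {pm pp qm qp a₀ : ℝ}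
variable (h : Barrier w η t₁ t₂ p q P Q pm pp qm qp a₀)
include h

lemma hasDerivAt_wkb {hb : ℝ} {U : ℂ → ℂ × ℂ} {x : ℂ} (hx : x ∈ HStrip 0 η)
    (hU : SolvesAt hb p q U x) :
    HasDerivAt (wkbFst (amp t₁ t₂ P Q) U)
      (Complex.I * mom t₁ t₂ P Q x / hb * wkbFst (amp t₁ t₂ P Q) U x -
        (deriv p x / p x - deriv q x / q x) / 4 * wkbSnd (amp t₁ t₂ P Q) U x) x ∧
    HasDerivAt (wkbSnd (amp t₁ t₂ P Q) U)
      (-(Complex.I * mom t₁ t₂ P Q x / hb * wkbSnd (amp t₁ t₂ P Q) U x) -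
        (deriv p x / p x - deriv q x / q x) / 4 * wkbFst (amp t₁ t₂ P Q) U x) x := by
  have hA := h.hasDerivAt_amp hx
  have hA0 := h.amp_ne hx
  have e1 := h.p_eq hx
  have e2 := h.q_mul hx
  have h1 : HasDerivAt (fun x => (U x).1 / amp t₁ t₂ P Q x)
      (Complex.I / hb * mom t₁ t₂ P Q x * (amp t₁ t₂ P Q x * (U x).2) -
        (deriv p x / p x - deriv q x / q x) / 4 * ((U x).1 / amp t₁ t₂ P Q x)) x := by
    refine (hU.fst.div hA hA0).congr_deriv ?_
    set g := (deriv p x / p x - deriv q x / q x) / 4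
    rw [e1]
    field_simp
  have h2 : HasDerivAt (fun x => amp t₁ t₂ P Q x * (U x).2)
      ((deriv p x / p x - deriv q x / q x) / 4 * (amp t₁ t₂ P Q x * (U x).2) +
        Complex.I / hb * mom t₁ t₂ P Q x * ((U x).1 / amp t₁ t₂ P Q x)) x := by
    refine (hA.mul hU.snd).congr_deriv ?_
    set g := (deriv p x / p x - deriv q x / q x) / 4
    rw [← e2]
    field_simp
  refine ⟨((h1.add h2).div_const 2).congr_deriv ?_, ((h1.sub h2).div_const 2).congr_deriv ?_⟩ <;>
  · simp only [wkbFst, wkbSnd]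
    ring

/-- The exact transmission amplitude `-W(u, x) exp(-θ/h) / 2` of a pair of Jost solutions has a
full expansion in powers of `h`, with factorially controlled coefficients and remainders. -/
theorem exists_wron_expansion :
    ∃ (a : ℕ → ℂ) (B D : ℝ), 0 < B ∧ 0 < D ∧ a 0 = 1 ∧ (∀ j : ℕ, ‖a j‖ ≤ D * (B * j) ^ j) ∧
      ∀ hb : ℝ, 0 < hb → ∀ u v : ℝ → ℂ × ℂ,
        (∀ s : ℝ, HasDerivAt u
          (offDiag (Complex.I / hb * p s) (Complex.I / hb * q s) (u s)) s) →
        (∀ s : ℝ, HasDerivAt v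
          (offDiag (Complex.I / hb * p s) (Complex.I / hb * q s) (v s)) s) →
        Tendsto (fun s : ℝ => Complex.exp (-(Complex.I * Real.sqrt (qm * pm) / hb * s)) • u s) atBot
          (𝓝 ((((pm / qm) ^ (1 / 4 : ℝ) : ℝ) : ℂ), (((pm / qm) ^ (1 / 4 : ℝ) : ℝ) : ℂ)⁻¹)) →
        Tendsto (fun s : ℝ => Complex.exp (-(Complex.I * Real.sqrt (qp * pp) / hb * s)) • v s) atTop
          (𝓝 ((((pp / qp) ^ (1 / 4 : ℝ) : ℝ) : ℂ), -(((pp / qp) ^ (1 / 4 : ℝ) : ℝ) : ℂ)⁻¹)) →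
        ∀ N : ℕ, ‖-(1 / 2) * Wron (u 0) (v 0) *
            Complex.exp (-(tunnelPhase t₁ t₂ p q pm pp qm qp / hb)) -
            ∑ j ∈ Finset.range (N + 1), a j * (hb : ℂ) ^ j‖
          ≤ D * hb ^ N * (B * (N + 1 : ℕ)) ^ (N + 1) := by
  obtain ⟨γ, γ', y₀, y₁, r, hr, hr', hy₀, hy₁, hγ⟩ := h.exists_path
  obtain ⟨G, K₀, hT⟩ := h.transData hr hr' hy₀ hy₁
  obtain ⟨η', hη1, hη2⟩ := exists_between (show y₁ < η by linarith)
  have hmem0 := hγ.mem 0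
  have hη0 : 0 < η' := by linarith [hmem0.1, hmem0.2]
  obtain ⟨K', hK'⟩ := h.norm_mom_le hη2
  obtain ⟨a, B, D, hB, hD, ha0, ha, hexp⟩ := hT.exists_expansion hγ (K' := K')
    (fun x hx => by
      rw [norm_mul, Complex.norm_I, one_mul]
      exact hK' x (HStrip_mono (by linarith) hη1.le hx))
  refine ⟨a, B, D, hB, hD, ha0, ha, fun hb hhb u v hu hv hul hvl => ?_⟩
  have hγη' : ∀ s, γ s ∈ HStrip 0 η' := fun s => HStrip_mono (by linarith) hη1.le (hγ.mem s)
  have hγη : ∀ s, γ s ∈ HStrip 0 η := fun s => HStrip_mono le_rfl hη2.le (hγη' s)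
  have hγc : ∀ s, γ s ∈ HStrip (-η) η := fun s => h.mem_of_upper (hγη s)
  have hsub : HStrip 0 η' ⊆ HStrip (-η') η' := HStrip_mono (by linarith) le_rfl
  obtain ⟨U, hUu, hU⟩ := h.exists_extension hη0 hη2 hu
  obtain ⟨X, hXv, hX⟩ := h.exists_extension hη0 hη2 hv
  simp only [← hUu] at hul
  simp only [← hXv] at hvl
  have hUl := h.tendsto_left hhb hη0 hη2 hU hγ.re_eq hγη' hul
  have hXl := h.tendsto_right hhb hη0 hη2 hX hγ.re_eq hγη' hvl
  obtain ⟨z, c, hz, hzbot, hztop⟩ := h.exists_phase hη2 hγη' hγ.re_eq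
  set θ := tunnelPhase t₁ t₂ p q pm pp qm qp
  obtain ⟨ham, -, -⟩ := quarter_root (h.a₀_pos.trans_le h.le_pm) (h.a₀_pos.trans_le h.le_qm)
  obtain ⟨hap, -, -⟩ := quarter_root (h.a₀_pos.trans_le h.le_pp) (h.a₀_pos.trans_le h.le_qp)
  rw [neg_div_neg_eq] at hap
  have ham' : (((pm / qm) ^ (1 / 4 : ℝ) : ℝ) : ℂ) ≠ 0 := by exact_mod_cast ham.ne'
  have hap' : (((pp / qp) ^ (1 / 4 : ℝ) : ℝ) : ℂ) ≠ 0 := by exact_mod_cast hap.ne'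
  have hUw := tendsto_wkb ham' (h.tendsto_amp_bot hγc hγ.re_eq) hUl
  have hXw := tendsto_wkb hap' (h.tendsto_amp_top hγc hγ.re_eq) hXl
  rw [mul_inv_cancel₀ ham'] at hUw
  rw [mul_neg, mul_inv_cancel₀ hap'] at hXw
  norm_num at hUw hXw
  have hhb' : (hb : ℂ) ≠ 0 := by exact_mod_cast hhb.ne'
  set τ : ℝ → ℂ := fun s => Complex.exp (-((z (γ s) - c) / hb)) with hτ
  have hτ0 : ∀ s, τ s ≠ 0 := fun s => Complex.exp_ne_zero _
  have hτ' : ∀ s, HasDerivAt τ (-(γ' s * (Complex.I * mom t₁ t₂ P Q (γ s) / hb)) * τ s) s :=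
    fun s => by
      have h1 := (hz _ (hγη s)).scomp s (hγ.deriv s)
      exact (((h1.sub_const c).div_const (hb : ℂ)).neg.cexp).congr_deriv (by
        simp only [hτ, Function.comp_apply, smul_eq_mul, Pi.neg_apply]; ring)
  set we : ℝ → ℂ := fun s => τ s * wkbFst (amp t₁ t₂ P Q) U (γ s) with hwe
  set wo : ℝ → ℂ := fun s => τ s * wkbSnd (amp t₁ t₂ P Q) U (γ s) with hwo
  have hwe' : ∀ s, HasDerivAt we
      (-(γ' s * ((deriv p (γ s) / p (γ s) - deriv q (γ s) / q (γ s)) / 4) * wo s)) s := fun s => by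
    have h1 := (h.hasDerivAt_wkb (hγη s) (hU _ (hsub (hγη' s)))).1.scomp s (hγ.deriv s)
    exact ((hτ' s).mul h1).congr_deriv (by
      simp only [hwo, Function.comp_apply, smul_eq_mul]; ring)
  have hwo' : ∀ s, HasDerivAt wo
      (-(γ' s * (2 * (Complex.I * mom t₁ t₂ P Q (γ s)) / hb * wo s +
        (deriv p (γ s) / p (γ s) - deriv q (γ s) / q (γ s)) / 4 * we s))) s := fun s => by
    have h1 := (h.hasDerivAt_wkb (hγη s) (hU _ (hsub (hγη' s)))).2.scomp s (hγ.deriv s)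
    exact ((hτ' s).mul h1).congr_deriv (by
      simp only [hwo, hwe, Function.comp_apply, smul_eq_mul]; ring)
  have hτbot : Tendsto (fun s => τ s * Complex.exp (Complex.I * Real.sqrt (qm * pm) / hb * γ s))
      atBot (𝓝 1) := by
    have h1 := (((hzbot.sub_const c).div_const (hb : ℂ)).neg).cexp
    rw [sub_self, zero_div, neg_zero, Complex.exp_zero] at h1
    refine h1.congr fun s => ?_
    rw [hτ, ← Complex.exp_add]
    congr 1
    ring
  have hτtop : Tendsto (fun s => (τ s)⁻¹ *
      Complex.exp (Complex.I * Real.sqrt (qp * pp) / hb * γ s)) atTop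
      (𝓝 (Complex.exp (θ / hb))) := by
    have h1 := ((hztop.sub_const c).div_const (hb : ℂ)).cexp
    rw [add_sub_cancel_left] at h1
    refine h1.congr fun s => ?_
    rw [hτ, ← Complex.exp_neg, ← Complex.exp_add]
    congr 1
    ring
  have hcancel : ∀ x y z : ℂ, x * Complex.exp y * (Complex.exp (-y) * z) = x * z :=
    fun x y z => by
      rw [mul_assoc, ← mul_assoc (Complex.exp y), ← Complex.exp_add, add_neg_cancel,
        Complex.exp_zero, one_mul]
  have hwe0 : Tendsto we atBot (𝓝 1) := by
    have := hτbot.mul hUw.1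
    rw [one_mul] at this
    exact this.congr fun s => hcancel _ _ _
  have hwo0 : Tendsto wo atBot (𝓝 0) := by
    have := hτbot.mul hUw.2
    rw [mul_zero] at this
    exact this.congr fun s => hcancel _ _ _
  have hX1 : Tendsto (fun s => (τ s)⁻¹ * wkbFst (amp t₁ t₂ P Q) X (γ s)) atTop (𝓝 0) := by
    have := hτtop.mul hXw.1
    rw [mul_zero] at this
    exact this.congr fun s => hcancel _ _ _
  have hX2 : Tendsto (fun s => (τ s)⁻¹ * wkbSnd (amp t₁ t₂ P Q) X (γ s)) atTop
      (𝓝 (Complex.exp (θ / hb))) := by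
    have := hτtop.mul hXw.2
    rw [mul_one] at this
    exact this.congr fun s => hcancel _ _ _
  obtain ⟨M, hM⟩ := hT.exists_bound_reflected hγ hhb hwe' hwo' hwe0 hwo0
  have hWo : Tendsto (fun s => wo s * ((τ s)⁻¹ * wkbFst (amp t₁ t₂ P Q) X (γ s))) atTop (𝓝 0) := by
    rw [tendsto_zero_iff_norm_tendsto_zero]
    refine squeeze_zero (fun s => norm_nonneg _)
      (g := fun s => M * ‖(τ s)⁻¹ * wkbFst (amp t₁ t₂ P Q) X (γ s)‖) (fun s => ?_)
      (by simpa using (tendsto_zero_iff_norm_tendsto_zero.1 hX1).const_mul M)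
    rw [norm_mul]
    exact mul_le_mul_of_nonneg_right (hM s) (norm_nonneg _)
  have hW : ∀ s, Wron (u 0) (v 0) = -2 * we s * ((τ s)⁻¹ * wkbSnd (amp t₁ t₂ P Q) X (γ s)) +
      2 * (wo s * ((τ s)⁻¹ * wkbFst (amp t₁ t₂ P Q) X (γ s))) := fun s => by
    have h1 := SolvesAt.wron_eq (convex_HStrip (-η') η') hU hX
      (IsScat.ofReal_mem hη0 0) (hsub (hγη' s))
    rw [hUu, hXv, wron_eq_wkb (h.amp_ne (hγη s))] at h1
    rw [h1]
    simp only [hwe, hwo]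
    field_simp [hτ0 s]
  have hwetop : Tendsto we atTop (𝓝 (-(1 / 2) * Wron (u 0) (v 0) * Complex.exp (-(θ / hb)))) := by
    have h1 := (((hWo.const_mul 2).const_sub (Wron (u 0) (v 0))).div_const (-2)).mul
      (hX2.inv₀ (Complex.exp_ne_zero _))
    rw [mul_zero, sub_zero, ← Complex.exp_neg] at h1
    have h2 : ∀ᶠ s in atTop, (τ s)⁻¹ * wkbSnd (amp t₁ t₂ P Q) X (γ s) ≠ 0 :=
      hX2.eventually_ne (Complex.exp_ne_zero _)
    refine (h1.congr' ?_).trans_eq (by ring_nf)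
    filter_upwards [h2] with s hs
    rw [hW s, add_sub_cancel_right]
    rw [mul_assoc, mul_div_cancel_left₀ _ (by norm_num : (-2 : ℂ) ≠ 0), mul_inv_cancel_right₀ hs]
  exact hexp hb hhb we wo _ hwe' hwo' hwe0 hwo0 hwetop

end Barrier

/-- Under assumption (A), the potential has scattering asymptotics on a horizontal strip. -/
lemma exists_isScat {V : ℂ → ℂ} {Vm Vp : ℝ} (hA : AssumptionA V Vm Vp) :
    ∃ δ η : ℝ, 1 < δ ∧ δ ≤ 2 ∧ 0 < η ∧ η ≤ Real.pi / 4 ∧ IsScat (stdWeight δ) η V Vm Vp := by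
  obtain ⟨ε, hε, η, hη, δ, hδ, han, ⟨Cp, Rp, hp⟩, ⟨Cm, Rm, hm⟩⟩ := hA.sector
  have hsub : HStrip (-min η (Real.pi / 4)) (min η (Real.pi / 4)) ⊆ Sector ε η := fun x hx => by
    have h1 : |x.im| < min η (Real.pi / 4) := abs_lt.2 hx
    have h2 := min_le_left η (Real.pi / 4)
    have h3 : 0 ≤ ε * |x.re| := by positivity
    change |x.im| < ε * |x.re| + η
    linarith
  have hw : ∀ (C : ℝ) (x : ℂ),
      C * (1 + ‖x‖ ^ 2) ^ (-(δ / 2)) ≤ |C| * stdWeight (min δ 2) x.re := fun C x => by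
    have h1 : x.re ^ 2 ≤ ‖x‖ ^ 2 := sq_le_sq.2 (by simpa using Complex.abs_re_le_norm x)
    have h2 : (1 + ‖x‖ ^ 2) ^ (-(δ / 2)) ≤ stdWeight (min δ 2) x.re :=
      calc (1 + ‖x‖ ^ 2) ^ (-(δ / 2)) ≤ (1 + x.re ^ 2) ^ (-(δ / 2)) :=
            Real.rpow_le_rpow_of_nonpos (by positivity) (by linarith) (by linarith)
        _ ≤ _ := Real.rpow_le_rpow_of_exponent_le (by nlinarith [sq_nonneg x.re])
            (by linarith [min_le_left δ 2])
    exact mul_le_mul (le_abs_self C) h2 (by positivity) (abs_nonneg C)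
  refine ⟨min δ 2, min η (Real.pi / 4), lt_min hδ (by norm_num), min_le_right _ _,
    lt_min hη (by positivity), min_le_right _ _, ?_⟩
  exact ⟨fun x hx => (han x (hsub hx)).differentiableAt.differentiableWithinAt, hA.real_on_real,
    ⟨|Cm|, Rm, fun x hx hx' => (hm x (hsub hx) hx').trans (hw _ _)⟩,
    ⟨|Cp|, Rp, fun x hx hx' => (hp x (hsub hx) hx').trans (hw _ _)⟩⟩

lemma IsScat.const_sub_div {w : ℝ → ℝ} {η : ℝ} {f : ℂ → ℂ} {fm fp : ℝ} (h : IsScat w η f fm fp)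
    (k : ℝ) {c : ℝ} (hc : 0 < c) :
    IsScat w η (fun x => ((k : ℂ) - f x) / c) ((k - fm) / c) ((k - fp) / c) := by
  have key : ∀ (x : ℂ) (l : ℝ),
      ‖((k : ℂ) - f x) / c - (((k - l) / c : ℝ) : ℂ)‖ = ‖f x - l‖ / c := fun x l => by
    have e : ((k : ℂ) - f x) / c - (((k - l) / c : ℝ) : ℂ) = -((f x - l) / c) := by
      push_cast; ring
    rw [e, norm_neg, norm_div, Complex.norm_real, Real.norm_of_nonneg hc.le]
  obtain ⟨C, R, hb⟩ := h.bot
  obtain ⟨C', R', ht⟩ := h.top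
  refine ⟨(h.diff.const_sub _).div_const _, fun s => ?_, ⟨C / c, R, fun x hx hx' => ?_⟩,
    ⟨C' / c, R', fun x hx hx' => ?_⟩⟩
  · rw [← h.ofReal_re s, ← Complex.ofReal_sub, ← Complex.ofReal_div, Complex.ofReal_im]
  · rw [key, div_mul_eq_mul_div]
    exact div_le_div_of_nonneg_right (hb x hx hx') hc.le
  · rw [key, div_mul_eq_mul_div]
    exact div_le_div_of_nonneg_right (ht x hx hx') hc.le

lemma exists_le_eq_of_tendsto_atBot {f : ℝ → ℝ} (hf : Continuous f) {a k t : ℝ}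
    (hlim : Tendsto f atBot (𝓝 a)) (hak : a < k) (hk : k ≤ f t) : ∃ z ≤ t, f z = k := by
  obtain ⟨y, hy, hyt⟩ := ((hlim.eventually (gt_mem_nhds hak)).and (eventually_le_atBot t)).exists
  obtain ⟨z, hz, hzk⟩ := intermediate_value_Icc hyt hf.continuousOn ⟨hy.le, hk⟩
  exact ⟨z, hz.2, hzk⟩

/-- The leftmost turning point is of electronic, the rightmost of positronic type. -/
lemma turning_values {f : ℝ → ℝ} (hf : Continuous f) {a b E μ t₁ t₂ : ℝ}
    (hbot : Tendsto f atBot (𝓝 a)) (htop : Tendsto f atTop (𝓝 b)) (hμ : 0 < μ)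
    (ha : a < E - μ) (hb : E + μ < b) (ht : t₁ < t₂)
    (hz : ∀ x, f x = E - μ ∨ f x = E + μ ↔ x = t₁ ∨ x = t₂) :
    f t₁ = E - μ ∧ f t₂ = E + μ := by
  have h1 : f t₁ = E - μ := by
    rcases (hz t₁).2 (Or.inl rfl) with h | h
    · exact h
    · obtain ⟨z, hzt, hzk⟩ :=
        exists_le_eq_of_tendsto_atBot hf hbot ha (by linarith : E - μ ≤ f t₁)
      rcases (hz z).1 (Or.inl hzk) with rfl | rfl
      · linarith
      · linarith
  obtain ⟨y, hy⟩ := (htop.eventually (lt_mem_nhds hb)).exists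
  obtain ⟨z, -, hzk⟩ :=
    exists_le_eq_of_tendsto_atBot hf hbot (by linarith : a < E + μ) (le_of_lt hy)
  refine ⟨h1, ?_⟩
  rcases (hz z).1 (Or.inr hzk) with rfl | rfl
  · linarith
  · exact hzk

lemma IsScat.deriv_ne_zero {w : ℝ → ℝ} {η : ℝ} {V : ℂ → ℂ} {Vm Vp : ℝ}
    (h : IsScat w η V Vm Vp) (hη : 0 < η) {k E t c : ℝ} (hc : 0 < c) (l : ℝ)
    (hd : deriv (fun x : ℝ => k - ((V x).re - E) ^ 2) t ≠ 0) :
    deriv (fun x => ((l : ℂ) - V x) / c) t ≠ 0 := by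
  have h1 : HasDerivAt V (deriv V t) (t : ℂ) :=
    (h.diff.differentiableAt ((isOpen_HStrip _ _).mem_nhds (ofReal_mem hη t))).hasDerivAt
  rw [((h1.const_sub (l : ℂ)).div_const (c : ℂ)).deriv]
  intro h0
  have hc' : (c : ℂ) ≠ 0 := by exact_mod_cast hc.ne'
  have h2 : deriv V (t : ℂ) = 0 := by simpa [hc'] using h0
  rw [h2] at h1
  refine hd ((((h1.real_of_complex.sub_const E).pow 2).const_sub k).deriv.trans ?_)
  simp

/-- In the Klein region with two simple turning points the potential gives rise to a barrier. -/
theorem exists_barrier {m c Vm Vp E : ℝ} {V : ℂ → ℂ}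
    (hA : AssumptionA V Vm Vp) (hm : 0 < m) (hc : 0 < c)
    (hE1 : Vm + m * c ^ 2 < E) (hE2 : E < Vp - m * c ^ 2)
    {t₁ t₂ : ℝ} (ht12 : t₁ < t₂)
    (hzeros : ∀ x : ℝ, m ^ 2 * c ^ 4 - ((V x).re - E) ^ 2 = 0 ↔ x = t₁ ∨ x = t₂)
    (hsimp1 : deriv (fun x : ℝ => m ^ 2 * c ^ 4 - ((V x).re - E) ^ 2) t₁ ≠ 0)
    (hsimp2 : deriv (fun x : ℝ => m ^ 2 * c ^ 4 - ((V x).re - E) ^ 2) t₂ ≠ 0) :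
    ∃ (w : ℝ → ℝ) (η : ℝ) (P Q : ℂ → ℂ) (a₀ : ℝ), Barrier w η t₁ t₂
      (fun x => (((E + m * c ^ 2 : ℝ) : ℂ) - V x) / c)
      (fun x => (((E - m * c ^ 2 : ℝ) : ℂ) - V x) / c) P Q
      ((E + m * c ^ 2 - Vm) / c) ((E + m * c ^ 2 - Vp) / c)
      ((E - m * c ^ 2 - Vm) / c) ((E - m * c ^ 2 - Vp) / c) a₀ := by
  obtain ⟨δ, η, hδ, hδ2, hη, hη4, hV⟩ := exists_isScat hA
  have hw := isWeight_stdWeight hδ hδ2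
  have hμ : 0 < m * c ^ 2 := by positivity
  have hz : ∀ x : ℝ, (V x).re = E - m * c ^ 2 ∨ (V x).re = E + m * c ^ 2 ↔
      x = t₁ ∨ x = t₂ := fun x => by
    rw [← hzeros]
    have e : m ^ 2 * c ^ 4 - ((V x).re - E) ^ 2 =
      -(((V x).re - (E - m * c ^ 2)) * ((V x).re - (E + m * c ^ 2))) := by ring
    rw [e, neg_eq_zero, mul_eq_zero, sub_eq_zero, sub_eq_zero]
  obtain ⟨h1, h2⟩ := turning_values (hV.continuous_re hη) (hV.tendsto_re_bot hw hη)
    (hV.tendsto_re_top hw hη) hμ (by linarith) (by linarith) ht12 hz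
  have hc' : (c : ℂ) ≠ 0 := by exact_mod_cast hc.ne'
  have hne : ∀ (k s : ℝ), ((k : ℂ) - V s) / c = 0 ↔ (V s).re = k := fun k s => by
    rw [div_eq_zero_iff, or_iff_left hc', sub_eq_zero, ← hV.ofReal_re s, Complex.ofReal_inj,
      Complex.ofReal_re]
    exact eq_comm
  obtain ⟨hqp, η₁, hη1, hη1', Q, hQ, ⟨a, ha, hQa⟩, hqQ⟩ :=
    (hV.const_sub_div (E - m * c ^ 2) hc).exists_factor (t := t₁) hw hη hη4
      (div_pos (by linarith) hc) (div_neg_of_neg_of_pos (by linarith) hc).ne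
      ((hne _ _).2 h1) (hV.deriv_ne_zero hη hc _ hsimp1) (fun s hs h0 => by
        have h3 := (hne _ _).1 h0
        rcases (hz s).1 (Or.inl h3) with h4 | h4
        · exact hs h4
        · rw [h4] at h3; linarith) (exp_le_stdWeight hδ2 t₁)
  obtain ⟨hpp, η₂, hη2, hη2', P, hP, ⟨b, hb, hPb⟩, hpP⟩ :=
    (hV.const_sub_div (E + m * c ^ 2) hc).exists_factor (t := t₂) hw hη hη4
      (div_pos (by linarith) hc) (div_neg_of_neg_of_pos (by linarith) hc).ne
      ((hne _ _).2 h2) (hV.deriv_ne_zero hη hc _ hsimp2) (fun s hs h0 => by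
        have h3 := (hne _ _).1 h0
        rcases (hz s).1 (Or.inr h3) with h4 | h4
        · rw [h4] at h3; linarith
        · exact hs h4) (exp_le_stdWeight hδ2 t₂)
  have hpm : 0 < (E + m * c ^ 2 - Vm) / c := div_pos (by linarith) hc
  have hqm : 0 < (E - m * c ^ 2 - Vm) / c := div_pos (by linarith) hc
  have e1 : min η₁ η₂ ≤ η₁ := min_le_left _ _
  have e2 : min η₁ η₂ ≤ η₂ := min_le_right _ _
  have s1 : HStrip (-min η₁ η₂) (min η₁ η₂) ⊆ HStrip (-η₁) η₁ := HStrip_mono (by linarith) e1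
  have s2 : HStrip (-min η₁ η₂) (min η₁ η₂) ⊆ HStrip (-η₂) η₂ := HStrip_mono (by linarith) e2
  obtain ⟨a₀, ha₀, hl⟩ : ∃ a₀ > 0, a₀ ≤ a ∧ a₀ ≤ b ∧ a₀ ≤ (E + m * c ^ 2 - Vm) / c ∧
      a₀ ≤ -((E + m * c ^ 2 - Vp) / c) ∧ a₀ ≤ (E - m * c ^ 2 - Vm) / c ∧
      a₀ ≤ -((E - m * c ^ 2 - Vp) / c) :=
    ⟨min a (min b (min ((E + m * c ^ 2 - Vm) / c) (min (-((E + m * c ^ 2 - Vp) / c))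
      (min ((E - m * c ^ 2 - Vm) / c) (-((E - m * c ^ 2 - Vp) / c)))))),
      lt_min ha (lt_min hb (lt_min hpm (lt_min (by linarith) (lt_min hqm (by linarith))))),
      by simp only [← le_min_iff, le_refl]⟩
  obtain ⟨l1, l2, l3, l4, l5, l6⟩ := hl
  exact ⟨stdWeight δ, min η₁ η₂, P, Q, a₀, hw, exp_le_stdWeight hδ2, lt_min hη1 hη2,
    by linarith, ht12, (hV.const_sub_div _ hc).mono (by linarith),
    (hV.const_sub_div _ hc).mono (by linarith), hP.mono e2, hQ.mono e1, ha₀, l3, l4, l5, l6,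
    fun x hx => l2.trans (hPb x (s2 hx)), fun x hx => l1.trans (hQa x (s1 hx)),
    fun x hx => hpP x (s2 hx), fun x hx => hqQ x (s1 hx)⟩

lemma hasDerivAt_of_isDiracSolution {hb m c E : ℝ} {V : ℂ → ℂ} {u : ℝ → ℂ × ℂ}
    (hu : IsDiracSolution hb m c V E u) (hhb : 0 < hb) (hc : 0 < c) (s : ℝ) :
    HasDerivAt u (offDiag (Complex.I / hb * ((((E + m * c ^ 2 : ℝ) : ℂ) - V s) / c))
      (Complex.I / hb * ((((E - m * c ^ 2 : ℝ) : ℂ) - V s) / c)) (u s)) s := by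
  have hb' : (hb : ℂ) ≠ 0 := by exact_mod_cast hhb.ne'
  have hc' : (c : ℂ) ≠ 0 := by exact_mod_cast hc.ne'
  have h1 := hu.eq1 s
  have h2 := hu.eq2 s
  refine ((hu.diff1 s).hasDerivAt.prodMk (hu.diff2 s).hasDerivAt).congr_deriv ?_
  rw [offDiag_apply]
  push_cast
  refine Prod.ext ?_ ?_
  · dsimp only
    field_simp
    linear_combination Complex.I * h2 +
      (hb * c * deriv (fun y : ℝ => (u y).1) s) * Complex.I_sq
  · dsimp only
    field_simp
    linear_combination Complex.I * h1 +
      (hb * c * deriv (fun y : ℝ => (u y).2) s) * Complex.I_sq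

lemma wron_eq_of_hasDerivAt {α β : ℝ → ℂ} {u v : ℝ → ℂ × ℂ}
    (hu : ∀ s, HasDerivAt u (offDiag (α s) (β s) (u s)) s)
    (hv : ∀ s, HasDerivAt v (offDiag (α s) (β s) (v s)) s) (x y : ℝ) :
    Wron (u x) (v x) = Wron (u y) (v y) := by
  have h1 : ∀ {u : ℝ → ℂ × ℂ}, (∀ s, HasDerivAt u (offDiag (α s) (β s) (u s)) s) → ∀ s,
      HasDerivAt (fun s => (u s).1) (α s * (u s).2) s := fun hu s => by
    simpa [Function.comp_def] using
      (ContinuousLinearMap.fst ℝ ℂ ℂ).hasFDerivAt.comp_hasDerivAt s (hu s)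
  have h2 : ∀ {u : ℝ → ℂ × ℂ}, (∀ s, HasDerivAt u (offDiag (α s) (β s) (u s)) s) → ∀ s,
      HasDerivAt (fun s => (u s).2) (β s * (u s).1) s := fun hu s => by
    simpa [Function.comp_def] using
      (ContinuousLinearMap.snd ℝ ℂ ℂ).hasFDerivAt.comp_hasDerivAt s (hu s)
  have h3 : ∀ s, HasDerivAt (fun s => Wron (u s) (v s)) 0 s := fun s =>
    (((h1 hu s).mul (h2 hv s)).sub ((h2 hu s).mul (h1 hv s))).congr_deriv (by ring)
  exact is_const_of_deriv_eq_zero (fun s => (h3 s).differentiableAt) (fun s => (h3 s).deriv) x y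

/-- Asymptotically opposite exponentials determine a constant Wronskian. -/
lemma wron_eq_of_jostAsymp {u v : ℝ → ℂ × ℂ} {θ : ℂ} {a b : ℂ × ℂ} {l : Filter ℝ} [l.NeBot]
    (hu : JostAsymp u θ a l) (hv : JostAsymp v (-θ) b l)
    (hconst : ∀ x y, Wron (u x) (v x) = Wron (u y) (v y)) (x : ℝ) :
    Wron (u x) (v x) = Wron a b := by
  have h1 := (hu.1.mul hv.2).sub (hu.2.mul hv.1)
  refine tendsto_nhds_unique (tendsto_const_nhds (f := l)) (h1.congr fun y => ?_)
  rw [hconst x y]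
  have : Complex.exp (-(θ * y)) * Complex.exp (-(-θ * y)) = 1 := by
    rw [← Complex.exp_add]; simp
  simp only [Wron]
  linear_combination ((u y).1 * (v y).2 - (u y).2 * (v y).1) * this

lemma JostAsymp.tendsto_smul {u : ℝ → ℂ × ℂ} {θ : ℂ} {a : ℂ × ℂ} {l : Filter ℝ}
    (hu : JostAsymp u θ a l) :
    Tendsto (fun s : ℝ => Complex.exp (-(θ * s)) • u s) l (𝓝 a) := by
  refine (hu.1.prodMk_nhds hu.2).congr fun s => Prod.ext ?_ ?_ <;> simp [mul_comm]

lemma sqrt_sq_sub (m E W : ℝ) {c : ℝ} (hc : 0 < c) :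
    Real.sqrt ((E - W) ^ 2 - m ^ 2 * c ^ 4) =
      c * Real.sqrt ((E - m * c ^ 2 - W) / c * ((E + m * c ^ 2 - W) / c)) := by
  have e : (E - W) ^ 2 - m ^ 2 * c ^ 4 =
      c ^ 2 * ((E - m * c ^ 2 - W) / c * ((E + m * c ^ 2 - W) / c)) := by
    field_simp
    ring
  rw [e, Real.sqrt_mul (by positivity), Real.sqrt_sq hc.le]

lemma phiF_of_pos {m c E W : ℝ} (hm : 0 < m) (hc : 0 < c) (hW : W + m * c ^ 2 < E) :
    PhiF m c (E - W) =
      c * Real.sqrt ((E - m * c ^ 2 - W) / c * ((E + m * c ^ 2 - W) / c)) := by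
  have : 0 < m * c ^ 2 := by positivity
  rw [PhiF, Real.sign_of_pos (by linarith), one_mul, sqrt_sq_sub m E W hc]

lemma phiF_of_neg {m c E W : ℝ} (hm : 0 < m) (hc : 0 < c) (hW : E < W - m * c ^ 2) :
    PhiF m c (E - W) =
      -(c * Real.sqrt ((E - m * c ^ 2 - W) / c * ((E + m * c ^ 2 - W) / c))) := by
  have : 0 < m * c ^ 2 := by positivity
  rw [PhiF, Real.sign_of_neg (by linarith), neg_one_mul, sqrt_sq_sub m E W hc]

lemma ampF_eq (m E W : ℝ) {c : ℝ} (hc : 0 < c) :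
    AmpF m c (E - W) =
      (((E + m * c ^ 2 - W) / c) / ((E - m * c ^ 2 - W) / c)) ^ (1 / 4 : ℝ) := by
  rw [AmpF, div_div_div_cancel_right₀ hc.ne']
  congr 2 <;> ring

lemma esym_eq (m E W : ℝ) {c : ℝ} (hc : 0 < c) :
    Esym m c E W = (E - m * c ^ 2 - W) / c * ((E + m * c ^ 2 - W) / c) := by
  rw [Esym]
  field_simp
  ring

lemma tunnelPhase_eq (m E Vm Vp t₁ t₂ : ℝ) (V : ℂ → ℂ) {c : ℝ} (hc : 0 < c) :
    tunnelPhase t₁ t₂ (fun x => (((E + m * c ^ 2 : ℝ) : ℂ) - V x) / c)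
      (fun x => (((E - m * c ^ 2 : ℝ) : ℂ) - V x) / c)
      ((E + m * c ^ 2 - Vm) / c) ((E + m * c ^ 2 - Vp) / c)
      ((E - m * c ^ 2 - Vm) / c) ((E - m * c ^ 2 - Vp) / c) =
    Complex.I * ((((∫ t in Set.Iic t₁, Qsym m c E Vm V t)
        + Real.sqrt (Esym m c E Vm) * t₁ : ℝ)) : ℂ)
      + Complex.I * ((((-∫ t in Set.Ici t₂, Qsym m c E Vp V t)
        + Real.sqrt (Esym m c E Vp) * t₂ : ℝ)) : ℂ)
      + ((SAct m c E V t₁ t₂ : ℝ) : ℂ) := by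
  have hre : ∀ (k t : ℝ), (((k : ℂ) - V t) / c).re = (k - (V t).re) / c := fun k t => by
    rw [Complex.div_ofReal_re, Complex.sub_re, Complex.ofReal_re]
  have e1 : ∀ t : ℝ, (E + m * c ^ 2 - (V t).re) / c * ((E - m * c ^ 2 - (V t).re) / c) =
      (-(m ^ 2 * c ^ 4) + ((V t).re - E) ^ 2) / c ^ 2 := fun t => by
    field_simp
    ring
  have e2 : ∀ t : ℝ, -((-(m ^ 2 * c ^ 4) + ((V t).re - E) ^ 2) / c ^ 2) =
      (m ^ 2 * c ^ 4 - ((V t).re - E) ^ 2) / c ^ 2 := fun t => by ring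
  simp only [tunnelPhase, hre, e1, e2, ← esym_eq _ _ _ hc, Qsym, SAct]

end KleinTunneling

/-- **Tunneling Wronskian in the Klein paradox case** (Section 5).  Under
assumption (A), `m > 0`, `E` in region III, and exactly two simple real zeros
`t₁ < t₂` of `m²c⁴ − (V(x)−E)²`:  `W(ω_out^+, ω_in^+) = −2` and there is a
classical analytic symbol `φ` of non-negative order with
`W(ω_in^−, ω_in^+) = −2(1+hφ(h)) exp{(1/h)(z(t₁,−∞) + z(t₂,+∞) + S(E))}`,
where `z(t₁,−∞) = i(∫_{−∞}^{t₁} Q⁻ + √E⁻ t₁)` and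
`z(t₂,+∞) = i(−∫_{t₂}^{∞} Q⁺ + √E⁺ t₂)` are purely imaginary. -/
theorem tunneling_wronskian_klein
    (m c Vm Vp E : ℝ) (V : ℂ → ℂ)
    (hA : AssumptionA V Vm Vp) (hm : 0 < m) (hc : 0 < c)
    (hE1 : Vm + m * c ^ 2 < E) (hE2 : E < Vp - m * c ^ 2)
    (t₁ t₂ : ℝ) (ht12 : t₁ < t₂)
    (hzeros : ∀ x : ℝ, m ^ 2 * c ^ 4 - ((V x).re - E) ^ 2 = 0 ↔ x = t₁ ∨ x = t₂)
    (hsimp1 : deriv (fun x : ℝ => m ^ 2 * c ^ 4 - ((V x).re - E) ^ 2) t₁ ≠ 0)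
    (hsimp2 : deriv (fun x : ℝ => m ^ 2 * c ^ 4 - ((V x).re - E) ^ 2) t₂ ≠ 0)
    (ωinm ωinp ωoutp : ℝ → ℝ → ℂ × ℂ)
    (hsol : ∀ h : ℝ, 0 < h →
      IsDiracSolution h m c V E (ωinm h) ∧ IsDiracSolution h m c V E (ωinp h) ∧
      IsDiracSolution h m c V E (ωoutp h))
    (hjost : ∀ h : ℝ, 0 < h →
      JostCond h m c E Vm 1 1 atBot (ωinm h) ∧
      JostCond h m c E Vp (-1) (-1) atTop (ωinp h) ∧
      JostCond h m c E Vp 1 1 atTop (ωoutp h)) :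
    ∃ φ : ℝ → ℂ, IsCAS φ ∧
      ∃ h₀ > (0 : ℝ), ∀ h : ℝ, 0 < h → h < h₀ →
        (∀ x : ℝ, Wron (ωoutp h x) (ωinp h x) = -2) ∧
        (∀ x : ℝ, Wron (ωinm h x) (ωinp h x) =
          -2 * (1 + (h : ℂ) * φ h)
            * Complex.exp ((1 / (h : ℂ)) *
              (Complex.I * ((((∫ t in Set.Iic t₁, Qsym m c E Vm V t)
                  + Real.sqrt (Esym m c E Vm) * t₁ : ℝ)) : ℂ)
               + Complex.I * ((((-∫ t in Set.Ici t₂, Qsym m c E Vp V t)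
                  + Real.sqrt (Esym m c E Vp) * t₂ : ℝ)) : ℂ)
               + ((SAct m c E V t₁ t₂ : ℝ) : ℂ)))) := by
  obtain ⟨w, η, P, Q, a₀, hB⟩ := KleinTunneling.exists_barrier hA hm hc hE1 hE2 ht12 hzeros
    hsimp1 hsimp2
  obtain ⟨a, B, D, hB0, hD0, ha0, ha, hexp⟩ := hB.exists_wron_expansion
  rw [KleinTunneling.tunnelPhase_eq m E Vm Vp t₁ t₂ V hc] at hexp
  set T : ℂ := Complex.I * ((((∫ t in Set.Iic t₁, Qsym m c E Vm V t)
      + Real.sqrt (Esym m c E Vm) * t₁ : ℝ)) : ℂ)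
    + Complex.I * ((((-∫ t in Set.Ici t₂, Qsym m c E Vp V t)
      + Real.sqrt (Esym m c E Vp) * t₂ : ℝ)) : ℂ)
    + ((SAct m c E V t₁ t₂ : ℝ) : ℂ) with hT
  have hc' : (c : ℂ) ≠ 0 := by exact_mod_cast hc.ne'
  refine ⟨fun h => (-(1 / 2) * Wron (ωinm h 0) (ωinp h 0) * Complex.exp (-(T / h)) - 1) / h,
    KleinTunneling.isCAS_of_expansion hB0 hD0 ha0 ha fun h hh N => ?_, 1, one_pos,
    fun h hh _ => ⟨fun x => ?_, fun x => ?_⟩⟩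
  · obtain ⟨hm1, hp1, -⟩ := hsol h hh
    obtain ⟨hm2, hp2, -⟩ := hjost h hh
    have hh' : (h : ℂ) ≠ 0 := by exact_mod_cast hh.ne'
    refine hexp h hh _ _ (KleinTunneling.hasDerivAt_of_isDiracSolution hm1 hh hc)
      (KleinTunneling.hasDerivAt_of_isDiracSolution hp1 hh hc) ?_ ?_ N
    · have := KleinTunneling.JostAsymp.tendsto_smul hm2
      rw [KleinTunneling.phiF_of_pos hm hc hE1, KleinTunneling.ampF_eq m E Vm hc] at this
      refine Tendsto.congr (fun s => ?_) (this.trans_eq ?_)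
      · congr 3
        push_cast
        field_simp
      · simp
    · have := KleinTunneling.JostAsymp.tendsto_smul hp2
      rw [KleinTunneling.phiF_of_neg hm hc hE2, KleinTunneling.ampF_eq m E Vp hc] at this
      refine Tendsto.congr (fun s => ?_) (this.trans_eq ?_)
      · congr 3
        push_cast
        field_simp
      · simp
  · obtain ⟨-, hp1, ho1⟩ := hsol h hh
    obtain ⟨-, hp2, ho2⟩ := hjost h hh
    have hpos : 0 < AmpF m c (E - Vp) := by
      have : 0 < m * c ^ 2 := by positivity
      exact Real.rpow_pos_of_pos (div_pos_of_neg_of_neg (by linarith) (by linarith)) _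
    have hA0 : ((AmpF m c (E - Vp) : ℝ) : ℂ) ≠ 0 := by exact_mod_cast hpos.ne'
    rw [KleinTunneling.wron_eq_of_jostAsymp ho2 (v := ωinp h) (b := _) (by
      have := hp2
      rw [JostCond] at this
      convert this using 1
      push_cast
      ring) (KleinTunneling.wron_eq_of_hasDerivAt
        (KleinTunneling.hasDerivAt_of_isDiracSolution ho1 hh hc)
        (KleinTunneling.hasDerivAt_of_isDiracSolution hp1 hh hc)) x]
    simp only [Wron]
    push_cast
    field_simp
    norm_num
  · obtain ⟨hm1, hp1, -⟩ := hsol h hh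
    have hh' : (h : ℂ) ≠ 0 := by exact_mod_cast hh.ne'
    rw [KleinTunneling.wron_eq_of_hasDerivAt
        (KleinTunneling.hasDerivAt_of_isDiracSolution hm1 hh hc)
        (KleinTunneling.hasDerivAt_of_isDiracSolution hp1 hh hc) x 0, mul_div_cancel₀ _ hh',
      one_div_mul_eq_div, add_sub_cancel]
    have : Complex.exp (-(T / h)) * Complex.exp (T / h) = 1 := by
      rw [← Complex.exp_add, neg_add_cancel, Complex.exp_zero]
    linear_combination -(Wron (ωinm h 0) (ωinp h 0)) * this
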